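/- Let Ω ⊂ ℝⁿ be open and u ∈ BV_loc(Ω) ∩ L^∞_loc(Ω). Then there exists a sequence (v_ℓ) in W^{1,1}_loc(Ω) ∩ L^∞_loc(Ω) such that v_1 ≥ v_ℓ ≥ u holds Lebesgue-a.e. on Ω for every ℓ ∈ ℕ, and such that the precise representatives v_ℓ* converge H^{n-1}-a.e. on Ω to u⁺, the representative of u taking the Lebesgue value at approximate continuity points and the larger of the two jump values at approximate jump points. -/

import Mathlib

open MeasureTheory Set Filter Topology Metric
open scoped RealInnerProductSpace ENNReal

noncomputable section

/-- Euclidean space `ℝⁿ`. -/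
abbrev Eu (n : ℕ) : Type := EuclideanSpace ℝ (Fin n)

/-- `(n-1)`-dimensional Hausdorff measure on `ℝⁿ`. -/
def hm (n : ℕ) : Measure (Eu n) := μH[(n : ℝ) - 1]

/-- Smooth test functions compactly supported in `Ω`. -/
def IsTest {n : ℕ} (Ω : Set (Eu n)) (φ : Eu n → ℝ) : Prop :=
  ContDiff ℝ (⊤ : ℕ∞) φ ∧ HasCompactSupport φ ∧ tsupport φ ⊆ Ω

/-- `σ ∈ L^∞(Ω, ℝⁿ)` with `‖σ‖ ≤ C` a.e. on `Ω`. -/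
def Bdd {n : ℕ} (Ω : Set (Eu n)) (σ : Eu n → Eu n) (C : ℝ) : Prop :=
  AEStronglyMeasurable σ (volume.restrict Ω) ∧ ∀ᵐ x ∂(volume.restrict Ω), ‖σ x‖ ≤ C

/-- `σ ∈ L^∞_loc(Ω, ℝⁿ)`. -/
def LocBdd {n : ℕ} (Ω : Set (Eu n)) (σ : Eu n → Eu n) : Prop :=
  AEStronglyMeasurable σ (volume.restrict Ω) ∧
  ∀ K : Set (Eu n), K ⊆ Ω → IsCompact K → ∃ C : ℝ, ∀ᵐ x ∂(volume.restrict K), ‖σ x‖ ≤ C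

/-- scalar `u ∈ L^∞_loc(Ω)`. -/
def LocBddFun {n : ℕ} (Ω : Set (Eu n)) (u : Eu n → ℝ) : Prop :=
  AEStronglyMeasurable u (volume.restrict Ω) ∧
  ∀ K : Set (Eu n), K ⊆ Ω → IsCompact K → ∃ C : ℝ, ∀ᵐ x ∂(volume.restrict K), |u x| ≤ C

/-- scalar `u ∈ L^∞(Ω)` with bound `C`. -/
def BddFun {n : ℕ} (Ω : Set (Eu n)) (u : Eu n → ℝ) (C : ℝ) : Prop :=
  AEStronglyMeasurable u (volume.restrict Ω) ∧ ∀ᵐ x ∂(volume.restrict Ω), |u x| ≤ C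

/-- A measure carried by `Ω` which is finite on compact subsets of `Ω` (Radon on `Ω`). -/
def LocFinOn {n : ℕ} (Ω : Set (Eu n)) (μ : Measure (Eu n)) : Prop :=
  (∀ K : Set (Eu n), K ⊆ Ω → IsCompact K → μ K < ⊤) ∧ μ Ωᶜ = 0

/-- A finite measure carried by `Ω`. -/
def FinOn {n : ℕ} (Ω : Set (Eu n)) (μ : Measure (Eu n)) : Prop :=
  μ univ < ⊤ ∧ μ Ωᶜ = 0

/-- The (signed) measure `μp - μn` represents `-Div σ` on `Ω`: for every test function `φ`
compactly supported in `Ω` one has `∫_Ω σ·∇φ dx = ∫ φ dμp - ∫ φ dμn`. -/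
def RepNegDiv {n : ℕ} (Ω : Set (Eu n)) (σ : Eu n → Eu n) (μp μn : Measure (Eu n)) : Prop :=
  ∀ φ : Eu n → ℝ, IsTest Ω φ →
    ∫ x in Ω, ⟪σ x, gradient φ x⟫ = (∫ x, φ x ∂μp) - ∫ x, φ x ∂μn

/-- `Div σ ≤ 0` in the sense of distributions on `Ω`. -/
def DivNonpos {n : ℕ} (Ω : Set (Eu n)) (σ : Eu n → Eu n) : Prop :=
  ∀ φ : Eu n → ℝ, IsTest Ω φ → (∀ x, 0 ≤ φ x) → 0 ≤ ∫ x in Ω, ⟪σ x, gradient φ x⟫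

/-- The set `A` has Lebesgue density zero at the point `x`. -/
def DensityZeroAt {n : ℕ} (A : Set (Eu n)) (x : Eu n) : Prop :=
  Tendsto (fun r : ℝ => volume (A ∩ ball x r) / volume (ball x r)) (𝓝[>] 0) (𝓝 0)

/-- The upper (approximate) representative `u⁺`: Lebesgue value at approximate continuity
points, larger jump value at approximate jump points. -/
def upperRep {n : ℕ} (u : Eu n → ℝ) (x : Eu n) : ℝ :=
  sInf {t : ℝ | DensityZeroAt {y | t < u y} x}

/-- The lower (approximate) representative `u⁻`. -/
def lowerRep {n : ℕ} (u : Eu n → ℝ) (x : Eu n) : ℝ :=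
  sSup {t : ℝ | DensityZeroAt {y | u y < t} x}

/-- The precise (mean-value) representative `u* = (u⁺ + u⁻)/2`. -/
def preciseRep {n : ℕ} (u : Eu n → ℝ) (x : Eu n) : ℝ := (upperRep u x + lowerRep u x) / 2

/-- `Du = θ·ν` is the gradient measure of `u` on `Ω` with total variation `ν` and
polar vector `θ` (so `ν = |Du|`). -/
def HasGradMeasure {n : ℕ} (Ω : Set (Eu n)) (u : Eu n → ℝ) (ν : Measure (Eu n))
    (θ : Eu n → Eu n) : Prop :=
  (∀ᵐ x ∂ν, ‖θ x‖ = 1) ∧ ν Ωᶜ = 0 ∧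
  ∀ φ : Eu n → ℝ, IsTest Ω φ → ∫ x in Ω, u x • gradient φ x = - ∫ x, φ x • θ x ∂ν

/-- `u ∈ BV_loc(Ω)`. -/
def MemBVLoc {n : ℕ} (Ω : Set (Eu n)) (u : Eu n → ℝ) : Prop :=
  LocallyIntegrableOn u Ω ∧
  ∃ ν θ, LocFinOn Ω ν ∧ HasGradMeasure Ω u ν θ

/-- `g` is the weak (Sobolev) gradient of `u ∈ W^{1,1}(Ω)`. -/
def HasSobGrad {n : ℕ} (Ω : Set (Eu n)) (u : Eu n → ℝ) (g : Eu n → Eu n) : Prop :=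
  IntegrableOn g Ω ∧
  ∀ φ : Eu n → ℝ, IsTest Ω φ → ∫ x in Ω, u x • gradient φ x = - ∫ x in Ω, φ x • g x

/-- `u ∈ W^{1,1}(Ω)`. -/
def MemW11 {n : ℕ} (Ω : Set (Eu n)) (u : Eu n → ℝ) : Prop :=
  IntegrableOn u Ω ∧ ∃ g, HasSobGrad Ω u g

/-- `u ∈ W^{1,1}_loc(Ω)` with weak gradient `g`. -/
def HasSobGradLoc {n : ℕ} (Ω : Set (Eu n)) (u : Eu n → ℝ) (g : Eu n → Eu n) : Prop :=
  LocallyIntegrableOn g Ω ∧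
  ∀ φ : Eu n → ℝ, IsTest Ω φ → ∫ x in Ω, u x • gradient φ x = - ∫ x in Ω, φ x • g x

def MemW11Loc {n : ℕ} (Ω : Set (Eu n)) (u : Eu n → ℝ) : Prop :=
  LocallyIntegrableOn u Ω ∧ ∃ g, HasSobGradLoc Ω u g

/-- `T` is the interior trace of `u` on `∂Ω`, characterized `H^{n-1}`-a.e. on `∂Ω`
by convergence of interior mean values. -/
def IsIntTrace {n : ℕ} (Ω : Set (Eu n)) (u T : Eu n → ℝ) : Prop :=
  ∀ᵐ x ∂((hm n).restrict (frontier Ω)),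
    Tendsto (fun r : ℝ => (∫ y in Ω ∩ ball x r, |u y - T x|) / (volume (ball x r)).toReal)
      (𝓝[>] 0) (𝓝 0)

/-- The domain assumption `H^{n-1}(∂Ω) = P(Ω) < ∞`, in the equivalent form
`𝟙_Ω ∈ BV(ℝⁿ)` with `|D𝟙_Ω| = H^{n-1}⌞∂Ω`. -/
def DomainAssum {n : ℕ} (Ω : Set (Eu n)) : Prop :=
  hm n (frontier Ω) < ⊤ ∧
  ∃ θ, HasGradMeasure (univ : Set (Eu n)) (Ω.indicator fun _ => (1 : ℝ))
    ((hm n).restrict (frontier Ω)) θ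

/-- `g` is the normal trace `σ_n*` of `σ` on `∂Ω`, characterized by the Gauss–Green
formula for `W^{1,1} ∩ L^∞` functions; here `μ = -Div σ ≥ 0`. -/
def IsNormalTrace {n : ℕ} (Ω : Set (Eu n)) (σ : Eu n → Eu n) (μ : Measure (Eu n))
    (g : Eu n → ℝ) : Prop :=
  ∀ (v : Eu n → ℝ) (gv : Eu n → Eu n) (T : Eu n → ℝ),
    MemW11 Ω v → (∃ C, BddFun Ω v C) → HasSobGrad Ω v gv → IsIntTrace Ω v T →
    ∀ φ : Eu n → ℝ, IsTest (univ : Set (Eu n)) φ →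
      (- ∫ x in Ω, v x * ⟪σ x, gradient φ x⟫) + (∫ x, φ x * preciseRep v x ∂μ)
        = (∫ x in Ω, φ x * ⟪σ x, gv x⟫) + ∫ x in frontier Ω, φ x * T x * g x ∂(hm n)

/-- Weakly super-1-harmonic: there is `σ ∈ L^∞` with `|σ| ≤ 1` a.e., `Div σ ≤ 0`,
and `⟨σ, Du⁺⟩ = |Du|` as measures on `Ω`. -/
def SuperOneHarmonic {n : ℕ} (Ω : Set (Eu n)) (u : Eu n → ℝ) : Prop :=
  MemBVLoc Ω u ∧ LocBddFun Ω u ∧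
  ∃ σ : Eu n → Eu n, ∃ μ : Measure (Eu n),
    Bdd Ω σ 1 ∧ DivNonpos Ω σ ∧ RepNegDiv Ω σ μ 0 ∧ LocFinOn Ω μ ∧
    ∃ ν θ, LocFinOn Ω ν ∧ HasGradMeasure Ω u ν θ ∧
      ∀ φ : Eu n → ℝ, IsTest Ω φ →
        (- ∫ x in Ω, u x * ⟪σ x, gradient φ x⟫) + (∫ x, φ x * upperRep u x ∂μ)
          = ∫ x, φ x ∂ν

/-- The distributional derivative of `f` on `U` is dominated by the measure `ν`. -/
def VarBound {n : ℕ} (U : Set (Eu n)) (f : Eu n → ℝ) (ν : Measure (Eu n)) : Prop :=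
  ∀ φ : Eu n → ℝ, IsTest U φ → ∀ h : Eu n,
    ‖∫ x, f x * fderiv ℝ φ x h‖ₑ ≤ ‖h‖ₑ * ∫⁻ x, ‖φ x‖ₑ ∂ν

/-- The mollification of `f` by a bump function. -/
def mollify {n : ℕ} (b : ContDiffBump (0 : Eu n)) (f : Eu n → ℝ) : Eu n → ℝ :=
  convolution f (b.normed volume) (ContinuousLinearMap.lsmul ℝ ℝ).flip volume

lemma mollify_ae_tendsto {n : ℕ} {f : Eu n → ℝ} (hf : LocallyIntegrable f volume)
    {b : ℕ → ContDiffBump (0 : Eu n)} (hb : ∀ k, (b k).rOut = 2 * (b k).rIn)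
    (h0 : Tendsto (fun k => (b k).rOut) atTop (𝓝 0)) :
    ∀ᵐ x, Tendsto (fun k => mollify (b k) f x) atTop (𝓝 (f x)) := by
  have := ContDiffBump.ae_convolution_tendsto_right_of_locallyIntegrable (μ := volume) (K := 2)
    h0 (Eventually.of_forall fun k => (hb k).le) hf
  filter_upwards [this] with x hx
  simpa only [mollify, convolution_flip] using hx

lemma exists_hasFDerivAt_mollify {n : ℕ} {f : Eu n → ℝ} (hf : LocallyIntegrable f volume)
    (b : ContDiffBump (0 : Eu n)) {U : Set (Eu n)} {ν : Measure (Eu n)} (hν : VarBound U f ν) :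
    ∃ D : Eu n → Eu n →L[ℝ] ℝ, Continuous D ∧ (∀ z, HasFDerivAt (mollify b f) (D z) z) ∧
      ∀ z h, closedBall z b.rOut ⊆ U →
        ‖D z h‖ₑ ≤ ‖h‖ₑ * ∫⁻ y, ‖b.normed volume (z - y)‖ₑ ∂ν := by
  set η := b.normed volume with hη
  have hηs : HasCompactSupport η := b.hasCompactSupport_normed
  have hηc : ContDiff ℝ (⊤ : ℕ∞) η := b.contDiff_normed
  have hη1 : ContDiff ℝ 1 η := b.contDiff_normed
  have hd := fun z => hηs.hasFDerivAt_convolution_right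
    (ContinuousLinearMap.lsmul ℝ ℝ : ℝ →L[ℝ] ℝ →L[ℝ] ℝ).flip hf hη1 z
  refine ⟨_, ?_, hd, ?_⟩
  · exact (hηs.fderiv ℝ).continuous_convolution_right _ hf (hη1.continuous_fderiv one_ne_zero)
  intro z h hz
  rw [convolution_precompR_apply _ hf (hηs.fderiv ℝ) (hη1.continuous_fderiv one_ne_zero)]
  have hsupp : tsupport (fun y => η (z - y)) ⊆ closedBall z b.rOut := by
    apply closure_minimal _ isClosed_closedBall
    intro y hy
    have : z - y ∈ Function.support η := hy
    rw [hη, b.support_normed_eq, mem_ball_zero_iff] at this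
    rw [mem_closedBall, dist_comm, dist_eq_norm]; exact this.le
  have htest : IsTest U (fun y => η (z - y)) :=
    ⟨hηc.comp (contDiff_const.sub contDiff_id),
      (isCompact_closedBall z b.rOut).of_isClosed_subset (isClosed_tsupport _) hsupp,
      hsupp.trans hz⟩
  have h1 := hν _ htest h
  have h2 : ∀ y, fderiv ℝ (fun y => η (z - y)) y h = - fderiv ℝ η (z - y) h := by
    intro y
    have h3 : HasFDerivAt (fun y => η (z - y))
        ((fderiv ℝ η (z - y)).comp (-ContinuousLinearMap.id ℝ (Eu n))) y :=
      ((hη1.differentiable one_ne_zero _).hasFDerivAt).comp y ((hasFDerivAt_id y).const_sub z)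
    rw [h3.fderiv]; simp
  simp only [h2, mul_neg, integral_neg, enorm_neg] at h1
  refine le_trans (le_of_eq ?_) h1
  simp [convolution, mul_comm]

theorem VarBound.lintegral_translate_le {n : ℕ} {f : Eu n → ℝ} (hf : LocallyIntegrable f volume)
    {U W A : Set (Eu n)} {ν : Measure (Eu n)} [SFinite ν] (hν : VarBound U f ν)
    (hA : MeasurableSet A) (hW : MeasurableSet W) (hWU : W ⊆ U) {δ : ℝ} (hδ : 0 < δ) (h : Eu n)
    (hAW : ∀ x ∈ A, ∀ s ∈ Icc (0 : ℝ) 1, closedBall (x + s • h) δ ⊆ W) :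
    ∫⁻ x in A, ‖f (x + h) - f x‖ₑ ≤ ‖h‖ₑ * ν W := by
  let b : ℕ → ContDiffBump (0 : Eu n) := fun k =>
    ⟨δ / (2 * (k + 1)), δ / (k + 1), by positivity, by
      apply div_lt_div_of_pos_left hδ <;> linarith⟩
  have hb : ∀ k, (b k).rOut = 2 * (b k).rIn := by intro k; simp only [b]; field_simp
  have hbδ : ∀ k, (b k).rOut ≤ δ := by
    intro k; simp only [b]; apply div_le_self hδ.le; linarith [k.cast_nonneg (α := ℝ)]
  have h0 : Tendsto (fun k => (b k).rOut) atTop (𝓝 0) := by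
    simpa using (tendsto_one_div_add_atTop_nhds_zero_nat (𝕜 := ℝ)).const_mul δ |>.congr
      (fun k => by simp only [b]; ring)
  have key : ∀ k, ∫⁻ x in A, ‖mollify (b k) f (x + h) - mollify (b k) f x‖ₑ ≤ ‖h‖ₑ * ν W := by
    intro k
    obtain ⟨D, hDc, hD, hDb⟩ := exists_hasFDerivAt_mollify hf (b k) hν
    set η := (b k).normed volume with hη
    have hηc : Continuous η := (b k).continuous_normed
    have hηm : Measurable η := hηc.measurable
    have hpt : ∀ x ∈ A, ‖mollify (b k) f (x + h) - mollify (b k) f x‖ₑ ≤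
        ∫⁻ s in Ioc (0:ℝ) 1, ‖h‖ₑ * ∫⁻ y in W, ‖η (x + s • h - y)‖ₑ ∂ν := by
      intro x hx
      have hder : ∀ s : ℝ, HasDerivAt (fun s : ℝ => mollify (b k) f (x + s • h))
          (D (x + s • h) h) s := by
        intro s
        have := (hD (x + s • h)).comp_hasDerivAt s
          (((hasDerivAt_id s).smul_const h).const_add x)
        simpa [Function.comp_def] using this
      have hcont : Continuous fun s : ℝ => D (x + s • h) h := by fun_prop
      have hint := intervalIntegral.integral_eq_sub_of_hasDerivAt (a := 0) (b := 1)
        (fun s _ => hder s) (hcont.intervalIntegrable _ _)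
      simp only [one_smul, zero_smul, add_zero] at hint
      rw [← hint, intervalIntegral.integral_of_le zero_le_one]
      refine (enorm_integral_le_lintegral_enorm _).trans ?_
      apply setLIntegral_mono_ae' measurableSet_Ioc
      refine Eventually.of_forall fun s hs => ?_
      have hball := hAW x hx s ⟨hs.1.le, hs.2⟩
      refine (hDb _ h (((closedBall_subset_closedBall (hbδ k)).trans hball).trans hWU)).trans ?_
      refine mul_le_mul_right ?_ _
      rw [← lintegral_indicator hW]
      apply lintegral_mono
      intro y
      by_cases hy : y ∈ W
      · simp [hy, hη]
      · have : η (x + s • h - y) = 0 := by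
          by_contra hne
          have hm : x + s • h - y ∈ Function.support η := hne
          rw [hη, (b k).support_normed_eq, mem_ball_zero_iff] at hm
          apply hy; apply hball
          rw [mem_closedBall, dist_comm, dist_eq_norm]
          exact hm.le.trans (hbδ k)
        change ‖η (x + s • h - y)‖ₑ ≤ _
        rw [this]; simp
    calc ∫⁻ x in A, ‖mollify (b k) f (x + h) - mollify (b k) f x‖ₑ
        ≤ ∫⁻ x in A, ∫⁻ s in Ioc (0:ℝ) 1, ‖h‖ₑ * ∫⁻ y in W, ‖η (x + s • h - y)‖ₑ ∂ν :=
          setLIntegral_mono_ae' hA (Eventually.of_forall hpt)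
      _ ≤ ∫⁻ x, ∫⁻ s in Ioc (0:ℝ) 1, ‖h‖ₑ * ∫⁻ y in W, ‖η (x + s • h - y)‖ₑ ∂ν :=
          setLIntegral_le_lintegral _ _
      _ = ∫⁻ s in Ioc (0:ℝ) 1, ∫⁻ x, ‖h‖ₑ * ∫⁻ y in W, ‖η (x + s • h - y)‖ₑ ∂ν := by
          apply lintegral_lintegral_swap
          apply Measurable.aemeasurable
          apply Measurable.const_mul
          exact Measurable.lintegral_prod_right' (f := fun p : (Eu n × ℝ) × Eu n =>
            ‖η (p.1.1 + p.1.2 • h - p.2)‖ₑ) ((hηm.comp (by fun_prop)).enorm)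
      _ = ∫⁻ s in Ioc (0:ℝ) 1, ‖h‖ₑ * ∫⁻ y in W, ∫⁻ x, ‖η (x + s • h - y)‖ₑ ∂volume ∂ν := by
          congr 1; ext s
          rw [lintegral_const_mul]
          · congr 1
            apply lintegral_lintegral_swap
            apply Measurable.aemeasurable
            exact (hηm.comp (by fun_prop)).enorm
          · exact Measurable.lintegral_prod_right' (f := fun p : Eu n × Eu n =>
              ‖η (p.1 + s • h - p.2)‖ₑ) ((hηm.comp (by fun_prop)).enorm)
      _ = ∫⁻ s in Ioc (0:ℝ) 1, ‖h‖ₑ * ∫⁻ y in W, 1 ∂ν := by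
          congr 1; ext s; congr 2; ext y
          have : ∀ x, x + s • h - y = x + (s • h - y) := fun x => by abel
          simp only [this]
          rw [lintegral_add_right_eq_self (fun x => ‖η x‖ₑ)]
          have h1 : ∫ x, η x = 1 := (b k).integral_normed
          rw [← ofReal_integral_norm_eq_lintegral_enorm (b k).integrable_normed]
          have h2 : ∀ x, ‖η x‖ = η x := fun x => Real.norm_of_nonneg ((b k).nonneg_normed x)
          simp only [← hη, h2, h1, ENNReal.ofReal_one]
      _ = ‖h‖ₑ * ν W := by simp
  have hae := mollify_ae_tendsto hf hb h0
  have hae' : ∀ᵐ x, Tendsto (fun k => mollify (b k) f (x + h)) atTop (𝓝 (f (x + h))) :=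
    (quasiMeasurePreserving_add_right volume h).ae hae
  calc ∫⁻ x in A, ‖f (x + h) - f x‖ₑ
      ≤ ∫⁻ x in A, liminf (fun k => ‖mollify (b k) f (x + h) - mollify (b k) f x‖ₑ) atTop := by
        apply lintegral_mono_ae
        filter_upwards [ae_restrict_of_ae hae, ae_restrict_of_ae hae'] with x h1 h2
        exact ((h2.sub h1).enorm.liminf_eq).ge
    _ ≤ liminf (fun k => ∫⁻ x in A, ‖mollify (b k) f (x + h) - mollify (b k) f x‖ₑ) atTop := by
        apply lintegral_liminf_le
        intro k
        obtain ⟨D, hDc, hD, hDb⟩ := exists_hasFDerivAt_mollify hf (b k) hν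
        have : Continuous (mollify (b k) f) :=
          continuous_iff_continuousAt.2 fun z => (hD z).continuousAt
        fun_prop
    _ ≤ ‖h‖ₑ * ν W := by
        apply Filter.liminf_le_of_frequently_le'
        exact Frequently.of_forall key

open CompactlySupported CompactlySupportedContinuousMap in
lemma exists_measure_tendsto_integral {n : ℕ} (F : Ultrafilter ℕ) {q : ℕ → Eu n → ℝ}
    (hq0 : ∀ k x, 0 ≤ q k x) (hqi : ∀ k, Integrable (q k)) {C : ℝ}
    (hC : ∀ᶠ k in (F : Filter ℕ), ∫ x, q k x ≤ C) :
    ∃ μ : Measure (Eu n), IsFiniteMeasureOnCompacts μ ∧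
      ∀ φ : Eu n → ℝ, Continuous φ → HasCompactSupport φ →
        Tendsto (fun k => ∫ x, φ x * q k x) F (𝓝 (∫ x, φ x ∂μ)) := by
  have hint : ∀ (φ : C_c(Eu n, ℝ)) k, Integrable (fun x => φ x * q k x) := by
    intro φ k
    obtain ⟨B, hB⟩ := φ.continuous.bounded_above_of_compact_support φ.hasCompactSupport
    exact (hqi k).bdd_mul φ.continuous.aestronglyMeasurable (Eventually.of_forall hB)
  have hlim : ∀ φ : C_c(Eu n, ℝ), ∃ l, Tendsto (fun k => ∫ x, φ x * q k x) F (𝓝 l) := by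
    intro φ
    obtain ⟨B, hB⟩ := φ.continuous.bounded_above_of_compact_support φ.hasCompactSupport
    have hB0 : 0 ≤ B := (norm_nonneg _).trans (hB 0)
    have hmem : ∀ᶠ k in (F : Filter ℕ), (∫ x, φ x * q k x) ∈ Icc (-(B * C)) (B * C) := by
      filter_upwards [hC] with k hk
      rw [mem_Icc, ← abs_le, ← Real.norm_eq_abs]
      refine (norm_integral_le_of_norm_le ((hqi k).const_mul B)
        (Eventually.of_forall fun x => ?_)).trans ?_
      · rw [norm_mul, Real.norm_of_nonneg (hq0 k x)]
        exact mul_le_mul_of_nonneg_right (hB x) (hq0 k x)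
      · rw [integral_const_mul]; gcongr
    obtain ⟨l, -, hl⟩ := isCompact_Icc.ultrafilter_le_nhds
      (F.map fun k => ∫ x, φ x * q k x) (le_principal_iff.2 hmem)
    exact ⟨l, hl⟩
  choose l hl using hlim
  let Λ₀ : C_c(Eu n, ℝ) →ₗ[ℝ] ℝ :=
    { toFun := l
      map_add' := fun φ ψ => by
        refine tendsto_nhds_unique (hl _) (((hl φ).add (hl ψ)).congr fun k => ?_)
        rw [← integral_add (hint φ k) (hint ψ k)]
        simp [add_mul]
      map_smul' := fun c φ => by
        refine tendsto_nhds_unique (hl _) (((hl φ).const_mul c).congr fun k => ?_)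
        rw [← integral_const_mul]
        simp [mul_assoc] }
  let Λ : C_c(Eu n, ℝ) →ₚ[ℝ] ℝ := PositiveLinearMap.mk₀ Λ₀ fun φ hφ =>
    ge_of_tendsto' (hl φ) fun k => integral_nonneg fun x => mul_nonneg (hφ x) (hq0 k x)
  refine ⟨RealRMK.rieszMeasure Λ, inferInstance, fun φ hφ hφs => ?_⟩
  have := RealRMK.integral_rieszMeasure Λ ⟨⟨φ, hφ⟩, hφs⟩
  rw [show ∫ x, φ x ∂(RealRMK.rieszMeasure Λ) = l ⟨⟨φ, hφ⟩, hφs⟩ from this]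
  exact hl ⟨⟨φ, hφ⟩, hφs⟩

/-- The step sizes used for difference quotients. -/
def step (k : ℕ) : ℝ := 1 / ((k : ℝ) + 1)

lemma step_pos (k : ℕ) : 0 < step k := by unfold step; positivity

lemma step_le_one (k : ℕ) : step k ≤ 1 := by
  unfold step; rw [div_le_one (by positivity)]; linarith [k.cast_nonneg (α := ℝ)]

lemma tendsto_step : Tendsto step atTop (𝓝 0) := tendsto_one_div_add_atTop_nhds_zero_nat

/-- The vector of length `step k` in the `i`-th coordinate direction. -/
def stepVec {n : ℕ} (i : Fin n) (k : ℕ) : Eu n := step k • EuclideanSpace.single i (1 : ℝ)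

lemma norm_stepVec {n : ℕ} (i : Fin n) (k : ℕ) : ‖stepVec i k‖ = step k := by
  simp [stepVec, norm_smul, abs_of_pos (step_pos k)]

/-- `θ i • ν` is the weak limit, along the ultrafilter `F`, of the difference quotients of `f` in
the `i`-th coordinate direction, tested with functions supported in `V`. -/
def IsDiffLimit {n : ℕ} (F : Ultrafilter ℕ) (V : Set (Eu n)) (f : Eu n → ℝ) (ν : Measure (Eu n))
    (θ : Fin n → Eu n → ℝ) : Prop :=
  ∀ i, ∀ φ : Eu n → ℝ, Continuous φ → HasCompactSupport φ → tsupport φ ⊆ V →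
    Tendsto (fun k => ∫ x, f x * ((φ x - φ (x - stepVec i k)) / step k)) F
      (𝓝 (- ∫ x, φ x * θ i x ∂ν))

lemma exists_isDiffLimit {n : ℕ} {f : Eu n → ℝ} (hf : Measurable f) (hfb : ∀ x, |f x| ≤ 1)
    {V : Set (Eu n)} (hV : MeasurableSet V) (hVfin : volume V ≠ ⊤) {C : ℝ}
    (hC : ∃ᶠ k in atTop, ∀ i : Fin n,
      ∫ x in V, |f (x + stepVec i k) - f x| / step k ≤ C) :
    ∃ (F : Ultrafilter ℕ) (ν : Measure (Eu n)) (θ : Fin n → Eu n → ℝ),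
      (F : Filter ℕ) ≤ atTop ∧ IsFiniteMeasureOnCompacts ν ∧ (∀ i, Measurable (θ i)) ∧
      (∀ i, ∀ᵐ x ∂ν, |θ i x| ≤ 1) ∧ IsDiffLimit F V f ν θ := by
  have hne : NeBot (atTop ⊓ 𝓟 {k : ℕ | ∀ i : Fin n,
      ∫ x in V, |f (x + stepVec i k) - f x| / step k ≤ C}) := frequently_mem_iff_neBot.1 hC
  obtain ⟨F, hFl⟩ := Ultrafilter.exists_le (atTop ⊓ 𝓟 {k : ℕ | ∀ i : Fin n,
      ∫ x in V, |f (x + stepVec i k) - f x| / step k ≤ C})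
  have hF : (F : Filter ℕ) ≤ atTop := hFl.trans inf_le_left
  have hFC : ∀ᶠ k in (F : Filter ℕ), ∀ i : Fin n,
      ∫ x in V, |f (x + stepVec i k) - f x| / step k ≤ C :=
    hFl.trans inf_le_right (mem_principal_self _)
  let d : Fin n → ℕ → Eu n → ℝ := fun i k x => V.indicator
    (fun x => (f (x + stepVec i k) - f x) / step k) x
  have hdm : ∀ i k, Measurable (d i k) := fun i k =>
    Measurable.indicator (((hf.comp (measurable_add_const _)).sub hf).div_const _) hV
  have hdi : ∀ i k, Integrable (d i k) := by
    intro i k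
    refine Integrable.mono' (g := V.indicator fun _ => 2 / step k)
      (by rw [integrable_indicator_iff hV]; exact integrableOn_const hVfin)
      (hdm i k).aestronglyMeasurable (Eventually.of_forall fun x => ?_)
    by_cases hx : x ∈ V
    · simp only [d, indicator_of_mem hx, norm_div, Real.norm_of_nonneg (step_pos k).le]
      gcongr
      · exact (step_pos k).le
      · rw [Real.norm_eq_abs]
        have h1 := hfb (x + stepVec i k); have h2 := hfb x
        rw [abs_le] at *; constructor <;> linarith [h1.1, h1.2, h2.1, h2.2]
    · simp [d, hx]
  have hdC : ∀ i, ∀ᶠ k in (F : Filter ℕ), ∫ x, |d i k x| ≤ C := by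
    intro i
    filter_upwards [hFC] with k hk
    refine le_trans (le_of_eq ?_) (hk i)
    rw [← integral_indicator hV]
    congr 1; ext x
    by_cases hx : x ∈ V <;> simp [d, hx, abs_div, abs_of_pos (step_pos k)]
  have hp := fun i => exists_measure_tendsto_integral F (q := fun k x => (d i k x)⁺)
    (fun k x => posPart_nonneg _) (fun k => (hdi i k).pos_part) (C := C) (by
      filter_upwards [hdC i] with k hk
      exact (integral_mono (hdi i k).pos_part (hdi i k).abs
        (fun x => max_le (le_abs_self _) (abs_nonneg _))).trans hk)
  have hm := fun i => exists_measure_tendsto_integral F (q := fun k x => (d i k x)⁻)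
    (fun k x => negPart_nonneg _) (fun k => (hdi i k).neg_part) (C := C) (by
      filter_upwards [hdC i] with k hk
      exact (integral_mono (hdi i k).neg_part (hdi i k).abs
        (fun x => max_le (neg_le_abs _) (abs_nonneg _))).trans hk)
  choose p hpf hpl using hp
  choose m hmf hml using hm
  let ν : Measure (Eu n) := ∑ i, (p i + m i)
  have hνf : IsFiniteMeasureOnCompacts ν := ⟨fun K hK => by
    simp only [ν, Measure.finsetSum_apply, Measure.add_apply]
    exact ENNReal.sum_lt_top.2 fun i _ =>
      ENNReal.add_lt_top.2 ⟨hK.measure_lt_top, hK.measure_lt_top⟩⟩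
  have hle : ∀ i, p i + m i ≤ ν := fun i =>
    Finset.single_le_sum (f := fun i => p i + m i) (fun j _ => Measure.zero_le _) (Finset.mem_univ i)
  have hpν : ∀ i, p i ≤ ν := fun i => le_trans (Measure.le_add_right le_rfl) (hle i)
  have hmν : ∀ i, m i ≤ ν := fun i => le_trans (Measure.le_add_left le_rfl) (hle i)
  refine ⟨F, ν, fun i x => ((p i).rnDeriv ν x).toReal - ((m i).rnDeriv ν x).toReal, hF, hνf,
    fun i => ((p i).measurable_rnDeriv ν).ennreal_toReal.sub
      ((m i).measurable_rnDeriv ν).ennreal_toReal, ?_, ?_⟩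
  · intro i
    filter_upwards [Measure.rnDeriv_le_one_of_le (hpν i), Measure.rnDeriv_le_one_of_le (hmν i)]
      with x h1 h2
    have h1' := ENNReal.toReal_mono ENNReal.one_ne_top h1
    have h2' := ENNReal.toReal_mono ENNReal.one_ne_top h2
    simp only [ENNReal.toReal_one] at h1' h2'
    have := ((p i).rnDeriv ν x).toReal_nonneg
    have := ((m i).rnDeriv ν x).toReal_nonneg
    rw [abs_le]; constructor <;> linarith
  · intro i φ hφ hφs hφV
    have hφp : ∀ (μ : Measure (Eu n)) [IsFiniteMeasureOnCompacts μ], Integrable φ μ := fun μ _ =>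
      hφ.integrable_of_hasCompactSupport hφs
    have hlim := ((hpl i φ hφ hφs).sub (hml i φ hφ hφs)).neg
    have hval : ∫ x, φ x * (((p i).rnDeriv ν x).toReal - ((m i).rnDeriv ν x).toReal) ∂ν =
        (∫ x, φ x ∂(p i)) - ∫ x, φ x ∂(m i) := by
      rw [← integral_rnDeriv_smul (Measure.absolutelyContinuous_of_le (hpν i)),
        ← integral_rnDeriv_smul (Measure.absolutelyContinuous_of_le (hmν i)), ← integral_sub]
      · congr 1; ext x; simp only [smul_eq_mul]; ring
      · exact (integrable_rnDeriv_smul_iff (Measure.absolutelyContinuous_of_le (hpν i))).2 (hφp _)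
      · exact (integrable_rnDeriv_smul_iff (Measure.absolutelyContinuous_of_le (hmν i))).2 (hφp _)
    rw [hval]
    refine hlim.congr fun k => ?_
    obtain ⟨B, hB⟩ := hφ.bounded_above_of_compact_support hφs
    have hi : ∀ g : Eu n → ℝ, Integrable g → Integrable (fun x => φ x * g x) := fun g hg =>
      hg.bdd_mul hφ.aestronglyMeasurable (Eventually.of_forall hB)
    have hfφ : Integrable (fun x => f x * φ x) := (hφp volume).bdd_mul hf.aestronglyMeasurable
      (Eventually.of_forall hfb)
    have hfφ' : Integrable (fun x => f x * φ (x - stepVec i k)) :=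
      ((hφp volume).comp_sub_right _).bdd_mul hf.aestronglyMeasurable (Eventually.of_forall hfb)
    have hfφ'' : Integrable (fun x => f (x + stepVec i k) * φ x) :=
      (hφp volume).bdd_mul (hf.comp (measurable_add_const _)).aestronglyMeasurable
        (Eventually.of_forall fun x => hfb _)
    rw [← integral_sub (f := fun x => φ x * (d i k x)⁺) (g := fun x => φ x * (d i k x)⁻)
      (hi _ (hdi i k).pos_part) (hi _ (hdi i k).neg_part)]
    have e1 : ∀ x, φ x * (d i k x)⁺ - φ x * (d i k x)⁻ =
        (f (x + stepVec i k) * φ x - f x * φ x) / step k := by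
      intro x
      rw [← mul_sub, posPart_sub_negPart]
      by_cases hx : x ∈ V
      · simp only [d, indicator_of_mem hx]; ring
      · have : φ x = 0 := image_eq_zero_of_notMem_tsupport fun h => hx (hφV h)
        simp [this]
    have e2 : ∀ x, f x * ((φ x - φ (x - stepVec i k)) / step k) =
        (f x * φ x - f x * φ (x - stepVec i k)) / step k := fun x => by ring
    simp only [e1, e2, integral_div]
    rw [integral_sub hfφ'' hfφ, integral_sub hfφ hfφ',
      ← integral_add_right_eq_self (fun x => f x * φ (x - stepVec i k)) (stepVec i k)]
    simp only [add_sub_cancel_right]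
    ring

lemma IsDiffLimit.integral_mul_fderiv {n : ℕ} {F : Ultrafilter ℕ} (hF : (F : Filter ℕ) ≤ atTop)
    {V : Set (Eu n)} {f : Eu n → ℝ} (hf : Measurable f) (hfb : ∀ x, |f x| ≤ 1)
    {ν : Measure (Eu n)} {θ : Fin n → Eu n → ℝ} (h : IsDiffLimit F V f ν θ)
    {φ : Eu n → ℝ} (hφ : IsTest V φ) (i : Fin n) :
    ∫ x, f x * fderiv ℝ φ x (EuclideanSpace.single i (1 : ℝ)) = - ∫ x, φ x * θ i x ∂ν := by
  obtain ⟨hφc, hφs, hφV⟩ := hφ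
  have hφc1 : ContDiff ℝ 1 φ := hφc.of_le (by exact_mod_cast le_top)
  obtain ⟨L, hL⟩ := hφc1.lipschitzWith_of_hasCompactSupport hφs one_ne_zero
  refine tendsto_nhds_unique (Tendsto.mono_left ?_ hF) (h i φ hφc.continuous hφs hφV)
  set K : Set (Eu n) := cthickening 1 (tsupport φ) with hK
  have hKc : IsCompact K := hφs.isCompact.cthickening
  refine tendsto_integral_filter_of_dominated_convergence (K.indicator fun _ => (L : ℝ)) ?_ ?_ ?_ ?_
  · refine Eventually.of_forall fun k => (hf.mul ?_).aestronglyMeasurable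
    exact ((hφc.continuous.sub (hφc.continuous.comp (continuous_id.sub continuous_const))).measurable).div_const _
  · refine Eventually.of_forall fun k => Eventually.of_forall fun x => ?_
    have hst := step_pos k
    by_cases hx : x ∈ K
    · rw [indicator_of_mem hx, norm_mul, norm_div, Real.norm_of_nonneg hst.le]
      have h1 : ‖φ x - φ (x - stepVec i k)‖ ≤ L * step k := by
        have := hL.dist_le_mul x (x - stepVec i k)
        rwa [dist_eq_norm, dist_eq_norm, sub_sub_cancel, norm_stepVec] at this
      calc ‖f x‖ * (‖φ x - φ (x - stepVec i k)‖ / step k) ≤ 1 * (L * step k / step k) := by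
            gcongr; exact hfb x
        _ = L := by field_simp
    · have h1 : φ x = 0 := image_eq_zero_of_notMem_tsupport fun h => hx (self_subset_cthickening _ h)
      have h2 : φ (x - stepVec i k) = 0 := image_eq_zero_of_notMem_tsupport fun h => hx
        (mem_cthickening_of_dist_le x _ 1 _ h (by
          rw [dist_eq_norm, sub_sub_cancel, norm_stepVec]; exact step_le_one k))
      simp [h1, h2, hx]
  · rw [integrable_indicator_iff hKc.measurableSet]
    exact integrableOn_const hKc.measure_lt_top.ne
  · refine Eventually.of_forall fun x => Tendsto.const_mul _ ?_
    have hd : HasFDerivAt φ (fderiv ℝ φ x) x :=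
      (hφc1.differentiable one_ne_zero x).hasFDerivAt
    have := hd.hasLineDerivAt (-EuclideanSpace.single i (1 : ℝ))
    have h2 := this.tendsto_slope_zero
    have h3 : Tendsto step atTop (𝓝[≠] 0) := tendsto_nhdsWithin_iff.2
      ⟨tendsto_step, Eventually.of_forall fun k => (step_pos k).ne'⟩
    have h4 := (h2.comp h3).neg
    rw [map_neg, neg_neg] at h4
    refine h4.congr fun k => ?_
    simp only [Function.comp, smul_eq_mul, stepVec, smul_neg, ← sub_eq_add_neg]
    ring

lemma IsDiffLimit.varBound {n : ℕ} {F : Ultrafilter ℕ} (hF : (F : Filter ℕ) ≤ atTop)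
    {V : Set (Eu n)} {f : Eu n → ℝ} (hf : Measurable f) (hfb : ∀ x, |f x| ≤ 1)
    {ν : Measure (Eu n)} {θ : Fin n → Eu n → ℝ} (hθ : ∀ i, Measurable (θ i))
    (h : IsDiffLimit F V f ν θ) :
    VarBound V f (ν.withDensity fun x => ∑ i, ‖θ i x‖ₑ) := by
  intro φ hφ w
  obtain ⟨hφc, hφs, hφV⟩ := id hφ
  have hφc1 : ContDiff ℝ 1 φ := hφc.of_le (by exact_mod_cast le_top)
  have hw : w = ∑ i, w i • EuclideanSpace.single i (1 : ℝ) := by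
    ext j; simp [Finset.sum_apply, Pi.single_apply]
  have hint : ∀ i : Fin n, Integrable fun x =>
      f x * fderiv ℝ φ x (EuclideanSpace.single i (1 : ℝ)) := fun i => by
    have hc : Continuous fun x => fderiv ℝ φ x (EuclideanSpace.single i (1 : ℝ)) :=
      (hφc1.continuous_fderiv one_ne_zero).clm_apply continuous_const
    refine (hc.integrable_of_hasCompactSupport (hφs.fderiv_apply ℝ _)).bdd_mul
      hf.aestronglyMeasurable (Eventually.of_forall hfb)
  have e : ∫ x, f x * fderiv ℝ φ x w = ∑ i, w i * (- ∫ x, φ x * θ i x ∂ν) := by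
    calc ∫ x, f x * fderiv ℝ φ x w
        = ∫ x, ∑ i, w i * (f x * fderiv ℝ φ x (EuclideanSpace.single i (1 : ℝ))) := by
          congr 1; ext x
          conv_lhs => rw [hw, map_sum, Finset.mul_sum]
          refine Finset.sum_congr rfl fun i _ => ?_
          rw [map_smul, smul_eq_mul]; ring
      _ = _ := by
          rw [integral_finsetSum _ fun i _ => (hint i).const_mul _]
          refine Finset.sum_congr rfl fun i _ => ?_
          rw [integral_const_mul, h.integral_mul_fderiv hF hf hfb hφ]
  rw [e, lintegral_withDensity_eq_lintegral_mul _
    (Finset.measurable_sum _ fun i _ => (hθ i).enorm) hφc.continuous.measurable.enorm]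
  simp only [Pi.mul_apply, Finset.sum_mul]
  rw [lintegral_finsetSum (f := fun i x => ‖θ i x‖ₑ * ‖φ x‖ₑ) _
      fun i _ => (hθ i).enorm.mul hφc.continuous.measurable.enorm,
    Finset.mul_sum]
  refine (enorm_sum_le _ _).trans (Finset.sum_le_sum fun i _ => ?_)
  rw [enorm_mul, enorm_neg]
  gcongr
  · rw [enorm_le_iff_norm_le]; exact PiLp.norm_apply_le w i
  · refine (enorm_integral_le_lintegral_enorm _).trans (lintegral_mono fun x => ?_)
    rw [enorm_mul, mul_comm]

lemma IsDiffLimit.abs_integral_mul_le {n : ℕ} {F : Ultrafilter ℕ} (hF : (F : Filter ℕ) ≤ atTop)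
    {V : Set (Eu n)} {f : Eu n → ℝ} (hf : Measurable f) (hfb : ∀ x, |f x| ≤ 1)
    {ν : Measure (Eu n)} {θ : Fin n → Eu n → ℝ} (h : IsDiffLimit F V f ν θ)
    {φ : Eu n → ℝ} (hφ : LipschitzWith 1 φ) {y : Eu n} {r : ℝ} (hr : 0 < r)
    (hφ0 : ∀ x, x ∉ closedBall y r → φ x = 0) (hV : closedBall y r ⊆ V) (i : Fin n) :
    |∫ x, φ x * θ i x ∂ν| ≤ ∫ x in closedBall y (2 * r), |f x| := by
  have hts : tsupport φ ⊆ closedBall y r :=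
    closure_minimal (fun x hx => by_contra fun h => hx (hφ0 x h)) isClosed_closedBall
  have hφs : HasCompactSupport φ := (isCompact_closedBall y r).of_isClosed_subset
    (isClosed_tsupport φ) hts
  have hlim := (h i φ hφ.continuous hφs (hts.trans hV)).abs
  rw [abs_neg] at hlim
  refine le_of_tendsto hlim ?_
  have : ∀ᶠ k in (F : Filter ℕ), step k ≤ r :=
    hF (tendsto_step.eventually (ge_mem_nhds hr))
  filter_upwards [this] with k hk
  have hst := step_pos k
  rw [← integral_indicator measurableSet_closedBall]
  refine (abs_integral_le_integral_abs).trans (integral_mono_of_nonneg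
    (Eventually.of_forall fun x => abs_nonneg _) ?_ (Eventually.of_forall fun x => ?_))
  · rw [integrable_indicator_iff measurableSet_closedBall]
    refine Integrable.mono' (g := fun _ => (1 : ℝ)) (integrableOn_const measure_closedBall_lt_top.ne)
      hf.abs.aestronglyMeasurable (Eventually.of_forall fun x => ?_)
    simpa using hfb x
  · by_cases hx : x ∈ closedBall y (2 * r)
    · simp only [indicator_of_mem hx, abs_mul, abs_div, abs_of_pos hst]
      have h1 : |φ x - φ (x - stepVec i k)| ≤ step k := by
        have := hφ.dist_le_mul x (x - stepVec i k)
        rwa [dist_eq_norm, dist_eq_norm, sub_sub_cancel, norm_stepVec, NNReal.coe_one, one_mul] at this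
      exact mul_le_of_le_one_right (abs_nonneg _) ((div_le_one hst).2 h1)
    · simp only [mem_closedBall, not_le] at hx
      have h1 : φ x = 0 := hφ0 x (by simp only [mem_closedBall, not_le]; linarith)
      have h2 : φ (x - stepVec i k) = 0 := hφ0 _ (by
        simp only [mem_closedBall, not_le]
        have : dist x y ≤ dist x (x - stepVec i k) + dist (x - stepVec i k) y := dist_triangle _ _ _
        rw [dist_eq_norm x (x - _), sub_sub_cancel, norm_stepVec] at this
        linarith)
      simp only [h1, h2, sub_self, zero_div, mul_zero, abs_zero]
      exact indicator_nonneg (fun _ _ => abs_nonneg _) _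

/-- The Lipschitz cutoff `x ↦ max 0 (min r (2 * r - |x - y|))` as an average of indicators of balls. -/
lemma integral_closedBall_indicator {n : ℕ} {ν : Measure (Eu n)} [IsFiniteMeasureOnCompacts ν]
    {g : Eu n → ℝ} (hg : LocallyIntegrable g ν) (y : Eu n) {r : ℝ} (hr : 0 < r) :
    ∫ x, max 0 (min r (2 * r - dist x y)) * g x ∂ν =
      ∫ s in Ioc r (2 * r), ∫ x in closedBall y s, g x ∂ν := by
  have e1 : ∀ s, ∫ x in closedBall y s, g x ∂ν =
      ∫ x, (Ici (dist x y)).indicator (fun _ => (1 : ℝ)) s * g x ∂ν := by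
    intro s
    rw [← integral_indicator measurableSet_closedBall]
    congr 1; ext x
    by_cases hx : dist x y ≤ s <;> simp [indicator, hx]
  simp only [e1]
  rw [integral_integral_swap]
  · congr 1; ext x
    rw [integral_mul_const]
    congr 1
    rw [integral_indicator_const _ measurableSet_Ici, measureReal_restrict_apply measurableSet_Ici]
    simp only [smul_eq_mul, mul_one]
    rcases le_total (dist x y) r with h | h
    · have : Ici (dist x y) ∩ Ioc r (2 * r) = Ioc r (2 * r) :=
        inter_eq_right.2 fun s hs => h.trans hs.1.le
      rw [this, Real.volume_real_Ioc_of_le (by linarith), min_eq_left (by linarith),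
        max_eq_right hr.le]; ring
    · rcases h.eq_or_lt with h | h
      · have : Ici (dist x y) ∩ Ioc r (2 * r) = Ioc r (2 * r) :=
          inter_eq_right.2 fun s hs => h ▸ hs.1.le
        rw [this, Real.volume_real_Ioc_of_le (by linarith), min_eq_left (by linarith),
          max_eq_right hr.le]; ring
      · have : Ici (dist x y) ∩ Ioc r (2 * r) = Icc (dist x y) (2 * r) := by
          ext s; simp only [mem_inter_iff, mem_Ici, mem_Ioc, mem_Icc]
          constructor
          · rintro ⟨a, b, c⟩; exact ⟨a, c⟩
          · rintro ⟨a, b⟩; exact ⟨a, h.trans_le a, b⟩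
        rw [this, min_eq_right (by linarith), Real.volume_real_Icc, max_comm]
  · have hK : IntegrableOn g (closedBall y (2 * r)) ν :=
      hg.integrableOn_isCompact (isCompact_closedBall _ _)
    have : Integrable ((closedBall y (2 * r)).indicator g) ν := by
      rwa [integrable_indicator_iff measurableSet_closedBall]
    have h2 : Integrable (fun p : ℝ × Eu n => (1 : ℝ) * (closedBall y (2 * r)).indicator g p.2)
        ((volume.restrict (Ioc r (2 * r))).prod ν) :=
      Integrable.mul_prod (integrable_const _) this
    have hm : MeasurableSet {p : ℝ × Eu n | dist p.2 y ≤ p.1} :=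
      (isClosed_le (continuous_snd.dist continuous_const) continuous_fst).measurableSet
    refine (h2.indicator hm).congr ?_
    have : ∀ᵐ p : ℝ × Eu n ∂((volume.restrict (Ioc r (2 * r))).prod ν), p.1 ∈ Ioc r (2 * r) :=
      Measure.quasiMeasurePreserving_fst.ae (ae_restrict_mem measurableSet_Ioc)
    filter_upwards [this] with p hp
    by_cases h : dist p.2 y ≤ p.1
    · have h' : p.2 ∈ closedBall y (2 * r) := h.trans hp.2
      simp [indicator, Function.uncurry, h, h.trans hp.2]
    · simp [indicator, Function.uncurry, h]

/-- De Giorgi's upper bound for the variation measure near its Lebesgue points. -/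
lemma IsDiffLimit.ae_mul_measure_closedBall_le {n : ℕ} {F : Ultrafilter ℕ}
    (hF : (F : Filter ℕ) ≤ atTop)
    {V : Set (Eu n)} (hV : IsOpen V) {f : Eu n → ℝ} (hf : Measurable f) (hfb : ∀ x, |f x| ≤ 1)
    {ν : Measure (Eu n)} [IsFiniteMeasureOnCompacts ν] {θ : Fin n → Eu n → ℝ}
    (hθ : ∀ i, Measurable (θ i)) (hθ1 : ∀ i, ∀ᵐ x ∂ν, |θ i x| ≤ 1)
    (h : IsDiffLimit F V f ν θ) :
    ∀ᵐ y ∂(ν.withDensity fun x => ∑ i, ‖θ i x‖ₑ), y ∈ V → ∀ᶠ r in 𝓝[>] (0 : ℝ),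
      r * ((ν.withDensity fun x => ∑ i, ‖θ i x‖ₑ) (closedBall y r)).toReal ≤
        3 * n * ∫ x in closedBall y (4 * r), |f x| := by
  set S : Eu n → ℝ≥0∞ := fun x => ∑ i, ‖θ i x‖ₑ with hS
  have hSm : Measurable S := Finset.measurable_sum _ fun i _ => (hθ i).enorm
  have hθb : ∀ (i) (c : ℝ) (s : Set (Eu n)), ν s ≠ ⊤ → IntegrableOn (fun x => θ i x - c) s ν := by
    intro i c s hs
    refine Integrable.sub (Integrable.mono' (g := fun _ => (1 : ℝ)) (integrableOn_const hs)
      (hθ i).aestronglyMeasurable (ae_restrict_of_ae ?_)) (integrableOn_const hs)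
    simpa using hθ1 i
  have hθl : ∀ i, LocallyIntegrable (θ i) ν := fun i =>
    (locallyIntegrable_const (1 : ℝ)).mono (hθ i).aestronglyMeasurable (by simpa using hθ1 i)
  have hleb : ∀ i, ∀ᵐ y ∂ν, Tendsto (fun r => ⨍ x in closedBall y r, ‖θ i x - θ i y‖ ∂ν)
      (𝓝[>] 0) (𝓝 0) := by
    intro i
    filter_upwards [(Besicovitch.vitaliFamily ν).ae_tendsto_average_norm_sub (hθl i)] with y hy
    exact hy.comp (Besicovitch.tendsto_filterAt ν y)
  have hpos : ∀ᵐ y ∂(ν.withDensity S), S y ≠ 0 := by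
    rw [ae_withDensity_iff hSm]; exact Eventually.of_forall fun x h => h
  filter_upwards [hpos, (withDensity_absolutelyContinuous ν S).ae_le (ae_all_iff.2 hleb)]
    with y hy hly hyV
  have : ∃ i : Fin n, 0 < |θ i y| := by
    by_contra hcon
    push Not at hcon
    exact hy (Finset.sum_eq_zero fun i _ => by simpa using (hcon i))
  obtain ⟨i0, hi0⟩ := this
  obtain ⟨i, -, hi⟩ := Finset.exists_max_image Finset.univ (fun i => |θ i y|) ⟨i0, Finset.mem_univ _⟩
  set a := |θ i y| with ha
  have hapos : 0 < a := hi0.trans_le (hi i0 (Finset.mem_univ _))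
  have hev : ∀ᶠ r in 𝓝[>] (0 : ℝ), ∀ j, ⨍ x in closedBall y r, ‖θ j x - θ j y‖ ∂ν < a / 2 :=
    eventually_all.2 fun j => (hly j).eventually (gt_mem_nhds (half_pos hapos))
  obtain ⟨δ, hδ, hδs⟩ := mem_nhdsGT_iff_exists_Ioo_subset.1 hev
  obtain ⟨ρ, hρ, hρV⟩ := Metric.nhds_basis_closedBall.mem_iff.1 (hV.mem_nhds hyV)
  have hδ' : (0 : ℝ) < min (δ / 2) (ρ / 2) := lt_min (half_pos hδ) (half_pos hρ)
  filter_upwards [Ioo_mem_nhdsGT hδ'] with r hr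
  have hr0 : 0 < r := hr.1
  have hrδ : 2 * r < δ := by linarith [hr.2.trans_le (min_le_left _ _)]
  have hrρ : 2 * r < ρ := by linarith [hr.2.trans_le (min_le_right _ _)]
  have hfin : ∀ s, ν (closedBall y s) ≠ ⊤ := fun s => (isCompact_closedBall y s).measure_lt_top.ne
  have hdiff : ∀ j, ∀ s ∈ Ioo 0 δ,
      ∫ x in closedBall y s, |θ j x - θ j y| ∂ν ≤ a / 2 * ν.real (closedBall y s) := by
    intro j s hs
    have := (hδs hs) j
    rw [setAverage_eq, smul_eq_mul] at this
    rcases (measureReal_nonneg (μ := ν) (s := closedBall y s)).eq_or_lt with h0 | h0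
    · have : ν (closedBall y s) = 0 := by
        rwa [eq_comm, measureReal_eq_zero_iff (hfin s)] at h0
      rw [Measure.restrict_eq_zero.2 this, ← h0]; simp
    · rw [inv_mul_lt_iff₀ h0] at this
      simp only [Real.norm_eq_abs] at this
      linarith
  have hVle : ∀ s ∈ Ioo 0 δ, ((ν.withDensity S) (closedBall y s)).toReal ≤
      3 * n * (a / 2 * ν.real (closedBall y s)) := by
    intro s hs
    rw [withDensity_apply _ measurableSet_closedBall]
    simp only [hS]
    rw [lintegral_finsetSum _ fun j _ => (hθ j).enorm, ENNReal.toReal_sum]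
    · calc _ ≤ ∑ j : Fin n, (3 * (a / 2 * ν.real (closedBall y s))) := by
            refine Finset.sum_le_sum fun j _ => ?_
            have hint : IntegrableOn (θ j) (closedBall y s) ν := by
              simpa using hθb j 0 _ (hfin s)
            have := integral_norm_eq_lintegral_enorm (μ := ν.restrict (closedBall y s))
              (hθ j).aestronglyMeasurable
            rw [← this]
            calc ∫ x in closedBall y s, ‖θ j x‖ ∂ν
                ≤ ∫ x in closedBall y s, (|θ j x - θ j y| + a) ∂ν := by
                  refine integral_mono hint.norm ((hθb j _ _ (hfin s)).abs.add
                    (integrableOn_const (hfin s))) fun x => ?_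
                  have h1 := hi j (Finset.mem_univ _)
                  have h2 := abs_sub_abs_le_abs_sub (θ j x) (θ j y)
                  simp only [Real.norm_eq_abs]; linarith
              _ = (∫ x in closedBall y s, |θ j x - θ j y| ∂ν) + ν.real (closedBall y s) * a := by
                  rw [integral_add (hθb j _ _ (hfin s)).abs (integrableOn_const (hfin s)),
                    setIntegral_const, smul_eq_mul]
              _ ≤ _ := by nlinarith [hdiff j s hs]
        _ = _ := by simp; ring
    · intro j _
      have := (hθb j 0 _ (hfin s)).hasFiniteIntegral.ne
      simpa using this
  have hlow : ∀ s ∈ Ioo 0 δ, a / 2 * ν.real (closedBall y s) ≤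
      SignType.sign (θ i y) * ∫ x in closedBall y s, θ i x ∂ν := by
    intro s hs
    have h1 := hdiff i s hs
    have hint : IntegrableOn (θ i) (closedBall y s) ν := by simpa using hθb i 0 _ (hfin s)
    have h2 : ∫ x in closedBall y s, (θ i x - θ i y) ∂ν =
        (∫ x in closedBall y s, θ i x ∂ν) - ν.real (closedBall y s) * θ i y := by
      rw [integral_sub hint (integrableOn_const (hfin s)), setIntegral_const, smul_eq_mul]
    have h3 : |∫ x in closedBall y s, (θ i x - θ i y) ∂ν| ≤ a / 2 * ν.real (closedBall y s) :=
      abs_integral_le_integral_abs.trans h1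
    rw [h2] at h3
    have h4 := abs_le.1 h3
    rcases lt_trichotomy (θ i y) 0 with hneg | h0 | hpos
    · have : a = - θ i y := abs_of_neg hneg
      rw [sign_neg hneg]; simp; nlinarith [h4.1, h4.2]
    · rw [h0] at ha; simp [ha] at hapos
    · have : a = θ i y := abs_of_pos hpos
      rw [sign_pos hpos]; simp; nlinarith [h4.1, h4.2]
  set φ : Eu n → ℝ := fun x => max 0 (min r (2 * r - dist x y)) with hφ
  have hφL : LipschitzWith 1 φ := by
    have h1 : LipschitzWith 1 fun x : Eu n => 2 * r - dist x y := by
      refine LipschitzWith.of_dist_le_mul fun p q => ?_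
      rw [NNReal.coe_one, one_mul, Real.dist_eq]
      have := abs_dist_sub_le p q y
      rwa [show 2 * r - dist p y - (2 * r - dist q y) = -(dist p y - dist q y) by ring, abs_neg]
    exact (h1.const_min r).const_max 0
  have key := h.abs_integral_mul_le hF hf hfb hφL (y := y) (r := 2 * r) (by linarith)
    (fun x hx => by
      simp only [mem_closedBall, not_le] at hx
      exact max_eq_left (min_le_of_right_le (by linarith)))
    ((closedBall_subset_closedBall hrρ.le).trans hρV) i
  rw [show 2 * (2 * r) = 4 * r by ring, integral_closedBall_indicator (hθl i) y hr0] at key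
  set Q := (((ν.withDensity S) (closedBall y r)).toReal) with hQ
  have hQs : ∀ s ∈ Ioc r (2 * r), Q ≤
      3 * n * ((SignType.sign (θ i y) : ℝ) * ∫ x in closedBall y s, θ i x ∂ν) := by
    intro s hs
    have hs' : s ∈ Ioo 0 δ := ⟨hr0.trans hs.1, hs.2.trans_lt hrδ⟩
    have hr' : r ∈ Ioo 0 δ := ⟨hr0, by linarith⟩
    refine (hVle r hr').trans ?_
    have : ν.real (closedBall y r) ≤ ν.real (closedBall y s) :=
      measureReal_mono (closedBall_subset_closedBall hs.1.le) (hfin s)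
    have h2 := hlow s hs'
    have h3 : a / 2 * ν.real (closedBall y r) ≤ a / 2 * ν.real (closedBall y s) := by gcongr
    exact mul_le_mul_of_nonneg_left (h3.trans h2) (by positivity)
  have hsgn : |((SignType.sign (θ i y) : SignType) : ℝ)| ≤ 1 := by
    rcases lt_trichotomy (θ i y) 0 with h | h | h <;> simp [h]
  have hIi : IntegrableOn (fun s => ∫ x in closedBall y s, θ i x ∂ν) (Ioc r (2 * r)) := by
    refine Integrable.mono' (g := fun _ => ν.real (closedBall y (2 * r)))
      (integrableOn_const (by simp)) ?_ ?_
    · have e1 : ∀ s, ∫ x in closedBall y s, θ i x ∂ν =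
          ∫ x, {p : ℝ × Eu n | dist p.2 y ≤ p.1}.indicator (fun p => θ i p.2) (s, x) ∂ν := by
        intro s
        rw [← integral_indicator measurableSet_closedBall]
        congr 1
      simp only [e1]
      refine StronglyMeasurable.aestronglyMeasurable
        (StronglyMeasurable.integral_prod_right (ν := ν) (f := fun s x => {p : ℝ × Eu n | dist p.2 y ≤ p.1}.indicator (fun p => θ i p.2) (s, x)) (Measurable.stronglyMeasurable ?_))
      exact ((hθ i).comp measurable_snd).indicator
        (isClosed_le (continuous_snd.dist continuous_const) continuous_fst).measurableSet
    · filter_upwards [ae_restrict_mem measurableSet_Ioc] with s hs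
      have := norm_setIntegral_le_of_norm_le_const_ae (μ := ν) (s := closedBall y s) (f := θ i)
        (C := 1) (hfin s).lt_top (ae_restrict_of_ae (by simpa using hθ1 i))
      rw [one_mul] at this
      exact this.trans (measureReal_mono (closedBall_subset_closedBall hs.2) (hfin _))
  calc r * Q = ∫ s in Ioc r (2 * r), Q := by
        rw [setIntegral_const, Real.volume_real_Ioc_of_le (by linarith), smul_eq_mul]; ring
    _ ≤ ∫ s in Ioc r (2 * r), 3 * n * ((SignType.sign (θ i y) : ℝ) * ∫ x in closedBall y s, θ i x ∂ν) :=
        setIntegral_mono_on (integrableOn_const (by simp)) ((hIi.const_mul _).const_mul _)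
          measurableSet_Ioc hQs
    _ = 3 * n * ((SignType.sign (θ i y) : ℝ) * ∫ s in Ioc r (2 * r), ∫ x in closedBall y s, θ i x ∂ν) := by
        rw [integral_const_mul, integral_const_mul]
    _ ≤ 3 * n * ∫ x in closedBall y (4 * r), |f x| := by
        gcongr
        refine (le_abs_self _).trans ?_
        rw [abs_mul]
        exact (mul_le_of_le_one_left (abs_nonneg _) hsgn).trans key

/-- The volume of the unit ball. -/
def unitVol (n : ℕ) : ℝ := volume.real (ball (0 : Eu n) 1)

lemma unitVol_pos (n : ℕ) : 0 < unitVol n :=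
  ENNReal.toReal_pos (measure_ball_pos _ _ one_pos).ne' measure_ball_lt_top.ne

lemma volume_real_closedBall {n : ℕ} (y : Eu n) {r : ℝ} (hr : 0 ≤ r) :
    volume.real (closedBall y r) = r ^ n * unitVol n := by
  have := Measure.addHaar_real_closedBall (volume : Measure (Eu n)) y hr
  simpa [unitVol] using this

lemma volume_real_ball {n : ℕ} (y : Eu n) {r : ℝ} (hr : 0 < r) :
    volume.real (ball y r) = r ^ n * unitVol n := by
  rw [measureReal_def, Measure.addHaar_ball_of_pos (volume : Measure (Eu n)) y hr,
    ENNReal.toReal_mul, ENNReal.toReal_ofReal (by positivity), unitVol, measureReal_def]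
  simp

/-- Averaged translation estimate on a ball. -/
lemma VarBound.lintegral_lintegral_le {n : ℕ} {f : Eu n → ℝ} (hf : LocallyIntegrable f volume)
    {U : Set (Eu n)} {ν : Measure (Eu n)} [SFinite ν] (hν : VarBound U f ν) {y : Eu n}
    {s σ t : ℝ} (hst : s + σ < t) (hU : closedBall y t ⊆ U) :
    ∫⁻ h in ball (0 : Eu n) σ, ∫⁻ x in closedBall y s, ‖f (x + h) - f x‖ₑ ≤
      ENNReal.ofReal σ * ν (closedBall y t) * volume (ball (0 : Eu n) σ) := by
  rw [← setLIntegral_const]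
  refine setLIntegral_mono' measurableSet_ball fun h hh => ?_
  have hh' : ‖h‖ < σ := by simpa using hh
  refine (hν.lintegral_translate_le hf (δ := t - (s + σ)) measurableSet_closedBall
    (measurableSet_closedBall (x := y) (ε := t)) hU (by linarith) h ?_).trans ?_
  · intro x hx τ hτ
    refine closedBall_subset_closedBall' ?_
    have h1 : dist (x + τ • h) y ≤ dist (x + τ • h) x + dist x y := dist_triangle _ _ _
    have h2 : dist (x + τ • h) x ≤ ‖h‖ := by
      rw [dist_eq_norm, add_sub_cancel_left, norm_smul, Real.norm_of_nonneg hτ.1]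
      exact mul_le_of_le_one_left (norm_nonneg _) hτ.2
    have h3 : dist x y ≤ s := hx
    linarith
  · gcongr
    rw [← ofReal_norm]
    exact ENNReal.ofReal_le_ofReal hh'.le

lemma locallyIntegrable_indicator_one {n : ℕ} {E : Set (Eu n)} (hE : MeasurableSet E) :
    LocallyIntegrable (E.indicator fun _ => (1 : ℝ)) volume :=
  (locallyIntegrable_const (1 : ℝ)).indicator hE

/-- Lower bound of the averaged translation differences of an indicator function. -/
lemma mul_volume_le_lintegral {n : ℕ} {E A : Set (Eu n)} (hE : MeasurableSet E)
    (hA : MeasurableSet A) {σ : ℝ} {c : ℝ≥0∞}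
    (hc : ∀ x ∈ E ∩ A, c ≤ volume {h ∈ ball (0 : Eu n) σ | x + h ∉ E}) :
    c * volume (E ∩ A) ≤ ∫⁻ h in ball (0 : Eu n) σ, ∫⁻ x in A,
      ‖E.indicator (fun _ => (1 : ℝ)) (x + h) - E.indicator (fun _ => (1 : ℝ)) x‖ₑ := by
  have hm : Measurable fun p : Eu n × Eu n => ‖E.indicator (fun _ => (1 : ℝ)) (p.2 + p.1) -
      E.indicator (fun _ => (1 : ℝ)) p.2‖ₑ := by
    have hi : Measurable (E.indicator fun _ => (1 : ℝ)) := measurable_const.indicator hE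
    exact ((hi.comp (measurable_snd.add measurable_fst)).sub (hi.comp measurable_snd)).enorm
  rw [lintegral_lintegral_swap hm.aemeasurable, ← setLIntegral_const]
  refine (setLIntegral_mono' (hE.inter hA) (g := fun x => ∫⁻ h in ball (0 : Eu n) σ,
    ‖E.indicator (fun _ => (1 : ℝ)) (x + h) - E.indicator (fun _ => (1 : ℝ)) x‖ₑ)
    fun x hx => ?_).trans (lintegral_mono_set inter_subset_right)
  refine (hc x hx).trans ?_
  have hms : MeasurableSet {h : Eu n | x + h ∉ E} := (measurable_const_add x) hE.compl
  rw [← setLIntegral_one, show {h ∈ ball (0 : Eu n) σ | x + h ∉ E} =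
    ball (0 : Eu n) σ ∩ {h | x + h ∉ E} from rfl]
  refine (setLIntegral_mono' (measurableSet_ball.inter hms) fun h hh => ?_).trans
    (lintegral_mono_set inter_subset_left)
  have h1 : x + h ∉ E := hh.2
  simp [hx.1, h1]

section

variable {n : ℕ} {E V : Set (Eu n)} {ν : Measure (Eu n)} [IsFiniteMeasureOnCompacts ν]

lemma volume_translate_inter {n : ℕ} (x : Eu n) (σ : ℝ) (S : Set (Eu n)) :
    volume {h ∈ ball (0 : Eu n) σ | x + h ∈ S} = volume (ball x σ ∩ S) := by
  have : {h ∈ ball (0 : Eu n) σ | x + h ∈ S} = (fun h => x + h) ⁻¹' (ball x σ ∩ S) := by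
    ext h; simp
  rw [this, measure_preimage_add]

/-- A set occupying little of a ball has small volume compared to its perimeter. -/
lemma VarBound.volume_le_of_small (hE : MeasurableSet E)
    (hν : VarBound V (E.indicator fun _ => (1 : ℝ)) ν) {y : Eu n} {s σ : ℝ} (hσ : 0 < σ)
    (hσs : σ ≤ s / 2) (hV : closedBall y (2 * s) ⊆ V)
    (hm : volume.real (E ∩ closedBall y (2 * s)) ≤ unitVol n * σ ^ n / 2) :
    volume.real (E ∩ closedBall y s) ≤ 2 * σ * ν.real (closedBall y (2 * s)) := by
  have h1 := hν.lintegral_lintegral_le (locallyIntegrable_indicator_one hE) (y := y) (s := s)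
    (σ := σ) (t := 2 * s) (by linarith) hV
  have h2 := (mul_volume_le_lintegral hE (measurableSet_closedBall (x := y) (ε := s)) (σ := σ)
    (c := ENNReal.ofReal (unitVol n * σ ^ n / 2)) fun x hx => by
      have e : {h ∈ ball (0 : Eu n) σ | x + h ∉ E} = {h ∈ ball (0 : Eu n) σ | x + h ∈ Eᶜ} := rfl
      rw [e, volume_translate_inter, ← ENNReal.ofReal_toReal
        ((measure_mono inter_subset_left).trans_lt (measure_ball_lt_top (x := x) (r := σ))).ne]
      refine ENNReal.ofReal_le_ofReal ?_
      change _ ≤ volume.real (ball x σ ∩ Eᶜ)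
      have hd := measureReal_sdiff_add_inter (μ := volume) (s := ball x σ) hE measure_ball_lt_top.ne
      rw [volume_real_ball x hσ] at hd
      have hb : volume.real (ball x σ ∩ E) ≤ volume.real (E ∩ closedBall y (2 * s)) := by
        refine measureReal_mono (fun z hz => ⟨hz.2, ?_⟩)
          ((measure_mono inter_subset_right).trans_lt measure_closedBall_lt_top).ne
        have h3 : dist z x < σ := hz.1
        have h4 : dist x y ≤ s := hx.2
        have := dist_triangle z x y
        simp only [mem_closedBall]; linarith
      rw [sdiff_eq] at hd
      nlinarith).trans h1
  have hfin : ν (closedBall y (2 * s)) ≠ ⊤ := (isCompact_closedBall _ _).measure_lt_top.ne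
  have h3 := ENNReal.toReal_mono (ENNReal.mul_ne_top (ENNReal.mul_ne_top ENNReal.ofReal_ne_top hfin)
    measure_ball_lt_top.ne) h2
  have hω := unitVol_pos n
  rw [ENNReal.toReal_mul, ENNReal.toReal_mul, ENNReal.toReal_mul, ENNReal.toReal_ofReal hσ.le,
    ENNReal.toReal_ofReal (by positivity)] at h3
  change _ * volume.real _ ≤ σ * ν.real _ * volume.real (ball (0 : Eu n) σ) at h3
  rw [volume_real_ball _ hσ] at h3
  have hp : 0 < unitVol n * σ ^ n / 2 := by positivity
  refine le_of_mul_le_mul_left (h3.trans (le_of_eq ?_)) hp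
  ring

/-- A crude relative isoperimetric inequality. -/
lemma VarBound.mul_le_of_relative (hE : MeasurableSet E)
    (hν : VarBound V (E.indicator fun _ => (1 : ℝ)) ν) {y : Eu n} {s : ℝ} (hs : 0 < s)
    (hV : closedBall y (5 * s) ⊆ V)
    (hm : volume.real (E ∩ closedBall y s) ≤ unitVol n * s ^ n / 2) :
    volume.real (E ∩ closedBall y s) ≤ 6 * 3 ^ n * s * ν.real (closedBall y (5 * s)) := by
  have h1 := hν.lintegral_lintegral_le (locallyIntegrable_indicator_one hE) (y := y) (s := s)
    (σ := 3 * s) (t := 5 * s) (by linarith) hV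
  have h2 := (mul_volume_le_lintegral hE (measurableSet_closedBall (x := y) (ε := s)) (σ := 3 * s)
    (c := ENNReal.ofReal (unitVol n * s ^ n / 2)) fun x hx => by
      have e : {h ∈ ball (0 : Eu n) (3 * s) | x + h ∉ E} =
        {h ∈ ball (0 : Eu n) (3 * s) | x + h ∈ Eᶜ} := rfl
      rw [e, volume_translate_inter, ← ENNReal.ofReal_toReal
        ((measure_mono inter_subset_left).trans_lt (measure_ball_lt_top (x := x) (r := 3 * s))).ne]
      refine ENNReal.ofReal_le_ofReal ?_
      change _ ≤ volume.real (ball x (3 * s) ∩ Eᶜ)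
      have hd := measureReal_sdiff_add_inter (μ := volume) (s := closedBall y s) hE
        measure_closedBall_lt_top.ne
      rw [volume_real_closedBall y hs.le, inter_comm _ E] at hd
      have hb : volume.real (closedBall y s \ E) ≤ volume.real (ball x (3 * s) ∩ Eᶜ) := by
        refine measureReal_mono (fun z hz => ⟨?_, hz.2⟩)
          ((measure_mono inter_subset_left).trans_lt measure_ball_lt_top).ne
        have h3 : dist z y ≤ s := hz.1
        have h4 : dist x y ≤ s := hx.2
        have := dist_triangle_right z x y
        simp only [mem_ball]; linarith
      nlinarith).trans h1
  have hfin : ν (closedBall y (5 * s)) ≠ ⊤ := (isCompact_closedBall _ _).measure_lt_top.ne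
  have h3 := ENNReal.toReal_mono (ENNReal.mul_ne_top (ENNReal.mul_ne_top ENNReal.ofReal_ne_top hfin)
    measure_ball_lt_top.ne) h2
  have hω := unitVol_pos n
  rw [ENNReal.toReal_mul, ENNReal.toReal_mul, ENNReal.toReal_mul,
    ENNReal.toReal_ofReal (by positivity), ENNReal.toReal_ofReal (by positivity)] at h3
  change _ * volume.real _ ≤ 3 * s * ν.real _ * volume.real (ball (0 : Eu n) (3 * s)) at h3
  rw [volume_real_ball _ (by positivity)] at h3
  have hp : 0 < unitVol n * s ^ n / 2 := by positivity
  refine le_of_mul_le_mul_left (h3.trans (le_of_eq ?_)) hp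
  rw [mul_pow]; ring

end

/-- The iteration behind the lower density estimate. -/
lemma density_iteration {n : ℕ} {m N : ℝ → ℝ} {ω C ε κ r₀ r : ℝ} (hω : 0 < ω) (hC : 0 ≤ C)
    (hm : Monotone m) (hm0 : ∀ s, 0 ≤ m s)
    (h1 : ∀ s, 0 < s → s < r₀ → s * N s ≤ C * m (4 * s))
    (h2 : ∀ s σ, 0 < σ → σ ≤ s / 2 → 2 * s < r₀ → m (2 * s) ≤ ω * σ ^ n / 2 →
      m s ≤ 2 * σ * N (2 * s))
    (hκ : κ = 1 / (2 * (C + 1) * 8 ^ (n + 2))) (hε : ε = ω * κ ^ n / (2 * 8 ^ n))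
    (hr : 0 < r) (hr₀ : r < r₀) (hmr : m r ≤ ε * r ^ n) (k : ℕ) :
    m (r / 8 ^ k) ≤ (1 / 8 ^ (n + 2)) ^ k * (ε * r ^ n) := by
  have hκ0 : 0 < κ := by rw [hκ]; positivity
  have hκ1 : κ ≤ 1 / 2 := by
    rw [hκ]
    apply one_div_le_one_div_of_le (by norm_num)
    have : (1 : ℝ) ≤ 8 ^ (n + 2) := one_le_pow₀ (by norm_num)
    nlinarith
  have hCκ : C * κ ≤ 1 / 8 ^ (n + 2) := by
    rw [hκ, mul_one_div, div_le_div_iff₀ (by positivity) (by positivity), one_mul]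
    have : (0 : ℝ) < 8 ^ (n + 2) := by positivity
    nlinarith
  have hε0 : 0 < ε := by rw [hε]; positivity
  induction k with
  | zero => simpa using hmr
  | succ k ih =>
    set s := r / 8 ^ (k + 1) with hs
    have hs0 : 0 < s := by positivity
    have h8 : r / 8 ^ k = 8 * s := by rw [hs, pow_succ]; field_simp
    rw [h8] at ih
    have hsr : 8 * s ≤ r := by
      rw [← h8]; exact div_le_self hr.le (one_le_pow₀ (by norm_num))
    have hrs : r = 8 ^ (k + 1) * s := by rw [hs]; field_simp
    have hA : m (2 * s) ≤ ω * (κ * s) ^ n / 2 := by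
      calc m (2 * s) ≤ m (8 * s) := hm (by linarith)
        _ ≤ (1 / 8 ^ (n + 2)) ^ k * (ε * r ^ n) := ih
        _ ≤ (1 / 8 ^ n) ^ k * (ε * r ^ n) := by
            gcongr
            · norm_num
            · omega
        _ = ω * (κ * s) ^ n / 2 := by
            rw [hrs, hε, mul_pow, mul_pow, one_div, inv_pow, ← pow_mul, ← pow_mul]
            have : (8 : ℝ) ^ ((k + 1) * n) = 8 ^ (n * k) * 8 ^ n := by rw [← pow_add]; ring_nf
            rw [this]; field_simp
    have hB := h2 s (κ * s) (by positivity) (by nlinarith) (by linarith) hA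
    have hD := h1 (2 * s) (by positivity) (by linarith)
    have hE : m s ≤ C * κ * m (8 * s) := by
      calc m s ≤ 2 * (κ * s) * N (2 * s) := hB
        _ = κ * (2 * s * N (2 * s)) := by ring
        _ ≤ κ * (C * m (4 * (2 * s))) := by gcongr
        _ = C * κ * m (8 * s) := by ring_nf
    calc m s ≤ C * κ * m (8 * s) := hE
      _ ≤ 1 / 8 ^ (n + 2) * ((1 / 8 ^ (n + 2)) ^ k * (ε * r ^ n)) := by
          gcongr; exact hm0 _
      _ = _ := by rw [pow_succ]; ring

/-- Auxiliary scale ratio in the lower density estimate. -/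
def scaleConst (n : ℕ) : ℝ := 1 / (2 * (3 * (n : ℝ) + 1) * 8 ^ (n + 2))

/-- The constant of the lower density estimate at points of the perimeter measure. -/
def densConst (n : ℕ) : ℝ := unitVol n * scaleConst n ^ n / (2 * 8 ^ n)

lemma densConst_pos (n : ℕ) : 0 < densConst n := by
  have := unitVol_pos n
  unfold densConst scaleConst
  positivity

lemma monotone_volume_inter_closedBall {n : ℕ} (E : Set (Eu n)) (y : Eu n) :
    Monotone fun r => volume.real (E ∩ closedBall y r) := fun _ _ h =>
  measureReal_mono (inter_subset_inter_right _ (closedBall_subset_closedBall h))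
    ((measure_mono inter_subset_right).trans_lt measure_closedBall_lt_top).ne

lemma VarBound.frequently_measure_le {n : ℕ} {E V : Set (Eu n)} {ν : Measure (Eu n)}
    [IsFiniteMeasureOnCompacts ν] (hE : MeasurableSet E) (hV : IsOpen V)
    (hν : VarBound V (E.indicator fun _ => (1 : ℝ)) ν) {y : Eu n} (hy : y ∈ V)
    (h1 : ∀ᶠ r in 𝓝[>] (0 : ℝ), r * ν.real (closedBall y r) ≤
      3 * n * volume.real (E ∩ closedBall y (4 * r)))
    (h2 : ∃ᶠ r in 𝓝[>] (0 : ℝ), volume.real (E ∩ closedBall y r) ≤ densConst n * r ^ n)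
    {η : ℝ} (hη : 0 < η) :
    ∃ᶠ r in 𝓝[>] (0 : ℝ), ν.real (closedBall y r) ≤ η * volume.real (closedBall y r) := by
  obtain ⟨δ, hδ, hδs⟩ := mem_nhdsGT_iff_exists_Ioo_subset.1 h1
  obtain ⟨ρ, hρ, hρV⟩ := Metric.nhds_basis_closedBall.mem_iff.1 (hV.mem_nhds hy)
  have hr₀ : (0 : ℝ) < min δ ρ := lt_min hδ hρ
  obtain ⟨r, hmr, hr⟩ := (h2.and_eventually (Ioo_mem_nhdsGT hr₀)).exists
  have hit := density_iteration (n := n) (unitVol_pos n) (C := 3 * n) (by positivity)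
    (N := fun s => ν.real (closedBall y s)) (monotone_volume_inter_closedBall E y)
    (fun s => measureReal_nonneg) (r₀ := min δ ρ)
    (fun s hs hs' => hδs ⟨hs, hs'.trans_le (min_le_left _ _)⟩)
    (fun s σ hσ hσs hs hm => hν.volume_le_of_small hE hσ hσs
      ((closedBall_subset_closedBall (hs.le.trans (min_le_right _ _))).trans hρV) hm)
    rfl rfl hr.1 hr.2 hmr
  have hr0 : 0 < r := hr.1
  have hω := unitVol_pos n
  have hb : Tendsto (fun k : ℕ => (1 / 8 : ℝ) ^ k) atTop (𝓝 0) :=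
    tendsto_pow_atTop_nhds_zero_of_lt_one (by norm_num) (by norm_num)
  have hs : Tendsto (fun k : ℕ => r / 4 * (1 / 8 : ℝ) ^ k) atTop (𝓝[>] 0) := by
    refine tendsto_nhdsWithin_iff.2 ⟨by simpa using hb.const_mul (r / 4),
      Eventually.of_forall fun k => by simp only [mem_Ioi]; positivity⟩
  refine hs.frequently (Eventually.frequently ?_)
  have hc : 0 < (r / 4) ^ (n + 1) * (η * unitVol n) := by positivity
  have hlim : Tendsto (fun k : ℕ => 3 * n * (densConst n * r ^ n) * (1 / 8 : ℝ) ^ k) atTop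
    (𝓝 0) := by simpa using hb.const_mul (3 * n * (densConst n * r ^ n))
  filter_upwards [hlim.eventually (gt_mem_nhds hc)] with k hk
  set b := (1 / 8 : ℝ) ^ k with hbk
  have hb0 : 0 < b := by positivity
  have hb1 : b ≤ 1 := pow_le_one₀ (by norm_num) (by norm_num)
  have hs0 : 0 < r / 4 * b := by positivity
  have hA : r / 4 * b * ν.real (closedBall y (r / 4 * b)) ≤
      3 * n * volume.real (E ∩ closedBall y (4 * (r / 4 * b))) :=
    hδs ⟨hs0, by nlinarith [hr.2.trans_le (min_le_left _ _)]⟩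
  have hB := hit k
  have e1 : r / 8 ^ k = 4 * (r / 4 * b) := by
    rw [hbk, one_div, inv_pow]; field_simp
  have e2 : ((1 : ℝ) / 8 ^ (n + 2)) ^ k = b ^ (n + 2) := by
    rw [hbk, ← pow_mul, mul_comm, pow_mul, ← one_div_pow]
  simp only [e1, e2] at hB
  rw [volume_real_closedBall _ hs0.le]
  refine le_of_mul_le_mul_left (hA.trans ?_) hs0
  calc 3 * n * volume.real (E ∩ closedBall y (4 * (r / 4 * b)))
      ≤ 3 * n * (b ^ (n + 2) * (densConst n * r ^ n)) := by gcongr; exact hB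
    _ = 3 * n * (densConst n * r ^ n) * b * b ^ (n + 1) := by ring
    _ ≤ (r / 4) ^ (n + 1) * (η * unitVol n) * b ^ (n + 1) := by gcongr
    _ = _ := by rw [mul_pow]; ring

/-- Lower density estimate for the set at almost every point of its perimeter measure. -/
lemma VarBound.ae_lower_density {n : ℕ} {E V : Set (Eu n)} {ν : Measure (Eu n)}
    [IsFiniteMeasureOnCompacts ν] (hE : MeasurableSet E) (hV : IsOpen V)
    (hν : VarBound V (E.indicator fun _ => (1 : ℝ)) ν)
    (h1 : ∀ᵐ y ∂ν, y ∈ V → ∀ᶠ r in 𝓝[>] (0 : ℝ), r * ν.real (closedBall y r) ≤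
      3 * n * volume.real (E ∩ closedBall y (4 * r))) :
    ∀ᵐ y ∂ν, y ∈ V → ∀ᶠ r in 𝓝[>] (0 : ℝ),
      densConst n * r ^ n < volume.real (E ∩ closedBall y r) := by
  set B : Set (Eu n) := {y | y ∈ V ∧ (∀ᶠ r in 𝓝[>] (0 : ℝ), r * ν.real (closedBall y r) ≤
      3 * n * volume.real (E ∩ closedBall y (4 * r))) ∧
      ∃ᶠ r in 𝓝[>] (0 : ℝ), volume.real (E ∩ closedBall y r) ≤ densConst n * r ^ n} with hB
  have hB0 : ν B = 0 := by
    have : B = ⋃ k : ℕ, B ∩ ball 0 k := by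
      rw [← inter_iUnion, iUnion_ball_nat, inter_univ]
    rw [this]
    refine measure_iUnion_null fun k => ?_
    have hle : ∀ η : ℝ, 0 < η → ν (B ∩ ball 0 k) ≤
        ENNReal.ofReal η * volume (ball (0 : Eu n) k) := by
      intro η hη
      have : IsLocallyFiniteMeasure (ENNReal.ofReal η • (volume : Measure (Eu n))) :=
        inferInstanceAs (IsLocallyFiniteMeasure (η.toNNReal • (volume : Measure (Eu n))))
      refine ((Besicovitch.vitaliFamily ν).measure_le_of_frequently_le
        (ENNReal.ofReal η • (volume : Measure (Eu n))) (Measure.AbsolutelyContinuous.refl _) _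
        fun y hy => ?_).trans ?_
      · refine (Besicovitch.tendsto_filterAt ν y).frequently
          ((hν.frequently_measure_le hE hV hy.1.1 hy.1.2.1 hy.1.2.2 hη).mono fun r hr => ?_)
        rw [Measure.smul_apply, smul_eq_mul, ← ENNReal.ofReal_toReal
          (isCompact_closedBall y r).measure_lt_top.ne, ← ENNReal.ofReal_toReal
          (measure_closedBall_lt_top (x := y) (r := r) (μ := volume)).ne, ← ENNReal.ofReal_mul hη.le]
        exact ENNReal.ofReal_le_ofReal hr
      · rw [Measure.smul_apply, smul_eq_mul]
        gcongr
        exact inter_subset_right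
    have hlim : Tendsto (fun η : ℝ => ENNReal.ofReal η * volume (ball (0 : Eu n) k)) (𝓝[>] 0)
        (𝓝 0) := by
      have : Tendsto (fun η : ℝ => ENNReal.ofReal η) (𝓝[>] 0) (𝓝 0) := by
        have := (ENNReal.continuous_ofReal.tendsto 0).mono_left (nhdsWithin_le_nhds (s := Ioi 0))
        simpa using this
      simpa using ENNReal.Tendsto.mul_const this (Or.inr measure_ball_lt_top.ne)
    exact le_antisymm (ge_of_tendsto hlim (by
      filter_upwards [self_mem_nhdsWithin] with η hη using hle η hη)) bot_le
  have hB0' : ∀ᵐ y ∂ν, y ∉ B := measure_eq_zero_iff_ae_notMem.1 hB0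
  filter_upwards [h1, hB0'] with y hy hyB hyV
  by_contra hcon
  refine hyB ⟨hyV, hy hyV, ?_⟩
  exact (not_eventually.1 hcon).mono fun r hr => not_lt.1 hr

/-- Vitali covering of a set of centers by balls whose weights are controlled by a measure. -/
lemma exists_countable_covering {n : ℕ} (t : Set (Eu n)) (s : Eu n → ℝ) {R : ℝ}
    (hs0 : ∀ x ∈ t, 0 < s x) (hsR : ∀ x ∈ t, s x ≤ R) (w : Eu n → ℝ≥0∞) (μ : Measure (Eu n))
    (hw : ∀ x ∈ t, w x ≤ μ (closedBall x (s x))) :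
    ∃ T ⊆ t, T.Countable ∧ (∀ x ∈ t, ∃ z ∈ T, x ∈ closedBall z (5 * s z)) ∧
      ∑' z : T, w z ≤ μ univ := by
  obtain ⟨T, hTt, hTd, hTc⟩ := Vitali.exists_disjoint_subfamily_covering_enlargement_closedBall t
    (fun x => x) s R hsR 5 (by norm_num)
  have hcount : T.Countable := hTd.countable_of_nonempty_interior fun x hx =>
    (nonempty_ball.2 (hs0 x (hTt hx))).mono ball_subset_interior_closedBall
  refine ⟨T, hTt, hcount, fun x hx => ?_, ?_⟩
  · obtain ⟨z, hz, h⟩ := hTc x hx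
    exact ⟨z, hz, h (mem_closedBall_self (hs0 x hx).le)⟩
  · refine (ENNReal.tsum_le_tsum fun z : T => hw z (hTt z.2)).trans ?_
    have : Countable T := hcount
    refine tsum_measure_le_measure_univ (fun z => measurableSet_closedBall.nullMeasurableSet)
      fun z z' hzz' => (hTd z.2 z'.2 fun h => hzz' (Subtype.ext h)).aedisjoint

/-- Density threshold below which a point of a set of finite perimeter is discarded. -/
def thr (n : ℕ) : ℝ := min (densConst n / 4 ^ n) (unitVol n / (2 ^ (n + 1) * 10 ^ n))

lemma thr_pos (n : ℕ) : 0 < thr n := by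
  have := densConst_pos n
  have := unitVol_pos n
  exact lt_min (by positivity) (by positivity)

/-- Isoperimetric constant of the covering argument. -/
def isoConst (n : ℕ) : ℝ := 5 ^ ((n : ℝ) - 1) * (6 * 3 ^ n * 2 ^ (n + 1) / unitVol n)

lemma isoConst_pos (n : ℕ) : 0 < isoConst n := by
  have := unitVol_pos n
  unfold isoConst; positivity

/-- At a density point of `E` at which `E` has small density at scale `r`, there is a smaller scale
at which the perimeter is large, and at which no point has uniformly large density. -/
lemma VarBound.exists_scale {n : ℕ} {E V F : Set (Eu n)} {ν : Measure (Eu n)}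
    [IsFiniteMeasureOnCompacts ν] (hE : MeasurableSet E)
    (hν : VarBound V (E.indicator fun _ => (1 : ℝ)) ν) {x : Eu n}
    (hx : Tendsto (fun r => volume (E ∩ closedBall x r) / volume (closedBall x r)) (𝓝[>] 0) (𝓝 1))
    {r δ : ℝ} (hr : 0 < r) (hrδ : r < δ)
    (hF : ∀ y ∈ F, ∀ q : ℚ, 0 < (q : ℝ) → (q : ℝ) < δ →
      densConst n * (q : ℝ) ^ n ≤ volume.real (E ∩ closedBall y q))
    (hV : closedBall x (3 * r) ⊆ V) (hxr : volume.real (E ∩ closedBall x r) < thr n * r ^ n) :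
    ∃ s, 0 < s ∧ s ≤ 5 / 2 * r ∧ closedBall x s ∩ F = ∅ ∧
      s ^ ((n : ℝ) - 1) ≤ isoConst n * ν.real (closedBall x s) := by
  have hω := unitVol_pos n
  set γ : ℝ := unitVol n / 2 ^ (n + 1) with hγ
  have hγ0 : 0 < γ := by positivity
  have hγω : γ < unitVol n := by
    rw [hγ, div_lt_iff₀ (by positivity)]
    have : (1 : ℝ) < 2 ^ (n + 1) := one_lt_pow₀ (by norm_num) (by omega)
    nlinarith
  have hdens : ∀ᶠ s in 𝓝[>] (0 : ℝ), γ * s ^ n ≤ volume.real (E ∩ closedBall x s) := by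
    have h1 := (ENNReal.tendsto_toReal ENNReal.one_ne_top).comp hx
    rw [ENNReal.toReal_one] at h1
    have h2 : γ / unitVol n < 1 := (div_lt_one hω).2 hγω
    filter_upwards [h1.eventually (lt_mem_nhds h2), self_mem_nhdsWithin] with s hs hs0
    have hs0' : (0 : ℝ) < s := hs0
    simp only [Function.comp, ENNReal.toReal_div] at hs
    change _ < volume.real _ / volume.real _ at hs
    rw [volume_real_closedBall _ hs0'.le, div_lt_div_iff₀ hω (by positivity)] at hs
    have : γ * s ^ n * unitVol n < volume.real (E ∩ closedBall x s) * unitVol n := by linarith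
    exact (lt_of_mul_lt_mul_right this hω.le).le
  have hs : Tendsto (fun k : ℕ => r * (1 / 2 : ℝ) ^ k) atTop (𝓝[>] 0) := by
    refine tendsto_nhdsWithin_iff.2 ⟨?_, Eventually.of_forall fun k => by
      simp only [mem_Ioi]; positivity⟩
    simpa using (tendsto_pow_atTop_nhds_zero_of_lt_one (r := (1 / 2 : ℝ)) (by norm_num)
      (by norm_num)).const_mul r
  classical
  have hex : ∃ k : ℕ, γ * (r * (1 / 2 : ℝ) ^ k) ^ n ≤
      volume.real (E ∩ closedBall x (r * (1 / 2 : ℝ) ^ k)) := (hs.eventually hdens).exists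
  set k := Nat.find hex with hk
  have hkspec := Nat.find_spec hex
  have hthr : thr n ≤ γ := by
    refine (min_le_right _ _).trans ?_
    rw [hγ]
    have : (1 : ℝ) ≤ 10 ^ n := one_le_pow₀ (by norm_num)
    gcongr
    nlinarith [show (0 : ℝ) < 2 ^ (n + 1) by positivity]
  have hk0 : k ≠ 0 := by
    intro h0
    rw [← hk, h0] at hkspec
    simp only [pow_zero, mul_one] at hkspec
    have : thr n * r ^ n ≤ γ * r ^ n := by gcongr
    linarith
  obtain ⟨j, hj⟩ := Nat.exists_eq_succ_of_ne_zero hk0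
  have hjn := Nat.find_min hex (m := j) (by rw [← hk, hj]; exact Nat.lt_succ_self j)
  rw [not_le] at hjn
  rw [← hk] at hkspec
  set ρ : ℝ := r * (1 / 2 : ℝ) ^ k with hρ
  have hρ0 : 0 < ρ := by positivity
  have h2ρ : r * (1 / 2 : ℝ) ^ j = 2 * ρ := by rw [hρ, hj, pow_succ]; ring
  have hρr : 2 * ρ ≤ r := by
    rw [← h2ρ]
    exact mul_le_of_le_one_right hr.le (pow_le_one₀ (by norm_num) (by norm_num))
  rw [h2ρ] at hjn
  have hmono := monotone_volume_inter_closedBall E x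
  have hhalf : volume.real (E ∩ closedBall x ρ) ≤ unitVol n * ρ ^ n / 2 := by
    refine (hmono (by linarith : ρ ≤ 2 * ρ)).trans (hjn.le.trans (le_of_eq ?_))
    rw [hγ, mul_pow, pow_succ]; field_simp
  refine ⟨5 * ρ, by positivity, by linarith, ?_, ?_⟩
  · by_contra hne
    obtain ⟨y, hy, hyF⟩ := nonempty_iff_ne_empty.2 hne
    rcases le_or_gt (5 * ρ) (r / 2) with h | h
    · obtain ⟨q, hq1, hq2⟩ := exists_rat_btwn (show r / 4 < r / 2 by linarith)
      have h3 := hF y hyF q (by linarith) (by linarith)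
      have h4 : volume.real (E ∩ closedBall y q) ≤ volume.real (E ∩ closedBall x r) := by
        refine measureReal_mono (inter_subset_inter_right _ (closedBall_subset_closedBall' ?_))
          ((measure_mono inter_subset_right).trans_lt measure_closedBall_lt_top).ne
        have : dist y x ≤ 5 * ρ := hy
        linarith
      have h5 : thr n * r ^ n ≤ densConst n * (q : ℝ) ^ n := by
        have hd := densConst_pos n
        calc thr n * r ^ n ≤ densConst n / 4 ^ n * r ^ n := by gcongr; exact min_le_left _ _
          _ = densConst n * (r / 4) ^ n := by rw [div_pow]; ring
          _ ≤ _ := by gcongr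
      linarith
    · have h3 : r / 10 < ρ := by linarith
      have h5 : thr n * r ^ n ≤ γ * ρ ^ n := by
        calc thr n * r ^ n ≤ unitVol n / (2 ^ (n + 1) * 10 ^ n) * r ^ n := by
              gcongr; exact min_le_right _ _
          _ = γ * (r / 10) ^ n := by rw [div_pow, hγ]; field_simp
          _ ≤ _ := by gcongr
      have := hmono (by linarith : ρ ≤ r)
      simp only at this
      linarith
  · have hrel := hν.mul_le_of_relative hE hρ0
      ((closedBall_subset_closedBall (by linarith)).trans hV) hhalf
    have h6 : γ * ρ ^ n ≤ 6 * 3 ^ n * ρ * ν.real (closedBall x (5 * ρ)) := hkspec.trans hrel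
    rw [Real.mul_rpow (by norm_num) hρ0.le, Real.rpow_sub_one hρ0.ne', Real.rpow_natCast, isoConst,
      mul_assoc]
    gcongr
    rw [div_le_iff₀ hρ0]
    rw [hγ, div_mul_eq_mul_div, div_le_iff₀ (by positivity)] at h6
    rw [div_mul_eq_mul_div, div_mul_eq_mul_div, le_div_iff₀ hω]
    linarith

lemma measurable_volume_inter_closedBall {n : ℕ} {E : Set (Eu n)} (hE : MeasurableSet E) (s : ℝ) :
    Measurable fun y => volume.real (E ∩ closedBall y s) := by
  have hm : MeasurableSet {p : Eu n × Eu n | p.2 ∈ E ∧ dist p.2 p.1 ≤ s} :=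
    (measurable_snd hE).inter (isClosed_le (continuous_snd.dist continuous_fst)
      continuous_const).measurableSet
  exact (measurable_measure_prodMk_left (ν := (volume : Measure (Eu n))) hm).ennreal_toReal

/-- Points of a set of finite perimeter at which the set has small density at a small scale `r` can
be covered by balls with small total `(n-1)`-dimensional content. -/
lemma VarBound.exists_covering {n : ℕ} {E V K : Set (Eu n)} {ν : Measure (Eu n)}
    [IsFiniteMeasureOnCompacts ν] (hE : MeasurableSet E) (hV : IsOpen V)
    (hν : VarBound V (E.indicator fun _ => (1 : ℝ)) ν)
    (hd : ∀ᵐ y ∂ν, y ∈ V → ∀ᶠ r in 𝓝[>] (0 : ℝ),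
      densConst n * r ^ n < volume.real (E ∩ closedBall y r))
    (hK : IsCompact K) (hKV : K ⊆ V) {ε : ℝ≥0∞} (hε : ε ≠ 0) :
    ∃ r₀ > 0, ∀ r, 0 < r → r < r₀ → ∃ (T : Set (Eu n)) (R : Eu n → ℝ), T.Countable ∧
      (∀ z ∈ T, 0 < R z ∧ R z ≤ 13 * r) ∧
      ∑' z : T, ENNReal.ofReal (R z) ^ ((n : ℝ) - 1) ≤ ε ∧
      ∀ᵐ x, x ∈ E ∩ K → volume.real (E ∩ closedBall x r) < thr n * r ^ n →
        ∃ z ∈ T, x ∈ closedBall z (R z) := by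
  obtain ⟨η, hη, hηV⟩ := hK.exists_cthickening_subset_open hV hKV
  set V' := cthickening η K with hV'
  have hV'c : IsCompact V' := hK.cthickening
  let F : ℕ → Set (Eu n) := fun m => {y | ∀ q : ℚ, 0 < (q : ℝ) → (q : ℝ) < step m →
    densConst n * (q : ℝ) ^ n ≤ volume.real (E ∩ closedBall y q)}
  have hFm : ∀ m, MeasurableSet (F m) := by
    intro m
    simp only [F, Set.ofPred_forall]
    refine MeasurableSet.iInter fun q => MeasurableSet.iInter fun _ => MeasurableSet.iInter fun _ =>
      measurableSet_le measurable_const (measurable_volume_inter_closedBall hE _)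
  have hstep : Antitone step := fun a b hab => by
    unfold step
    gcongr
  have hlim : Tendsto (fun m => ν (V' \ F m)) atTop (𝓝 0) := by
    have hanti : Antitone fun m => V' \ F m := fun a b hab =>
      sdiff_subset_sdiff_right fun y hy q hq hq' => hy q hq (hq'.trans_le (hstep hab))
    have h1 := tendsto_measure_iInter_atTop (μ := ν) (s := fun m => V' \ F m)
      (fun m => (hV'c.measurableSet.diff (hFm m)).nullMeasurableSet) hanti
      ⟨0, ((measure_mono sdiff_subset).trans_lt hV'c.measure_lt_top).ne⟩
    have h0 : ν (⋂ m, V' \ F m) = 0 := by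
      refine measure_mono_null ?_ (ae_iff.1 hd)
      intro y hy hcon
      have hyV : y ∈ V' := (mem_iInter.1 hy 0).1
      obtain ⟨δ, hδ, hδs⟩ := mem_nhdsGT_iff_exists_Ioo_subset.1 (hcon (hηV hyV))
      obtain ⟨m, hm⟩ := (tendsto_step.eventually (gt_mem_nhds hδ)).exists
      exact (mem_iInter.1 hy m).2 fun q hq hq' => le_of_lt (hδs ⟨hq, hq'.trans hm⟩)
    rwa [h0] at h1
  set C : ℝ := 5 ^ ((n : ℝ) - 1) * isoConst n with hC
  have hC0 : 0 < C := by have := isoConst_pos n; positivity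
  have hlim2 : Tendsto (fun m => ENNReal.ofReal C * ν (V' \ F m)) atTop (𝓝 0) := by
    simpa using ENNReal.Tendsto.const_mul hlim (Or.inr ENNReal.ofReal_ne_top)
  obtain ⟨m, hm⟩ := (hlim2.eventually (gt_mem_nhds (pos_iff_ne_zero.2 hε))).exists
  refine ⟨min (step m) (η / 3), lt_min (step_pos m) (by positivity), fun r hr hrr => ?_⟩
  have hrm : r < step m := hrr.trans_le (min_le_left _ _)
  have hrη : 3 * r < η := by linarith [hrr.trans_le (min_le_right _ _)]
  set t : Set (Eu n) := {x | x ∈ E ∩ K ∧ volume.real (E ∩ closedBall x r) < thr n * r ^ n ∧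
    Tendsto (fun r => volume (E ∩ closedBall x r) / volume (closedBall x r)) (𝓝[>] 0) (𝓝 1)}
  have hball : ∀ x ∈ t, closedBall x (3 * r) ⊆ V' := fun x hx =>
    (closedBall_subset_cthickening hx.1.2 (3 * r)).trans (cthickening_mono hrη.le K)
  have hsc : ∀ x ∈ t, ∃ s, 0 < s ∧ s ≤ 5 / 2 * r ∧ closedBall x s ∩ F m = ∅ ∧
      s ^ ((n : ℝ) - 1) ≤ isoConst n * ν.real (closedBall x s) := fun x hx =>
    hν.exists_scale hE hx.2.2 hr hrm (fun y hy => hy) ((hball x hx).trans hηV) hx.2.1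
  choose! s hs0 hsr hsF hsν using hsc
  obtain ⟨T, hTt, hTc, hTcov, hTsum⟩ := exists_countable_covering t s hs0 hsr
    (fun x => ENNReal.ofReal (5 * s x) ^ ((n : ℝ) - 1))
    (ENNReal.ofReal C • ν.restrict (V' \ F m)) fun x hx => by
      rw [Measure.smul_apply, smul_eq_mul, Measure.restrict_apply measurableSet_closedBall]
      have h1 : closedBall x (s x) ∩ (V' \ F m) = closedBall x (s x) := by
        refine inter_eq_left.2 fun y hy => ⟨hball x hx (closedBall_subset_closedBall
          (by linarith [hsr x hx]) hy), fun hyF => ?_⟩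
        have : y ∈ closedBall x (s x) ∩ F m := ⟨hy, hyF⟩
        rw [hsF x hx] at this
        exact this
      have hs := hs0 x hx
      rw [h1, ENNReal.ofReal_rpow_of_pos (by positivity),
        ← ENNReal.ofReal_toReal (isCompact_closedBall x (s x)).measure_lt_top.ne,
        ← ENNReal.ofReal_mul hC0.le]
      refine ENNReal.ofReal_le_ofReal ?_
      rw [Real.mul_rpow (by norm_num) hs.le, hC, mul_assoc]
      exact mul_le_mul_of_nonneg_left (hsν x hx) (by positivity)
  refine ⟨T, fun z => 5 * s z, hTc, fun z hz => ?_, hTsum.trans ?_, ?_⟩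
  · have := hs0 z (hTt hz); have := hsr z (hTt hz)
    constructor <;> linarith
  · rw [Measure.smul_apply, smul_eq_mul, Measure.restrict_apply_univ]
    exact hm.le
  · have h1 := Besicovitch.ae_tendsto_measure_inter_div (volume : Measure (Eu n)) E
    rw [ae_restrict_iff' hE] at h1
    filter_upwards [h1] with x hx hxEK hxr
    exact hTcov x ⟨hxEK, hxr, hx hxEK.1⟩

/-- Existence of a perimeter measure with the lower density estimate. -/
lemma exists_perimeter {n : ℕ} {E V : Set (Eu n)} (hE : MeasurableSet E) (hV : IsOpen V)
    (hVfin : volume V ≠ ⊤) {C : ℝ}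
    (hC : ∃ᶠ k in atTop, ∀ i : Fin n, ∫ x in V, |E.indicator (fun _ => (1 : ℝ)) (x + stepVec i k) -
      E.indicator (fun _ => (1 : ℝ)) x| / step k ≤ C) :
    ∃ ν : Measure (Eu n), IsFiniteMeasureOnCompacts ν ∧
      VarBound V (E.indicator fun _ => (1 : ℝ)) ν ∧
      ∀ᵐ y ∂ν, y ∈ V → ∀ᶠ r in 𝓝[>] (0 : ℝ),
        densConst n * r ^ n < volume.real (E ∩ closedBall y r) := by
  have hf : Measurable (E.indicator fun _ => (1 : ℝ)) := measurable_const.indicator hE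
  have hfb : ∀ x, |E.indicator (fun _ => (1 : ℝ)) x| ≤ 1 := fun x => by
    by_cases hx : x ∈ E <;> simp [hx]
  obtain ⟨F, ν, θ, hF, hν, hθ, hθ1, hlim⟩ := exists_isDiffLimit hf hfb hV.measurableSet hVfin hC
  have hfin : IsFiniteMeasureOnCompacts (ν.withDensity fun x => ∑ i, ‖θ i x‖ₑ) := ⟨fun K hK => by
    rw [withDensity_apply _ hK.measurableSet]
    refine (setLIntegral_mono_ae (g := fun _ => (n : ℝ≥0∞)) measurable_const.aemeasurable
      ?_).trans_lt (by
        rw [setLIntegral_const]; exact ENNReal.mul_lt_top (by simp) hK.measure_lt_top)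
    filter_upwards [ae_all_iff.2 hθ1] with x hx _
    calc ∑ i, ‖θ i x‖ₑ ≤ ∑ _i : Fin n, (1 : ℝ≥0∞) := Finset.sum_le_sum fun i _ => by
          rw [← ofReal_norm, ← ENNReal.ofReal_one]
          exact ENNReal.ofReal_le_ofReal (hx i)
      _ = n := by simp⟩
  have hvar := hlim.varBound hF hf hfb hθ
  refine ⟨_, hfin, hvar, hvar.ae_lower_density hE hV ?_⟩
  filter_upwards [hlim.ae_mul_measure_closedBall_le hF hV hf hfb hθ hθ1] with y hy hyV
  filter_upwards [hy hyV] with r hr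
  refine hr.trans (le_of_eq ?_)
  congr 1
  have : ∀ x, |E.indicator (fun _ => (1 : ℝ)) x| = E.indicator (fun _ => (1 : ℝ)) x := fun x =>
    abs_of_nonneg (indicator_nonneg (fun _ _ => zero_le_one) _)
  simp only [this]
  rw [setIntegral_indicator hE, setIntegral_const, smul_eq_mul, mul_one, inter_comm]

lemma IsTest.continuous_gradient {n : ℕ} {Ω : Set (Eu n)} {φ : Eu n → ℝ} (hφ : IsTest Ω φ) :
    Continuous (gradient φ) :=
  (InnerProductSpace.toDual ℝ (Eu n)).symm.continuous.comp
    (hφ.1.continuous_fderiv (by simp))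

lemma gradient_eq_zero_of_notMem_tsupport {n : ℕ} {φ : Eu n → ℝ} {x : Eu n} (hx : x ∉ tsupport φ) :
    gradient φ x = 0 := by
  have : fderiv ℝ φ x = 0 := by
    by_contra h
    exact hx (support_fderiv_subset ℝ h)
  simp [gradient, this]

lemma IsTest.integrableOn_smul_gradient {n : ℕ} {Ω : Set (Eu n)} {φ u : Eu n → ℝ}
    (hφ : IsTest Ω φ) (hu : LocallyIntegrableOn u Ω) :
    IntegrableOn (fun x => u x • gradient φ x) Ω := by
  have h1 : IntegrableOn (fun x => u x • gradient φ x) (tsupport φ) :=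
    (hu.integrableOn_compact_subset hφ.2.2 hφ.2.1).smul_continuousOn
      hφ.continuous_gradient.continuousOn hφ.2.1
  have h2 : Integrable (fun x => u x • gradient φ x) := by
    rw [← integrableOn_iff_integrable_of_support_subset (s := tsupport φ)]
    · exact h1
    · intro x hx
      by_contra h
      exact hx (by simp [gradient_eq_zero_of_notMem_tsupport h])
  exact h2.integrableOn

lemma HasGradMeasure.varBound {n : ℕ} {Ω W : Set (Eu n)} {u f : Eu n → ℝ} {ν : Measure (Eu n)}
    {θ : Eu n → Eu n} (h : HasGradMeasure Ω u ν θ) (hu : LocallyIntegrableOn u Ω)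
    (hΩ : MeasurableSet Ω) (hW : MeasurableSet W) (hWΩ : W ⊆ Ω)
    (hf : ∀ᵐ x, x ∈ W → f x = u x) : VarBound W f (ν.restrict W) := by
  intro φ hφ h'
  have hφΩ : IsTest Ω φ := ⟨hφ.1, hφ.2.1, hφ.2.2.trans hWΩ⟩
  have h0 : ∀ x, x ∉ W → fderiv ℝ φ x = 0 := fun x hx => by
    by_contra hne
    exact hx (hφ.2.2 (support_fderiv_subset ℝ hne))
  have e1 : ∫ x, f x * fderiv ℝ φ x h' = ∫ x in Ω, ⟪h', u x • gradient φ x⟫ := by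
    rw [← setIntegral_eq_integral_of_forall_compl_eq_zero (s := Ω)]
    · refine setIntegral_congr_ae hΩ ?_
      filter_upwards [hf] with x hx _
      rw [real_inner_comm, real_inner_smul_left, inner_gradient_left]
      by_cases hxW : x ∈ W
      · rw [hx hxW]
      · simp [h0 x hxW]
    · intro x hx
      simp [h0 x fun hxW => hx (hWΩ hxW)]
  rw [e1, integral_inner (hφΩ.integrableOn_smul_gradient hu) h', h.2.2 φ hφΩ]
  have e2 : ‖- ∫ x, φ x • θ x ∂ν‖ₑ ≤ ∫⁻ x, ‖φ x‖ₑ ∂(ν.restrict W) := by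
    rw [enorm_neg]
    refine (enorm_integral_le_lintegral_enorm _).trans ?_
    rw [← lintegral_indicator hW]
    refine lintegral_mono_ae ?_
    filter_upwards [h.1] with x hx
    by_cases hxW : x ∈ W
    · rw [indicator_of_mem hxW, enorm_smul, ← ofReal_norm (θ x), hx]; simp
    · have : φ x = 0 := image_eq_zero_of_notMem_tsupport fun hxt => hxW (hφ.2.2 hxt)
      simp [this]
  calc ‖⟪h', - ∫ x, φ x • θ x ∂ν⟫‖ₑ ≤ ‖h'‖ₑ * ‖- ∫ x, φ x • θ x ∂ν‖ₑ := by
        rw [← ofReal_norm, ← ofReal_norm, ← ofReal_norm, ← ENNReal.ofReal_mul (norm_nonneg _)]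
        exact ENNReal.ofReal_le_ofReal (norm_inner_le_norm _ _)
    _ ≤ _ := by gcongr

/-- Layer-cake formula for the increments of a function. -/
lemma lintegral_enorm_indicator_sub (a b : ℝ) :
    ∫⁻ t : ℝ, ‖(Iio a).indicator (fun _ => (1 : ℝ)) t - (Iio b).indicator (fun _ => (1 : ℝ)) t‖ₑ
      = ‖a - b‖ₑ := by
  wlog hab : b ≤ a generalizing a b
  · rw [← enorm_neg (a - b), neg_sub, ← this b a (le_of_not_ge hab)]
    refine lintegral_congr fun t => ?_
    rw [← enorm_neg, neg_sub]
  have : ∀ t : ℝ, ‖(Iio a).indicator (fun _ => (1 : ℝ)) t -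
      (Iio b).indicator (fun _ => (1 : ℝ)) t‖ₑ = (Ico b a).indicator (fun _ => 1) t := by
    intro t
    by_cases h1 : t < a <;> by_cases h2 : t < b <;> simp [indicator, h1, h2]
    all_goals linarith
  simp_rw [this]
  rw [lintegral_indicator_const measurableSet_Ico, Real.volume_Ico, one_mul,
    Real.enorm_eq_ofReal (by linarith)]

/-- Coarea estimate: for almost every level the difference quotients of the characteristic function
of the superlevel set stay bounded along a subsequence. -/
lemma HasGradMeasure.ae_level {n : ℕ} {Ω V : Set (Eu n)} {u w : Eu n → ℝ} {ν : Measure (Eu n)}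
    {θ : Eu n → Eu n} (h : HasGradMeasure Ω u ν θ) (hu : LocallyIntegrableOn u Ω)
    (hΩ : IsOpen Ω) (hν : LocFinOn Ω ν) (hw : Measurable w) (hwu : ∀ᵐ x, x ∈ Ω → w x = u x)
    (hV : IsOpen V) (hVc : IsCompact (closure V)) (hVΩ : closure V ⊆ Ω) :
    ∀ᵐ t : ℝ, ∃ C : ℝ, ∃ᶠ k in atTop, ∀ i : Fin n,
      ∫ x in V, |{y | t < w y}.indicator (fun _ => (1 : ℝ)) (x + stepVec i k) -
        {y | t < w y}.indicator (fun _ => (1 : ℝ)) x| / step k ≤ C := by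
  obtain ⟨δ₁, hδ₁, hδ₁Ω⟩ := hVc.exists_cthickening_subset_open hΩ hVΩ
  have hKc : IsCompact (cthickening δ₁ (closure V)) := hVc.cthickening
  set W := cthickening δ₁ (closure V) with hWdef
  have hWm : MeasurableSet W := hKc.measurableSet
  have hνW : ν W < ⊤ := hν.1 W hδ₁Ω hKc
  have : IsFiniteMeasure (ν.restrict W) := ⟨by simpa using hνW⟩
  set f := W.indicator w with hf
  have hwi : IntegrableOn w W := by
    refine (hu.integrableOn_compact_subset hδ₁Ω hKc).congr ?_
    rw [EventuallyEq, ae_restrict_iff' hWm]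
    filter_upwards [hwu] with x hx hxW
    exact (hx (hδ₁Ω hxW)).symm
  have hfi : LocallyIntegrable f volume := (hwi.integrable_indicator hWm).locallyIntegrable
  have hvar : VarBound W f (ν.restrict W) := h.varBound hu hΩ.measurableSet hWm hδ₁Ω (by
    filter_upwards [hwu] with x hx hxW
    rw [hf, indicator_of_mem hxW, hx (hδ₁Ω hxW)])
  have hVW : ∀ x ∈ V, closedBall x δ₁ ⊆ W := fun x hx =>
    (closedBall_subset_cthickening (subset_closure hx) δ₁)
  -- the coarea integrand
  let D : ℕ → Fin n → ℝ → ℝ≥0∞ := fun k i t => ∫⁻ x in V,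
    ‖(Iio (w (x + stepVec i k))).indicator (fun _ => (1 : ℝ)) t -
      (Iio (w x)).indicator (fun _ => (1 : ℝ)) t‖ₑ
  have hmeas : ∀ k i, Measurable fun p : ℝ × Eu n =>
      ‖(Iio (w (p.2 + stepVec i k))).indicator (fun _ => (1 : ℝ)) p.1 -
      (Iio (w p.2)).indicator (fun _ => (1 : ℝ)) p.1‖ₑ := by
    intro k i
    have m : ∀ g : Eu n → ℝ, Measurable g → Measurable fun p : ℝ × Eu n =>
        (Iio (g p.2)).indicator (fun _ => (1 : ℝ)) p.1 := fun g hg => by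
      have : (fun p : ℝ × Eu n => (Iio (g p.2)).indicator (fun _ => (1 : ℝ)) p.1) =
          {p : ℝ × Eu n | p.1 < g p.2}.indicator fun _ => 1 := by
        ext p; simp [indicator]
      rw [this]
      exact measurable_const.indicator
        (measurableSet_lt measurable_fst (hg.comp measurable_snd))
    exact ((m _ (hw.comp (measurable_id.add_const _))).sub (m _ hw)).enorm
  have hDm : ∀ k i, Measurable (D k i) := fun k i => (hmeas k i).lintegral_prod_right'
  have hDint : ∀ᶠ k in atTop, ∀ i, ∫⁻ t, D k i t ≤ ENNReal.ofReal (step k) * ν W := by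
    filter_upwards [tendsto_step.eventually (gt_mem_nhds (show (0 : ℝ) < δ₁ / 2 by positivity))]
      with k hk i
    have e : ∫⁻ t, D k i t = ∫⁻ x in V, ‖w (x + stepVec i k) - w x‖ₑ := by
      rw [lintegral_lintegral_swap (hmeas k i).aemeasurable]
      exact lintegral_congr fun x => lintegral_enorm_indicator_sub _ _
    have hsub : ∀ x ∈ V, ∀ s ∈ Icc (0 : ℝ) 1, closedBall (x + s • stepVec i k) (δ₁ / 2) ⊆ W := by
      intro x hx s hs
      refine (closedBall_subset_closedBall' ?_).trans (hVW x hx)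
      rw [dist_eq_norm, add_sub_cancel_left, norm_smul, norm_stepVec, Real.norm_of_nonneg hs.1]
      nlinarith [hs.2, step_pos k, hs.1]
    have := hvar.lintegral_translate_le hfi hV.measurableSet hWm le_rfl
      (show 0 < δ₁ / 2 by positivity) (stepVec i k) hsub
    rw [e]
    calc ∫⁻ x in V, ‖w (x + stepVec i k) - w x‖ₑ
        = ∫⁻ x in V, ‖f (x + stepVec i k) - f x‖ₑ := by
          refine setLIntegral_congr_fun hV.measurableSet fun x hx => ?_
          have h1 : x + stepVec i k ∈ W := by
            have := hsub x hx 1 ⟨zero_le_one, le_rfl⟩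
            rw [one_smul] at this
            exact this (mem_closedBall_self (by positivity))
          have h2 : x ∈ W := hVW x hx (mem_closedBall_self hδ₁.le)
          simp only [hf, indicator_of_mem h1, indicator_of_mem h2]
      _ ≤ _ := this
      _ = ENNReal.ofReal (step k) * ν W := by
          rw [← ofReal_norm, norm_stepVec, Measure.restrict_apply_self]
  let Q : ℕ → ℝ → ℝ≥0∞ := fun k t => ∑ i, D k i t / ENNReal.ofReal (step k)
  have hQm : ∀ k, Measurable (Q k) := fun k =>
    Finset.measurable_sum _ fun i _ => (hDm k i).div_const _
  have hQ : ∀ᶠ k in atTop, ∫⁻ t, Q k t ≤ n * ν W := by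
    filter_upwards [hDint] with k hk
    rw [lintegral_finsetSum _ fun i _ => (hDm k i).div_const _]
    calc ∑ i, ∫⁻ t, D k i t / ENNReal.ofReal (step k) ≤ ∑ _i : Fin n, ν W := by
          refine Finset.sum_le_sum fun i _ => ?_
          simp_rw [div_eq_mul_inv]
          rw [lintegral_mul_const _ (hDm k i), ← div_eq_mul_inv]
          exact ENNReal.div_le_of_le_mul' (hk i)
      _ = n * ν W := by simp
  have hfatou : ∫⁻ t, liminf (fun k => Q k t) atTop ≤ n * ν W :=
    (lintegral_liminf_le hQm).trans
      ((liminf_le_liminf hQ).trans (by simp))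
  have hfin : ∀ᵐ t, liminf (fun k => Q k t) atTop < ⊤ :=
    ae_lt_top (Measurable.liminf hQm) (hfatou.trans_lt
      (ENNReal.mul_lt_top (by simp) hνW)).ne
  filter_upwards [hfin] with t ht
  obtain ⟨C, hC1, hC2⟩ := exists_between ht
  refine ⟨C.toReal, (frequently_lt_of_liminf_lt (by isBoundedDefault) hC1).mono fun k hk i => ?_⟩
  have hk' : D k i t / ENNReal.ofReal (step k) ≤ C :=
    (Finset.single_le_sum (f := fun i => D k i t / ENNReal.ofReal (step k))
      (fun _ _ => zero_le) (Finset.mem_univ i)).trans hk.le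
  have ind : ∀ x, {y | t < w y}.indicator (fun _ => (1 : ℝ)) x =
      (Iio (w x)).indicator (fun _ => (1 : ℝ)) t := fun x => by simp [indicator]
  simp_rw [ind]
  rw [integral_div, div_le_iff₀ (step_pos k)]
  have : ∫ x in V, |(Iio (w (x + stepVec i k))).indicator (fun _ => (1 : ℝ)) t -
      (Iio (w x)).indicator (fun _ => (1 : ℝ)) t| = (D k i t).toReal := by
    rw [integral_eq_lintegral_of_nonneg_ae (Eventually.of_forall fun _ => abs_nonneg _)]
    · simp only [D, Real.enorm_eq_ofReal_abs]
    · have := ((hmeas k i).comp (measurable_prodMk_left (x := t))).ennreal_toReal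
      refine (this.aestronglyMeasurable).congr (Eventually.of_forall fun x => ?_)
      simp
  rw [this]
  rw [ENNReal.div_le_iff_le_mul (Or.inl (by simp [step_pos k])) (Or.inl (by simp))] at hk'
  have := ENNReal.toReal_mono (ENNReal.mul_ne_top hC2.ne (by simp)) hk'
  rwa [ENNReal.toReal_mul, ENNReal.toReal_ofReal (step_pos k).le] at this

/-- Exhaustion of an open set by compact sets. -/
structure IsExhaustion {n : ℕ} (Ω : Set (Eu n)) (K : ℕ → Set (Eu n)) : Prop where
  isCompact : ∀ m, IsCompact (K m)
  subset_interior : ∀ m, K m ⊆ interior (K (m + 1))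
  iUnion_eq : ⋃ m, K m = Ω

lemma exists_isExhaustion {n : ℕ} {Ω : Set (Eu n)} (hΩ : IsOpen Ω) :
    ∃ K : ℕ → Set (Eu n), IsExhaustion Ω K := by
  have : LocallyCompactSpace Ω := hΩ.locallyCompactSpace
  let L := CompactExhaustion.choice Ω
  refine ⟨fun m => Subtype.val '' L m, fun m => (L.isCompact m).image continuous_subtype_val,
    fun m => ?_, ?_⟩
  · exact (image_mono (L.subset_interior_succ m)).trans
      (hΩ.isOpenMap_subtype_val.image_interior_subset _)
  · rw [← image_iUnion, L.iUnion_eq, image_univ, Subtype.range_coe]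

lemma IsExhaustion.subset {n : ℕ} {Ω : Set (Eu n)} {K : ℕ → Set (Eu n)} (hK : IsExhaustion Ω K)
    (m : ℕ) : K m ⊆ Ω := hK.iUnion_eq ▸ subset_iUnion K m

lemma IsExhaustion.monotone {n : ℕ} {Ω : Set (Eu n)} {K : ℕ → Set (Eu n)}
    (hK : IsExhaustion Ω K) : Monotone K :=
  monotone_nat_of_le_succ fun m => (hK.subset_interior m).trans interior_subset

lemma IsExhaustion.exists_mem_interior {n : ℕ} {Ω : Set (Eu n)} {K : ℕ → Set (Eu n)}
    (hK : IsExhaustion Ω K) {x : Eu n} (hx : x ∈ Ω) : ∃ m, x ∈ interior (K m) := by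
  rw [← hK.iUnion_eq] at hx
  obtain ⟨m, hm⟩ := mem_iUnion.1 hx
  exact ⟨m + 1, hK.subset_interior m hm⟩

/-- There is a dense sequence of levels whose superlevel sets can be covered near their small
density points by balls of small total `(n-1)`-dimensional size. -/
lemma exists_levels {n : ℕ} {Ω : Set (Eu n)} {u w : Eu n → ℝ} (hΩ : IsOpen Ω) (hu : MemBVLoc Ω u)
    (hw : Measurable w) (hwu : ∀ᵐ x, x ∈ Ω → w x = u x) {K : ℕ → Set (Eu n)}
    (hK : IsExhaustion Ω K) :
    ∃ t : ℕ → ℝ, DenseRange t ∧ ∀ (j m : ℕ) (ε : ℝ≥0∞), ε ≠ 0 → ∃ r₀ > (0 : ℝ), ∀ r, 0 < r → r < r₀ →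
      ∃ (T : Set (Eu n)) (R : Eu n → ℝ), T.Countable ∧ (∀ z ∈ T, 0 < R z ∧ R z ≤ 13 * r) ∧
        ∑' z : T, ENNReal.ofReal (R z) ^ ((n : ℝ) - 1) ≤ ε ∧
        ∀ᵐ x, x ∈ {y | t j < w y} ∩ K m →
          volume.real ({y | t j < w y} ∩ closedBall x r) < thr n * r ^ n →
          ∃ z ∈ T, x ∈ closedBall z (R z) := by
  obtain ⟨hui, ν, θ, hν, hgrad⟩ := hu
  have hgood : ∀ᵐ t : ℝ, ∀ m, ∃ C : ℝ, ∃ᶠ k in atTop, ∀ i : Fin n,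
      ∫ x in interior (K (m + 1)), |{y | t < w y}.indicator (fun _ => (1 : ℝ)) (x + stepVec i k) -
        {y | t < w y}.indicator (fun _ => (1 : ℝ)) x| / step k ≤ C := by
    refine ae_all_iff.2 fun m => ?_
    have hsub : closure (interior (K (m + 1))) ⊆ K (m + 1) :=
      closure_minimal interior_subset (hK.isCompact _).isClosed
    exact hgrad.ae_level hui hΩ hν hw hwu isOpen_interior
      ((hK.isCompact (m + 1)).of_isClosed_subset isClosed_closure hsub)
      (hsub.trans (hK.subset _))
  obtain ⟨s, hs, hsc, hsd⟩ := (Measure.dense_of_ae hgood).exists_countable_dense_subset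
  have hne : s.Nonempty := hsd.nonempty
  obtain ⟨t, rfl⟩ := hsc.exists_eq_range hne
  refine ⟨t, hsd, fun j m ε hε => ?_⟩
  obtain ⟨C, hC⟩ := hs (mem_range_self j) m
  have hE : MeasurableSet {y | t j < w y} := measurableSet_lt measurable_const hw
  obtain ⟨ν', hν', hvar, hd⟩ := exists_perimeter hE isOpen_interior
    ((measure_mono interior_subset).trans_lt (hK.isCompact (m + 1)).measure_lt_top).ne hC
  exact hvar.exists_covering hE isOpen_interior hd (hK.isCompact m) (hK.subset_interior m) hε

/-- Countable family of closed balls given by centers and positive radii. -/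
lemma exists_ball_family {n : ℕ} {w : Eu n → ℝ} {K : ℕ → Set (Eu n)} {t : ℕ → ℝ}
    (ht : ∀ (j m : ℕ) (ε : ℝ≥0∞), ε ≠ 0 → ∃ r₀ > (0 : ℝ), ∀ r, 0 < r → r < r₀ →
      ∃ (T : Set (Eu n)) (R : Eu n → ℝ), T.Countable ∧ (∀ z ∈ T, 0 < R z ∧ R z ≤ 13 * r) ∧
        ∑' z : T, ENNReal.ofReal (R z) ^ ((n : ℝ) - 1) ≤ ε ∧
        ∀ᵐ x, x ∈ {y | t j < w y} ∩ K m →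
          volume.real ({y | t j < w y} ∩ closedBall x r) < thr n * r ^ n →
          ∃ z ∈ T, x ∈ closedBall z (R z)) (ℓ : ℕ) {δ : ℝ} (hδ : 0 < δ) {ε : ℝ≥0∞} (hε : ε ≠ 0) :
    ∃ (r : ℝ) (ι : Type) (z : ι → Eu n) (R : ι → ℝ), 0 < r ∧ r ≤ δ ∧ Countable ι ∧
      (∀ i, 0 < R i) ∧ (∀ i, R i ≤ δ) ∧ ∑' i, ENNReal.ofReal (R i) ^ ((n : ℝ) - 1) ≤ ε ∧
      ∀ j ≤ ℓ, ∀ᵐ x, x ∈ K ℓ → t j < w x →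
        volume.real ({y | t j < w y} ∩ closedBall x r) < thr n * r ^ n →
        ∃ i, x ∈ closedBall (z i) (R i) := by
  have hε' : ε / (ℓ + 1 : ℕ) ≠ 0 := (ENNReal.div_pos hε (by simp)).ne'
  choose! r₀ hr₀ hr using fun j => ht j ℓ (ε / (ℓ + 1 : ℕ)) hε'
  obtain ⟨ρ, hρ0, hρ⟩ : ∃ ρ > 0, ∀ j : Fin (ℓ + 1), ρ < r₀ j := by
    have : ∀ᶠ ρ in 𝓝[>] (0 : ℝ), ∀ j : Fin (ℓ + 1), ρ < r₀ j :=
      eventually_all.2 fun j => (gt_mem_nhds (hr₀ j)).filter_mono nhdsWithin_le_nhds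
    obtain ⟨ρ, h1, h2⟩ := (this.and self_mem_nhdsWithin).exists
    exact ⟨ρ, h2, h1⟩
  set r := min ρ (δ / 13) with hrdef
  have hr0 : 0 < r := lt_min hρ0 (by positivity)
  have hrδ : 13 * r ≤ δ := by have := min_le_right ρ (δ / 13); linarith
  choose T R hTc hTR hTs hTa using fun j : Fin (ℓ + 1) =>
    hr j r hr0 ((min_le_left _ _).trans_lt (hρ j))
  have : ∀ j, Countable (T j) := hTc
  refine ⟨r, Σ j : Fin (ℓ + 1), T j, fun p => p.2, fun p => R p.1 p.2, hr0, by linarith,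
    inferInstance, fun p => (hTR p.1 _ p.2.2).1, fun p => (hTR p.1 _ p.2.2).2.trans hrδ, ?_,
    fun j hj => ?_⟩
  · rw [ENNReal.tsum_sigma' (f := fun p : Σ j : Fin (ℓ + 1), T j =>
      ENNReal.ofReal (R p.1 p.2) ^ ((n : ℝ) - 1)), tsum_fintype]
    calc ∑ j, ∑' b : T j, ENNReal.ofReal (R j b) ^ ((n : ℝ) - 1)
        ≤ ∑ _j : Fin (ℓ + 1), ε / (ℓ + 1 : ℕ) := Finset.sum_le_sum fun j _ => hTs j
      _ = ε := by
        rw [Finset.sum_const, Finset.card_univ, Fintype.card_fin, nsmul_eq_mul,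
          ENNReal.mul_div_cancel (by simp) (by simp)]
  · filter_upwards [hTa ⟨j, Nat.lt_succ_of_le hj⟩] with x hx h1 h2 h3
    obtain ⟨z, hz, hxz⟩ := hx ⟨h2, h1⟩ h3
    exact ⟨⟨⟨j, Nat.lt_succ_of_le hj⟩, ⟨z, hz⟩⟩, hxz⟩

lemma hm_eq_zero_of_covering {n : ℕ} (hn : 1 ≤ n) {A : Set (Eu n)}
    (h : ∀ ε : ℝ≥0∞, ε ≠ 0 → ∀ δ : ℝ, 0 < δ → ∃ (ι : Type) (z : ι → Eu n) (R : ι → ℝ),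
      Countable ι ∧ (∀ i, 0 < R i) ∧ (∀ i, R i ≤ δ) ∧
      ∑' i, ENNReal.ofReal (R i) ^ ((n : ℝ) - 1) ≤ ε ∧ A ⊆ ⋃ i, closedBall (z i) (R i)) :
    hm n A = 0 := by
  have hn1 : (0 : ℝ) ≤ (n : ℝ) - 1 := by
    have : (1 : ℝ) ≤ n := by exact_mod_cast hn
    linarith
  choose ι z R hc hR0 hR hs hA using fun k : ℕ =>
    h (ENNReal.ofReal (step k)) (by simp [step_pos]) (step k) (step_pos k)
  have hdiam : ∀ k i, ediam (closedBall (z k i) (R k i)) ≤ 2 * ENNReal.ofReal (R k i) := by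
    intro k i
    rw [← closedEBall_ofReal (hR0 k i).le]
    exact ediam_closedEBall_le
  have hofs : Tendsto (fun k => ENNReal.ofReal (step k)) atTop (𝓝 0) := by
    simpa using ENNReal.tendsto_ofReal tendsto_step
  have key := Measure.hausdorffMeasure_le_liminf_tsum ((n : ℝ) - 1) A (l := atTop)
    (fun k : ℕ => 2 * ENNReal.ofReal (step k))
    (by simpa using ENNReal.Tendsto.const_mul hofs (Or.inr (by simp)))
    (fun k i => closedBall (z k i) (R k i))
    (Eventually.of_forall fun k i => (hdiam k i).trans (by gcongr; exact hR k i))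
    (Eventually.of_forall hA)
  have hlim : Tendsto (fun k => (2 : ℝ≥0∞) ^ ((n : ℝ) - 1) * ENNReal.ofReal (step k)) atTop
      (𝓝 0) := by
    simpa using ENNReal.Tendsto.const_mul hofs
      (Or.inr (ENNReal.rpow_ne_top_of_nonneg hn1 (by simp)))
  refine le_antisymm (key.trans ?_) zero_le
  rw [← hlim.liminf_eq]
  refine liminf_le_liminf (Eventually.of_forall fun k => ?_)
  calc ∑' i, ediam (closedBall (z k i) (R k i)) ^ ((n : ℝ) - 1)
      ≤ ∑' i, (2 : ℝ≥0∞) ^ ((n : ℝ) - 1) * ENNReal.ofReal (R k i) ^ ((n : ℝ) - 1) :=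
        ENNReal.tsum_le_tsum fun i => by
          rw [← ENNReal.mul_rpow_of_nonneg _ _ hn1]
          exact ENNReal.rpow_le_rpow (hdiam k i) hn1
    _ ≤ _ := by rw [ENNReal.tsum_mul_left]; gcongr; exact hs k

lemma ofReal_mul_rpow {n : ℕ} (hn : 1 ≤ n) {c : ℝ} (hc : 0 ≤ c) (r : ℝ) :
    ENNReal.ofReal (c * r) ^ ((n : ℝ) - 1) =
      ENNReal.ofReal c ^ ((n : ℝ) - 1) * ENNReal.ofReal r ^ ((n : ℝ) - 1) := by
  have : (1 : ℝ) ≤ n := by exact_mod_cast hn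
  rw [ENNReal.ofReal_mul hc, ENNReal.mul_rpow_of_nonneg _ _ (by linarith)]

lemma ofReal_rpow_ne_top {n : ℕ} (hn : 1 ≤ n) (c : ℝ) :
    ENNReal.ofReal c ^ ((n : ℝ) - 1) ≠ ⊤ := by
  have : (1 : ℝ) ≤ n := by exact_mod_cast hn
  exact ENNReal.rpow_ne_top_of_nonneg (by linarith) (by simp)

/-- Borel–Cantelli for the Hausdorff measure. -/
lemma hm_ae_eventually_notMem {n : ℕ} (hn : 1 ≤ n) {ι : ℕ → Type} [∀ ℓ, Countable (ι ℓ)]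
    {z : ∀ ℓ, ι ℓ → Eu n} {R : ∀ ℓ, ι ℓ → ℝ} (hR0 : ∀ ℓ i, 0 < R ℓ i)
    (hR : ∀ ℓ i, R ℓ i ≤ step ℓ)
    (hsum : ∑' ℓ, ∑' i, ENNReal.ofReal (R ℓ i) ^ ((n : ℝ) - 1) ≠ ⊤) {c : ℝ} (hc : 0 < c) :
    ∀ᵐ x ∂hm n, ∀ᶠ ℓ in atTop, ∀ i, x ∉ closedBall (z ℓ i) (c * R ℓ i) := by
  refine hm_eq_zero_of_covering hn fun ε hε δ hδ => ?_
  have h1 : Tendsto (fun N => ENNReal.ofReal c ^ ((n : ℝ) - 1) *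
      ∑' k, ∑' i, ENNReal.ofReal (R (k + N) i) ^ ((n : ℝ) - 1)) atTop (𝓝 0) := by
    simpa using ENNReal.Tendsto.const_mul (ENNReal.tendsto_sum_nat_add _ hsum)
      (Or.inr (ofReal_rpow_ne_top hn c))
  have h2 : Tendsto (fun N => c * step N) atTop (𝓝 0) := by
    simpa using tendsto_step.const_mul c
  obtain ⟨N, hN1, hN2⟩ := ((h1.eventually (ge_mem_nhds (pos_iff_ne_zero.2 hε))).and
    (h2.eventually (ge_mem_nhds hδ))).exists
  refine ⟨Σ k, ι (k + N), fun p => z _ p.2, fun p => c * R _ p.2, inferInstance,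
    fun p => mul_pos hc (hR0 _ _), fun p => ?_, ?_, fun x hx => ?_⟩
  · refine le_trans ?_ hN2
    have : step (p.1 + N) ≤ step N := one_div_le_one_div_of_le (by positivity) (by
      push_cast; linarith [(Nat.cast_nonneg p.1 : (0:ℝ) ≤ p.1)])
    exact mul_le_mul_of_nonneg_left ((hR _ _).trans this) hc.le
  · refine le_trans (le_of_eq ?_) hN1
    rw [ENNReal.tsum_sigma' (f := fun p : Σ k, ι (k + N) =>
      ENNReal.ofReal (c * R _ p.2) ^ ((n : ℝ) - 1))]
    simp_rw [ofReal_mul_rpow hn hc.le, ENNReal.tsum_mul_left]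
  · have hx' : ∃ᶠ ℓ in atTop, ∃ i, x ∈ closedBall (z ℓ i) (c * R ℓ i) := by
      simpa [Filter.Frequently] using hx
    obtain ⟨ℓ, hℓ, i, hi⟩ := (frequently_atTop.1 hx') N
    obtain ⟨k, rfl⟩ := Nat.exists_eq_add_of_le' hℓ
    exact mem_iUnion.2 ⟨⟨k, i⟩, hi⟩

/-- A union of balls has small measure near points which are far from all of them. -/
lemma volume_iUnion_closedBall_inter_ball_le {n : ℕ} {ι : Type} [Countable ι]
    {z : ι → Eu n} {R : ι → ℝ} (hR0 : ∀ i, 0 < R i) (S : Finset ι) {x : Eu n} {s : ℝ}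
    (hx : ∀ i, x ∉ closedBall (z i) (10 * R i))
    (hS : ∀ i ∈ S, Disjoint (closedBall (z i) (2 * R i)) (ball x s)) :
    volume ((⋃ i, closedBall (z i) (2 * R i)) ∩ ball x s) ≤
      2 ^ n * volume (ball (0 : Eu n) 1) * ENNReal.ofReal s *
      (Measure.sum fun i : {i // i ∉ S} => ENNReal.ofReal (R i) ^ ((n : ℝ) - 1) •
        Measure.dirac (z i)) (closedBall x (2 * s)) := by
  rw [Measure.sum_apply _ measurableSet_closedBall, ← ENNReal.tsum_mul_left, iUnion_inter]
  refine (measure_iUnion_le _).trans ?_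
  rw [← tsum_subtype_eq_of_support_subset (s := {i | i ∉ S})
    (f := fun i => volume (closedBall (z i) (2 * R i) ∩ ball x s))]
  · refine ENNReal.tsum_le_tsum fun i => ?_
    rcases eq_empty_or_nonempty (closedBall (z i) (2 * R i) ∩ ball x s) with h | ⟨y, hy1, hy2⟩
    · rw [h]; simp
    have h1 := hx i
    rw [mem_closedBall, not_le] at h1
    rw [mem_closedBall] at hy1
    rw [mem_ball] at hy2
    have h2 := dist_triangle x y (z i)
    rw [dist_comm x y] at h2
    have h8 : R i ≤ s := by linarith [hR0 i]
    have hz : z i ∈ closedBall x (2 * s) := by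
      rw [mem_closedBall, dist_comm]; linarith [hR0 i]
    rw [Measure.smul_apply, Measure.dirac_apply' _ measurableSet_closedBall,
      indicator_of_mem hz, Pi.one_apply, smul_eq_mul, mul_one]
    refine (measure_mono inter_subset_left).trans ?_
    rw [Measure.addHaar_closedBall _ _ (by linarith [hR0 i]), finrank_euclideanSpace,
      Fintype.card_fin, ENNReal.ofReal_pow (by linarith [hR0 i]),
      ENNReal.ofReal_mul (by norm_num), mul_pow]
    have e : ENNReal.ofReal (R i) ^ n =
        ENNReal.ofReal (R i) * ENNReal.ofReal (R i) ^ ((n : ℝ) - 1) := by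
      have hne : ENNReal.ofReal (R i) ≠ 0 := by simp [hR0 i]
      rw [ENNReal.rpow_sub _ _ hne (by simp), ENNReal.rpow_one, ENNReal.rpow_natCast,
        ENNReal.mul_div_cancel hne (by simp)]
    rw [e, ENNReal.ofReal_ofNat]
    calc 2 ^ n * (ENNReal.ofReal (R i) * ENNReal.ofReal (R i) ^ ((n : ℝ) - 1)) *
          volume (ball (0 : Eu n) 1) = 2 ^ n * volume (ball (0 : Eu n) 1) *
          ENNReal.ofReal (R i) * ENNReal.ofReal (R i) ^ ((n : ℝ) - 1) := by ring
      _ ≤ _ := by gcongr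
  · intro i hi hiS
    exact hi (by simp only [(hS i hiS).inter_eq, measure_empty])

/-- A union of balls of finite total `(n-1)`-dimensional size has density zero at almost every point
outside the enlarged balls. -/
lemma hm_ae_densityZeroAt {n : ℕ} (hn : 1 ≤ n) {ι : Type} [Countable ι]
    {z : ι → Eu n} {R : ι → ℝ} (hR0 : ∀ i, 0 < R i)
    (hsum : ∑' i, ENNReal.ofReal (R i) ^ ((n : ℝ) - 1) ≠ ⊤) :
    ∀ᵐ x ∂hm n, (∀ i, x ∉ closedBall (z i) (10 * R i)) →
      DensityZeroAt (⋃ i, closedBall (z i) (2 * R i)) x := by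
  set U := ⋃ i, closedBall (z i) (2 * R i) with hU
  let N : ℕ → Set (Eu n) := fun k => {x | (∀ i, x ∉ closedBall (z i) (10 * R i)) ∧
    ∃ᶠ s in 𝓝[>] (0 : ℝ), ENNReal.ofReal (step k) < volume (U ∩ ball x s) / volume (ball x s)}
  have hN : ∀ k, hm n (N k) = 0 := by
    intro k
    refine hm_eq_zero_of_covering hn fun ε hε δ hδ => ?_
    set η := ENNReal.ofReal (step k) with hη
    have hη0 : η ≠ 0 := by simp [hη, step_pos]
    have hlim : Tendsto (fun S : Finset ι => ENNReal.ofReal 10 ^ ((n : ℝ) - 1) * (2 ^ n / η) *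
        ∑' i : {i // i ∉ S}, ENNReal.ofReal (R i) ^ ((n : ℝ) - 1)) atTop (𝓝 0) := by
      have : ENNReal.ofReal 10 ^ ((n : ℝ) - 1) * (2 ^ n / η) ≠ ⊤ :=
        ENNReal.mul_ne_top (ofReal_rpow_ne_top hn _) (ENNReal.div_ne_top (by simp) hη0)
      simpa using ENNReal.Tendsto.const_mul (ENNReal.tendsto_tsum_compl_atTop_zero hsum)
        (Or.inr this)
    obtain ⟨S, hS⟩ := (hlim.eventually (ge_mem_nhds (pos_iff_ne_zero.2 hε))).exists
    set μ := Measure.sum fun i : {i // i ∉ S} => ENNReal.ofReal (R i) ^ ((n : ℝ) - 1) •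
        Measure.dirac (z i) with hμ
    have hμuniv : μ univ = ∑' i : {i // i ∉ S}, ENNReal.ofReal (R i) ^ ((n : ℝ) - 1) := by
      rw [hμ, Measure.sum_apply _ MeasurableSet.univ]
      simp
    have hs : ∀ x ∈ N k, ∃ s : ℝ, 0 < s ∧ 10 * s ≤ δ ∧
        η * ENNReal.ofReal s ^ ((n : ℝ) - 1) ≤ 2 ^ n * μ (closedBall x (2 * s)) := by
      rintro x ⟨hx, hfr⟩
      have hdisj : ∀ᶠ s in 𝓝[>] (0 : ℝ), ∀ i ∈ S,
          Disjoint (closedBall (z i) (2 * R i)) (ball x s) := by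
        refine (Finset.eventually_all S).2 fun i _ => ?_
        have h1 := hx i
        rw [mem_closedBall, not_le] at h1
        have : (0 : ℝ) < dist x (z i) - 2 * R i := by linarith [hR0 i]
        filter_upwards [(gt_mem_nhds this).filter_mono nhdsWithin_le_nhds] with s hs
        rw [disjoint_comm]
        refine ball_disjoint_closedBall (by linarith)
      have hsm : ∀ᶠ s in 𝓝[>] (0 : ℝ), s < δ / 10 :=
        (gt_mem_nhds (by positivity)).filter_mono nhdsWithin_le_nhds
      obtain ⟨s, hs1, hs2, hs3, hs4⟩ :=
        (hfr.and_eventually (hdisj.and (hsm.and self_mem_nhdsWithin))).exists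
      refine ⟨s, hs4, by linarith, ?_⟩
      have hb := volume_iUnion_closedBall_inter_ball_le hR0 S hx hs2
      have hω0 : volume (ball (0 : Eu n) 1) ≠ 0 := (measure_ball_pos _ _ one_pos).ne'
      have hωt : volume (ball (0 : Eu n) 1) ≠ ⊤ := measure_ball_lt_top.ne
      have hs0 : ENNReal.ofReal s ≠ 0 := by simp [hs4]
      have h3 := (ENNReal.mul_lt_of_lt_div hs1).le.trans hb
      rw [Measure.addHaar_ball_of_pos _ _ hs4, finrank_euclideanSpace,
        Fintype.card_fin, ENNReal.ofReal_pow hs4.le] at h3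
      have e : ENNReal.ofReal s ^ n = ENNReal.ofReal s * ENNReal.ofReal s ^ ((n : ℝ) - 1) := by
        rw [ENNReal.rpow_sub _ _ hs0 (by simp), ENNReal.rpow_one, ENNReal.rpow_natCast,
          ENNReal.mul_div_cancel hs0 (by simp)]
      rw [e] at h3
      have h4 : (volume (ball (0 : Eu n) 1) * ENNReal.ofReal s) *
          (η * ENNReal.ofReal s ^ ((n : ℝ) - 1)) ≤
          (volume (ball (0 : Eu n) 1) * ENNReal.ofReal s) * (2 ^ n * μ (closedBall x (2 * s))) := by
        calc _ = η * (ENNReal.ofReal s * ENNReal.ofReal s ^ ((n : ℝ) - 1) *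
              volume (ball (0 : Eu n) 1)) := by ring
          _ ≤ _ := h3
          _ = _ := by ring
      exact (ENNReal.mul_le_mul_iff_right (mul_ne_zero hω0 hs0)
        (ENNReal.mul_ne_top hωt (by simp))).1 h4
    choose! s hs0 hsδ hsμ using hs
    obtain ⟨T, hT, hTc, hTcov, hTsum⟩ := exists_countable_covering (N k) (fun x => 2 * s x)
      (R := δ) (fun x hx => by linarith [hs0 x hx]) (fun x hx => by linarith [hsδ x hx, hs0 x hx])
      (fun x => η * ENNReal.ofReal (s x) ^ ((n : ℝ) - 1)) ((2 : ℝ≥0∞) ^ n • μ) hsμ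
    refine ⟨T, fun x => x, fun x => 10 * s x, hTc, fun x => by linarith [hs0 x (hT x.2)],
      fun x => hsδ x (hT x.2), ?_, fun x hx => ?_⟩
    · refine le_trans ?_ hS
      rw [ENNReal.tsum_mul_left, Measure.smul_apply, hμuniv, smul_eq_mul] at hTsum
      simp_rw [ofReal_mul_rpow hn (show (0 : ℝ) ≤ 10 by norm_num)]
      rw [ENNReal.tsum_mul_left, mul_assoc]
      gcongr
      rw [← ENNReal.mul_div_right_comm, ENNReal.le_div_iff_mul_le (Or.inl hη0)
        (Or.inl (by simp [hη])), mul_comm]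
      exact hTsum
    · obtain ⟨y, hy, hxy⟩ := hTcov x hx
      exact mem_iUnion.2 ⟨⟨y, hy⟩, by convert hxy using 2; ring⟩
  refine measure_mono_null (fun x hx => ?_) (measure_iUnion_null hN)
  simp only [mem_compl_iff, mem_ofPred_eq, Classical.not_imp] at hx
  obtain ⟨hx1, hx2⟩ := hx
  rw [DensityZeroAt, ENNReal.tendsto_nhds_zero] at hx2
  push Not at hx2
  obtain ⟨ε, hε, hfr⟩ := hx2
  have hofs : Tendsto (fun k => ENNReal.ofReal (step k)) atTop (𝓝 0) := by
    simpa using ENNReal.tendsto_ofReal tendsto_step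
  obtain ⟨k, hk⟩ := (hofs.eventually (gt_mem_nhds hε)).exists
  exact mem_iUnion.2 ⟨k, hx1, hfr.mono fun s hs => hk.trans hs⟩

lemma norm_gradient {n : ℕ} (f : Eu n → ℝ) (x : Eu n) : ‖gradient f x‖ = ‖fderiv ℝ f x‖ := by
  simp [gradient]

lemma measurable_gradient {n : ℕ} (f : Eu n → ℝ) : Measurable (gradient f) :=
  (InnerProductSpace.toDual ℝ (Eu n)).symm.continuous.measurable.comp (measurable_fderiv ℝ f)

lemma IsTest.hasCompactSupport_gradient {n : ℕ} {Ω : Set (Eu n)} {φ : Eu n → ℝ}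
    (hφ : IsTest Ω φ) : HasCompactSupport (gradient φ) :=
  HasCompactSupport.intro hφ.2.1 fun _ hx => gradient_eq_zero_of_notMem_tsupport hx

lemma LipschitzWith.integral_smul_gradient {n : ℕ} {Ω : Set (Eu n)} {φ f : Eu n → ℝ}
    {C : NNReal} (hf : LipschitzWith C f) (hφ : IsTest Ω φ) :
    ∫ x, f x • gradient φ x = - ∫ x, φ x • gradient f x := by
  have i1 : Integrable fun x => f x • gradient φ x :=
    (hf.continuous.smul hφ.continuous_gradient).integrable_of_hasCompactSupport
      (hφ.hasCompactSupport_gradient.smul_left)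
  have i2 : Integrable fun x => φ x • gradient f x := by
    have : Integrable fun x => ‖φ x‖ * C :=
      ((hφ.1.continuous.integrable_of_hasCompactSupport hφ.2.1).norm).mul_const _
    refine this.mono' (hφ.1.continuous.measurable.smul
      (measurable_gradient f)).aestronglyMeasurable (Eventually.of_forall fun x => ?_)
    rw [norm_smul, norm_gradient]
    exact mul_le_mul_of_nonneg_left (norm_fderiv_le_of_lipschitz ℝ hf) (norm_nonneg _)
  refine ext_inner_left ℝ fun v => ?_
  rw [inner_neg_right, ← integral_inner i1 v, ← integral_inner i2 v]
  obtain ⟨D, hD⟩ := ContDiff.lipschitzWith_of_hasCompactSupport hφ.2.1 hφ.1 (by simp)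
  have key := hf.integral_lineDeriv_mul_eq (μ := volume) hD hφ.2.1 v
  have e1 : ∫ x, lineDeriv ℝ φ x (-v) * f x = - ∫ x, ⟪v, f x • gradient φ x⟫ := by
    rw [← integral_neg]
    refine integral_congr_ae (Eventually.of_forall fun x => ?_)
    simp only
    rw [(hφ.1.differentiable (by simp)).differentiableAt.lineDeriv_eq_fderiv, map_neg,
      real_inner_comm, real_inner_smul_left, inner_gradient_left]
    ring
  have e2 : ∫ x, lineDeriv ℝ f x v * φ x = ∫ x, ⟪v, φ x • gradient f x⟫ := by
    refine integral_congr_ae ?_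
    filter_upwards [hf.ae_differentiableAt] with x hx
    rw [hx.lineDeriv_eq_fderiv, real_inner_comm, real_inner_smul_left, inner_gradient_left,
      mul_comm]
  rw [← e2, key, e1, neg_neg]

/-- Integration by parts for locally Lipschitz functions. -/
lemma LocallyLipschitzOn.integral_smul_gradient {n : ℕ} {Ω : Set (Eu n)} {φ f : Eu n → ℝ}
    (hΩ : IsOpen Ω) (hf : LocallyLipschitzOn Ω f) (hφ : IsTest Ω φ) :
    ∫ x in Ω, f x • gradient φ x = - ∫ x in Ω, φ x • gradient f x := by
  obtain ⟨δ, hδ, hδΩ⟩ := hφ.2.1.isCompact.exists_cthickening_subset_open hΩ hφ.2.2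
  obtain ⟨C, hC⟩ := (hf.mono hδΩ).exists_lipschitzOnWith_of_compact hφ.2.1.isCompact.cthickening
  obtain ⟨F, hF, hfF⟩ := hC.extend_real
  have hnear : ∀ x ∈ tsupport φ, f =ᶠ[𝓝 x] F := fun x hx => by
    filter_upwards [ball_mem_nhds x hδ] with y hy
    exact hfF (closedBall_subset_cthickening hx δ (ball_subset_closedBall hy))
  have e1 : ∫ x in Ω, f x • gradient φ x = ∫ x, F x • gradient φ x := by
    refine Eq.trans ?_ (setIntegral_eq_integral_of_forall_compl_eq_zero (s := Ω) ?_)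
    · refine setIntegral_congr_fun hΩ.measurableSet fun x _ => ?_
      by_cases hx : x ∈ tsupport φ
      · simp only [(hnear x hx).eq_of_nhds]
      · simp [gradient_eq_zero_of_notMem_tsupport hx]
    · intro x hx
      simp [gradient_eq_zero_of_notMem_tsupport fun h => hx (hφ.2.2 h)]
  have e2 : ∫ x in Ω, φ x • gradient f x = ∫ x, φ x • gradient F x := by
    refine Eq.trans ?_ (setIntegral_eq_integral_of_forall_compl_eq_zero (s := Ω) ?_)
    · refine setIntegral_congr_fun hΩ.measurableSet fun x _ => ?_
      by_cases hx : x ∈ tsupport φ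
      · simp only [gradient, (hnear x hx).fderiv_eq]
      · simp [image_eq_zero_of_notMem_tsupport hx]
    · intro x hx
      simp [image_eq_zero_of_notMem_tsupport fun h => hx (hφ.2.2 h)]
  rw [e1, e2, hF.integral_smul_gradient hφ]

/-- Limits of locally Lipschitz functions with dominated convergent gradients are Sobolev. -/
lemma memW11Loc_of_tendsto {n : ℕ} {Ω : Set (Eu n)} (hΩ : IsOpen Ω) {f : ℕ → Eu n → ℝ}
    {F : Eu n → ℝ} {H : Eu n → ℝ≥0∞} (hf : ∀ N, LocallyLipschitzOn Ω (f N)) (hHm : Measurable H)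
    (hH : ∫⁻ x, H x ≠ ⊤)
    (hbd : ∀ x ∈ Ω, ∃ C : NNReal, ∀ᶠ y in 𝓝 x, ∀ N, ‖f N y‖ₑ ≤ C ∧
      ‖fderiv ℝ (f N) y‖ₑ ≤ C * (1 + H y))
    (hlim : ∀ᵐ x, x ∈ Ω → Tendsto (fun N => f N x) atTop (𝓝 (F x)))
    (hst : ∀ᵐ x, x ∈ Ω → ∃ L, Tendsto (fun N => fderiv ℝ (f N) x) atTop (𝓝 L)) :
    MemW11Loc Ω F ∧ LocBddFun Ω F := by
  have hbdK : ∀ K ⊆ Ω, IsCompact K → ∃ C : NNReal, ∀ y ∈ K, ∀ N, ‖f N y‖ₑ ≤ C ∧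
      ‖fderiv ℝ (f N) y‖ₑ ≤ C * (1 + H y) := by
    intro K hKΩ hK
    refine hK.induction_on (p := fun s => ∃ C : NNReal, ∀ y ∈ s, ∀ N, ‖f N y‖ₑ ≤ C ∧
      ‖fderiv ℝ (f N) y‖ₑ ≤ C * (1 + H y)) ⟨0, by simp⟩ ?_ ?_ ?_
    · rintro s t hst ⟨C, hC⟩
      exact ⟨C, fun y hy => hC y (hst hy)⟩
    · rintro s t ⟨C, hC⟩ ⟨D, hD⟩
      refine ⟨max C D, fun y hy N => ?_⟩
      rcases hy with hy | hy
      · exact ⟨(hC y hy N).1.trans (by gcongr; exact le_max_left _ _),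
          (hC y hy N).2.trans (by gcongr; exact le_max_left _ _)⟩
      · exact ⟨(hD y hy N).1.trans (by gcongr; exact le_max_right _ _),
          (hD y hy N).2.trans (by gcongr; exact le_max_right _ _)⟩
    · intro x hx
      obtain ⟨C, hC⟩ := hbd x (hKΩ hx)
      exact ⟨_, mem_nhdsWithin_of_mem_nhds hC, C, fun y hy => hy⟩
  have hst' : ∀ᵐ x ∂(volume.restrict Ω), ∃ L, Tendsto (fun N => gradient (f N) x) atTop (𝓝 L) := by
    rw [ae_restrict_iff' hΩ.measurableSet]
    filter_upwards [hst] with x hx hxΩ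
    obtain ⟨L, hL⟩ := hx hxΩ
    exact ⟨_, ((InnerProductSpace.toDual ℝ (Eu n)).symm.continuous.tendsto L).comp hL⟩
  obtain ⟨G, hGm, hG⟩ := measurable_limit_of_tendsto_metrizable_ae
    (fun N => (measurable_gradient (f N)).aemeasurable) hst'
  have hlim' : ∀ᵐ x ∂(volume.restrict Ω), Tendsto (fun N => f N x) atTop (𝓝 (F x)) := by
    rwa [ae_restrict_iff' hΩ.measurableSet]
  have hfm : ∀ N, AEStronglyMeasurable (f N) (volume.restrict Ω) := fun N =>
    (hf N).continuousOn.aestronglyMeasurable hΩ.measurableSet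
  have hFm : AEStronglyMeasurable F (volume.restrict Ω) :=
    aestronglyMeasurable_of_tendsto_ae atTop hfm hlim'
  have hFb : ∀ K ⊆ Ω, IsCompact K → ∃ C : NNReal, ∀ᵐ x ∂(volume.restrict K), ‖F x‖ ≤ C := by
    intro K hKΩ hK
    obtain ⟨C, hC⟩ := hbdK K hKΩ hK
    refine ⟨C, ?_⟩
    rw [ae_restrict_iff' hK.measurableSet]
    filter_upwards [hlim] with x hx hxK
    exact le_of_tendsto (hx (hKΩ hxK)).norm (Eventually.of_forall fun N => by
      have := (hC x hxK N).1
      rwa [enorm_le_coe] at this)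
  have hGint : LocallyIntegrableOn G Ω := by
    rw [locallyIntegrableOn_iff hΩ.isLocallyClosed]
    intro K hKΩ hK
    obtain ⟨C, hC⟩ := hbdK K hKΩ hK
    refine ⟨hGm.aestronglyMeasurable, ?_⟩
    have : ∫⁻ x in K, ‖G x‖ₑ ≤ ∫⁻ x in K, C * (1 + H x) := by
      refine lintegral_mono_ae ?_
      have hG' := ae_restrict_of_ae_restrict_of_subset hKΩ hG
      filter_upwards [hG', ae_restrict_mem hK.measurableSet] with x hx hxK
      refine le_of_tendsto hx.enorm (Eventually.of_forall fun N => ?_)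
      rw [← ofReal_norm, norm_gradient, ofReal_norm]
      exact (hC x hxK N).2
    refine this.trans_lt ?_
    rw [lintegral_const_mul _ (by fun_prop), lintegral_add_left (by fun_prop)]
    refine ENNReal.mul_lt_top (by simp) (ENNReal.add_lt_top.2 ⟨?_, ?_⟩)
    · simpa using hK.measure_lt_top
    · exact (setLIntegral_le_lintegral _ _).trans_lt (lt_top_iff_ne_top.2 hH)
  have hFint : LocallyIntegrableOn F Ω := by
    rw [locallyIntegrableOn_iff hΩ.isLocallyClosed]
    intro K hKΩ hK
    obtain ⟨C, hC⟩ := hFb K hKΩ hK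
    exact IntegrableOn.of_bound hK.measure_lt_top (hFm.mono_set hKΩ) C hC
  refine ⟨⟨hFint, G, hGint, fun φ hφ => ?_⟩, hFm, fun K hKΩ hK => ?_⟩
  · obtain ⟨C, hC⟩ := hbdK _ hφ.2.2 hφ.2.1
    have hHtop : ∀ᵐ x ∂(volume.restrict Ω), H x < ⊤ :=
      ae_restrict_of_ae (ae_lt_top hHm hH)
    have t1 : Tendsto (fun N => ∫ x in Ω, f N x • gradient φ x) atTop
        (𝓝 (∫ x in Ω, F x • gradient φ x)) := by
      refine tendsto_integral_of_dominated_convergence (fun x => C * ‖gradient φ x‖)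
        (fun N => (hfm N).smul hφ.continuous_gradient.aestronglyMeasurable) ?_
        (fun N => Eventually.of_forall fun x => ?_) ?_
      · exact (((hφ.continuous_gradient.integrable_of_hasCompactSupport
          hφ.hasCompactSupport_gradient).norm).const_mul _).integrableOn
      · rw [norm_smul]
        by_cases hx : x ∈ tsupport φ
        · have := (hC x hx N).1
          rw [enorm_le_coe] at this
          exact mul_le_mul_of_nonneg_right this (norm_nonneg _)
        · simp [gradient_eq_zero_of_notMem_tsupport hx]
      · filter_upwards [hlim'] with x hx
        exact hx.smul_const _
    have t2 : Tendsto (fun N => ∫ x in Ω, φ x • gradient (f N) x) atTop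
        (𝓝 (∫ x in Ω, φ x • G x)) := by
      refine tendsto_integral_of_dominated_convergence
        (fun x => ‖φ x‖ * (C * (1 + (H x).toReal)))
        (fun N => hφ.1.continuous.aestronglyMeasurable.smul
          (measurable_gradient _).aestronglyMeasurable) ?_ (fun N => ?_) ?_
      · have i1 : Integrable φ := hφ.1.continuous.integrable_of_hasCompactSupport hφ.2.1
        have i2 : Integrable fun x => (H x).toReal := integrable_toReal_of_lintegral_ne_top
          hHm.aemeasurable hH
        obtain ⟨B, hB⟩ := hφ.1.continuous.bounded_above_of_compact_support hφ.2.1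
        have i3 : Integrable fun x => φ x * (H x).toReal :=
          i2.bdd_mul hφ.1.continuous.aestronglyMeasurable (Eventually.of_forall hB)
        have i4 : Integrable fun x => C * (‖φ x‖ + ‖φ x * (H x).toReal‖) :=
          (i1.norm.add i3.norm).const_mul _
        refine (i4.congr (Eventually.of_forall fun x => ?_)).integrableOn
        simp only [norm_mul, Real.norm_of_nonneg ENNReal.toReal_nonneg]
        ring
      · filter_upwards [hHtop] with x hxH
        rw [norm_smul]
        by_cases hx : x ∈ tsupport φ
        · refine mul_le_mul_of_nonneg_left ?_ (norm_nonneg _)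
          have := (hC x hx N).2
          rw [norm_gradient]
          have h2 := ENNReal.toReal_mono (ENNReal.mul_ne_top (by simp)
            (ENNReal.add_ne_top.2 ⟨by simp, hxH.ne⟩)) this
          rwa [toReal_enorm, ENNReal.toReal_mul, ENNReal.toReal_add (by simp) hxH.ne] at h2
        · simp [image_eq_zero_of_notMem_tsupport hx]
      · filter_upwards [hG] with x hx
        exact hx.const_smul _
    refine tendsto_nhds_unique t1 ?_
    simp_rw [(hf _).integral_smul_gradient hΩ hφ]
    exact t2.neg
  · obtain ⟨C, hC⟩ := hFb K hKΩ hK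
    exact ⟨C, hC⟩

lemma LocallyLipschitzOn.comp₂ {α : Type*} [PseudoEMetricSpace α] {s : Set α} {f g : α → ℝ}
    {F : ℝ × ℝ → ℝ} (hF : LocallyLipschitz F) (hf : LocallyLipschitzOn s f)
    (hg : LocallyLipschitzOn s g) : LocallyLipschitzOn s fun x => F (f x, g x) := by
  rw [locallyLipschitzOn_iff_restrict] at *
  exact hF.comp (hf.prodMk hg)

lemma LocallyLipschitzOn.mul_real {α : Type*} [PseudoEMetricSpace α] {s : Set α} {f g : α → ℝ}
    (hf : LocallyLipschitzOn s f) (hg : LocallyLipschitzOn s g) :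
    LocallyLipschitzOn s fun x => f x * g x :=
  LocallyLipschitzOn.comp₂ (F := fun p => p.1 * p.2)
    (contDiff_fst.mul contDiff_snd : ContDiff ℝ 1 fun p : ℝ × ℝ => p.1 * p.2).locallyLipschitz hf hg

lemma LocallyLipschitzOn.min_real {α : Type*} [PseudoEMetricSpace α] {s : Set α} {f g : α → ℝ}
    (hf : LocallyLipschitzOn s f) (hg : LocallyLipschitzOn s g) :
    LocallyLipschitzOn s fun x => min (f x) (g x) :=
  LocallyLipschitzOn.comp₂ (F := fun p => min p.1 p.2)
    (LipschitzWith.prod_fst.locallyLipschitz.min LipschitzWith.prod_snd.locallyLipschitz) hf hg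

lemma LocallyLipschitzOn.max_real {α : Type*} [PseudoEMetricSpace α] {s : Set α} {f g : α → ℝ}
    (hf : LocallyLipschitzOn s f) (hg : LocallyLipschitzOn s g) :
    LocallyLipschitzOn s fun x => max (f x) (g x) :=
  LocallyLipschitzOn.comp₂ (F := fun p => max p.1 p.2)
    (LipschitzWith.prod_fst.locallyLipschitz.max LipschitzWith.prod_snd.locallyLipschitz) hf hg

lemma LocallyLipschitzOn.const_real {α : Type*} [PseudoEMetricSpace α] {s : Set α} (c : ℝ) :
    LocallyLipschitzOn s fun _ : α => c := (LocallyLipschitz.const c).locallyLipschitzOn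

lemma LocallyLipschitzOn.sum_real {α κ : Type*} [PseudoEMetricSpace α] {s : Set α} (t : Finset κ)
    {f : κ → α → ℝ} (hf : ∀ i ∈ t, LocallyLipschitzOn s (f i)) :
    LocallyLipschitzOn s fun x => ∑ i ∈ t, f i x := by
  classical
  induction t using Finset.induction_on with
  | empty => simpa using LocallyLipschitzOn.const_real 0
  | insert a t ha ih =>
    simp only [Finset.sum_insert ha]
    exact (hf a (by simp)).add (ih fun i hi => hf i (by simp [hi]))

/-- The piecewise linear function equal to `1` on the ball of radius `R` about `z` and to `0`
outside the ball of radius `2 R`. -/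
def bump {n : ℕ} (z : Eu n) (R : ℝ) (x : Eu n) : ℝ := max 0 (min 1 (2 - dist x z / R))

lemma bump_nonneg {n : ℕ} (z : Eu n) (R : ℝ) (x : Eu n) : 0 ≤ bump z R x := le_max_left _ _

lemma bump_eq_one {n : ℕ} {z : Eu n} {R : ℝ} (hR : 0 < R) {x : Eu n} (hx : x ∈ closedBall z R) :
    bump z R x = 1 := by
  have : dist x z / R ≤ 1 := (div_le_one hR).2 hx
  rw [bump, min_eq_left (by linarith), max_eq_right zero_le_one]

lemma bump_eq_zero {n : ℕ} {z : Eu n} {R : ℝ} (hR : 0 < R) {x : Eu n}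
    (hx : x ∉ closedBall z (2 * R)) : bump z R x = 0 := by
  have : 2 ≤ dist x z / R := by
    rw [le_div_iff₀ hR]; exact (not_le.1 hx).le
  exact max_eq_left ((min_le_right _ _).trans (by linarith))

lemma abs_bump_sub_le {n : ℕ} (z : Eu n) {R : ℝ} (hR : 0 < R) (x y : Eu n) :
    |bump z R y - bump z R x| ≤ R⁻¹ * ‖y - x‖ := by
  have h1 : |bump z R y - bump z R x| ≤ |min 1 (2 - dist y z / R) - min 1 (2 - dist x z / R)| := by
    have := abs_max_sub_max_le_max 0 (min 1 (2 - dist y z / R)) 0 (min 1 (2 - dist x z / R))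
    simpa [bump] using this
  have h2 : |min 1 (2 - dist y z / R) - min 1 (2 - dist x z / R)| ≤
      |(2 - dist y z / R) - (2 - dist x z / R)| := by
    have := abs_min_sub_min_le_max 1 (2 - dist y z / R) 1 (2 - dist x z / R)
    simpa using this
  have h3 : |(2 - dist y z / R) - (2 - dist x z / R)| = R⁻¹ * |dist y z - dist x z| := by
    rw [show (2 - dist y z / R) - (2 - dist x z / R) = - (R⁻¹ * (dist y z - dist x z)) by ring,
      abs_neg, abs_mul, abs_of_pos (inv_pos.2 hR)]
  have h4 : |dist y z - dist x z| ≤ ‖y - x‖ := by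
    rw [← dist_eq_norm]; exact abs_dist_sub_le y x z
  calc _ ≤ R⁻¹ * |dist y z - dist x z| := h3 ▸ h1.trans h2
    _ ≤ _ := mul_le_mul_of_nonneg_left h4 (inv_pos.2 hR).le

lemma locallyLipschitzOn_bump {n : ℕ} {s : Set (Eu n)} (z : Eu n) {R : ℝ} (hR : 0 < R) :
    LocallyLipschitzOn s (bump z R) := by
  refine (LipschitzWith.of_dist_le_mul (K := ⟨R⁻¹, (inv_pos.2 hR).le⟩) fun x y => ?_).locallyLipschitz
    |>.locallyLipschitzOn
  rw [Real.dist_eq, dist_eq_norm]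
  exact abs_bump_sub_le z hR y x

/-- The family of balls of radius `2 R i`, weighted by the inverse radii. -/
def ballWeight {n : ℕ} {ι : Type} (z : ι → Eu n) (R : ι → ℝ) (x : Eu n) : ℝ≥0∞ :=
  ∑' i, (closedBall (z i) (2 * R i)).indicator (fun _ => (ENNReal.ofReal (R i))⁻¹) x

lemma measurable_ballWeight {n : ℕ} {ι : Type} [Countable ι] (z : ι → Eu n) (R : ι → ℝ) :
    Measurable (ballWeight z R) :=
  Measurable.tsum fun _ => measurable_const.indicator measurableSet_closedBall

lemma lintegral_ballWeight_ne_top {n : ℕ} {ι : Type} [Countable ι] {z : ι → Eu n} {R : ι → ℝ}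
    (hR0 : ∀ i, 0 < R i) (hsum : ∑' i, ENNReal.ofReal (R i) ^ ((n : ℝ) - 1) ≠ ⊤) :
    ∫⁻ x, ballWeight z R x ≠ ⊤ := by
  have key : ∀ i, ∫⁻ x, (closedBall (z i) (2 * R i)).indicator
      (fun _ => (ENNReal.ofReal (R i))⁻¹) x =
        ENNReal.ofReal (2 ^ n * unitVol n) * ENNReal.ofReal (R i) ^ ((n : ℝ) - 1) := by
    intro i
    rw [lintegral_indicator measurableSet_closedBall, setLIntegral_const,
      ← ofReal_measureReal measure_closedBall_lt_top.ne,
      volume_real_closedBall _ (by linarith [hR0 i]), ← ENNReal.ofReal_inv_of_pos (hR0 i),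
      ENNReal.ofReal_rpow_of_pos (hR0 i), Real.rpow_sub_one (hR0 i).ne', Real.rpow_natCast,
      ← ENNReal.ofReal_mul (inv_pos.2 (hR0 i)).le,
      ← ENNReal.ofReal_mul (by have := unitVol_pos n; positivity)]
    congr 1
    ring
  unfold ballWeight
  rw [lintegral_tsum fun i => (measurable_const.indicator measurableSet_closedBall).aemeasurable]
  simp only [key]
  rw [ENNReal.tsum_mul_left]
  exact ENNReal.mul_ne_top ENNReal.ofReal_ne_top hsum

lemma ae_finite_mem_closedBall {n : ℕ} {ι : Type} [Countable ι] {z : ι → Eu n} {R : ι → ℝ}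
    (hR0 : ∀ i, 0 < R i) (hR1 : ∀ i, R i ≤ 1)
    (hsum : ∑' i, ENNReal.ofReal (R i) ^ ((n : ℝ) - 1) ≠ ⊤) :
    ∀ᵐ x, {i | x ∈ closedBall (z i) (2 * R i)}.Finite := by
  filter_upwards [ae_lt_top (measurable_ballWeight z R) (lintegral_ballWeight_ne_top hR0 hsum)]
    with x hx
  refine (ENNReal.finite_const_le_of_tsum_ne_top hx.ne one_ne_zero).subset fun i hi => ?_
  simp only [mem_ofPred_eq] at hi ⊢
  rw [indicator_of_mem hi, ENNReal.one_le_inv]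
  simpa using hR1 i

/-- Interpolation from `Φ` to `M` on the balls of a family. -/
def blend {n : ℕ} {ι : Type} (z : ι → Eu n) (R : ι → ℝ) (Φ M : Eu n → ℝ) (x : Eu n) : ℝ :=
  Φ x + min 1 (∑' i, bump (z i) (R i) x) * (M x - Φ x)

lemma abs_blend_sub_le {φ φ' m m' g g' L B h d : ℝ} (hd : 0 ≤ d) (hh : 0 ≤ h) (hL : 0 ≤ L)
    (hB : 0 ≤ B) (hφ : |φ' - φ| ≤ L * d) (hm : |m' - m| ≤ L * d) (hφB : |φ'| ≤ B) (hmB : |m'| ≤ B)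
    (hg0 : 0 ≤ g) (hg1 : g ≤ 1) (hg : |g' - g| ≤ h * d) :
    |(φ' + g' * (m' - φ')) - (φ + g * (m - φ))| ≤ (3 * L + 2 * B) * (1 + h) * d := by
  have e : (φ' + g' * (m' - φ')) - (φ + g * (m - φ)) =
      (φ' - φ) + (g' - g) * (m' - φ') + g * ((m' - m) - (φ' - φ)) := by ring
  have h1 : |(g' - g) * (m' - φ')| ≤ h * d * (2 * B) := by
    rw [abs_mul]
    have : |m' - φ'| ≤ 2 * B := (abs_sub _ _).trans (by linarith)
    exact mul_le_mul hg this (abs_nonneg _) (by positivity)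
  have h2 : |g * ((m' - m) - (φ' - φ))| ≤ 1 * (2 * (L * d)) := by
    rw [abs_mul, abs_of_nonneg hg0]
    have : |(m' - m) - (φ' - φ)| ≤ 2 * (L * d) := (abs_sub _ _).trans (by linarith)
    exact mul_le_mul hg1 this (abs_nonneg _) zero_le_one
  rw [e]
  refine (abs_add_three _ _ _).trans ?_
  have : 0 ≤ L * h * d := by positivity
  have : 0 ≤ B * d := by positivity
  nlinarith

lemma abs_sum_bump_sub_le {n : ℕ} {ι : Type} {z : ι → Eu n} {R : ι → ℝ} (hR0 : ∀ i, 0 < R i)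
    (s : Finset ι) (y : Eu n) :
    ∃ h : ℝ, 0 ≤ h ∧ ENNReal.ofReal h ≤ ballWeight z R y ∧
      ∀ᶠ y' in 𝓝 y, |∑ i ∈ s, bump (z i) (R i) y' - ∑ i ∈ s, bump (z i) (R i) y| ≤ h * ‖y' - y‖ := by
  classical
  let a : ι → ℝ := fun i => (closedBall (z i) (2 * R i)).indicator (fun _ => (R i)⁻¹) y
  have ha : ∀ i, 0 ≤ a i := fun i => indicator_nonneg (fun _ _ => (inv_pos.2 (hR0 i)).le) _
  refine ⟨∑ i ∈ s, a i, Finset.sum_nonneg fun i _ => ha i, ?_, ?_⟩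
  · rw [ENNReal.ofReal_sum_of_nonneg fun i _ => ha i]
    refine le_trans (le_of_eq (Finset.sum_congr rfl fun i _ => ?_)) (ENNReal.sum_le_tsum s)
    by_cases hy : y ∈ closedBall (z i) (2 * R i)
    · simp only [a, indicator_of_mem hy, ENNReal.ofReal_inv_of_pos (hR0 i)]
    · simp only [a, indicator_of_notMem hy, ENNReal.ofReal_zero]
  · have hev : ∀ᶠ y' in 𝓝 y, ∀ i ∈ s, |bump (z i) (R i) y' - bump (z i) (R i) y| ≤ a i * ‖y' - y‖ := by
      refine (Filter.eventually_all_finset s).2 fun i _ => ?_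
      by_cases hy : y ∈ closedBall (z i) (2 * R i)
      · refine Eventually.of_forall fun y' => ?_
        simp only [a, indicator_of_mem hy]
        exact abs_bump_sub_le _ (hR0 i) _ _
      · filter_upwards [isClosed_closedBall.isOpen_compl.mem_nhds hy] with y' hy'
        rw [bump_eq_zero (hR0 i) hy, bump_eq_zero (hR0 i) hy', sub_zero, abs_zero]
        exact mul_nonneg (ha i) (norm_nonneg _)
    filter_upwards [hev] with y' hy'
    rw [← Finset.sum_sub_distrib, Finset.sum_mul]
    exact (Finset.abs_sum_le_sum_abs _ _).trans (Finset.sum_le_sum hy')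

lemma memW11Loc_blend {n : ℕ} {Ω : Set (Eu n)} (hΩ : IsOpen Ω) {Φ M : Eu n → ℝ}
    (hΦ : LocallyLipschitzOn Ω Φ) (hM : LocallyLipschitzOn Ω M) {ι : Type} [Countable ι]
    {z : ι → Eu n} {R : ι → ℝ} (hR0 : ∀ i, 0 < R i) (hR1 : ∀ i, R i ≤ 1)
    (hsum : ∑' i, ENNReal.ofReal (R i) ^ ((n : ℝ) - 1) ≠ ⊤) :
    MemW11Loc Ω (blend z R Φ M) ∧ LocBddFun Ω (blend z R Φ M) := by
  obtain ⟨s, hs⟩ := Filter.exists_seq_tendsto (atTop : Filter (Finset ι))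
  let S : ℕ → Eu n → ℝ := fun N x => ∑ i ∈ s N, bump (z i) (R i) x
  have hS0 : ∀ N x, 0 ≤ S N x := fun N x => Finset.sum_nonneg fun i _ => bump_nonneg _ _ _
  have hfin := ae_finite_mem_closedBall (z := z) hR0 hR1 hsum
  refine memW11Loc_of_tendsto (f := fun N x => Φ x + min 1 (S N x) * (M x - Φ x)) hΩ ?_
    (measurable_ballWeight z R) (lintegral_ballWeight_ne_top hR0 hsum) ?_ ?_ ?_
  · intro N
    exact hΦ.add (((LocallyLipschitzOn.const_real 1).min_real (LocallyLipschitzOn.sum_real (s N)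
      fun i _ => locallyLipschitzOn_bump (z i) (hR0 i))).mul_real (hM.sub hΦ))
  · intro x hx
    obtain ⟨L₁, t₁, ht₁, hL₁⟩ := hΦ hx
    obtain ⟨L₂, t₂, ht₂, hL₂⟩ := hM hx
    rw [hΩ.nhdsWithin_eq hx] at ht₁ ht₂
    have hL : (L₁ : ℝ) ≤ max L₁ L₂ := le_max_left _ _
    have hL' : (L₂ : ℝ) ≤ max L₁ L₂ := le_max_right _ _
    set L : ℝ := max L₁ L₂ with hLdef
    have hL0 : 0 ≤ L := L₁.2.trans hL
    have hbΦ : ∀ᶠ y in 𝓝 x, |Φ y| < |Φ x| + 1 :=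
      (((hΦ.continuousOn.continuousAt (hΩ.mem_nhds hx)).abs).eventually_lt continuousAt_const
        (by linarith))
    have hbM : ∀ᶠ y in 𝓝 x, |M y| < |M x| + 1 :=
      (((hM.continuousOn.continuousAt (hΩ.mem_nhds hx)).abs).eventually_lt continuousAt_const
        (by linarith))
    set B : ℝ := |Φ x| + |M x| + 1 with hBdef
    have hB0 : 0 ≤ B := by positivity
    have hC0 : 0 ≤ 3 * L + 3 * B := by positivity
    refine ⟨(3 * L + 3 * B).toNNReal, ?_⟩
    have hall := (hbΦ.and hbM).and (Filter.eventually_of_mem ht₁ fun _ h => h) |>.and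
      (Filter.eventually_of_mem ht₂ fun _ h => h)
    filter_upwards [eventually_eventually_nhds.2 hall] with y hy N
    obtain ⟨⟨⟨hyΦ, hyM⟩, hy₁⟩, hy₂⟩ := hy.self_of_nhds
    have hg0 : 0 ≤ min 1 (S N y) := le_min zero_le_one (hS0 N y)
    have hg1 : min 1 (S N y) ≤ 1 := min_le_left _ _
    have hΦB : |Φ y| ≤ B := by rw [hBdef]; linarith [abs_nonneg (M x)]
    have hMB : |M y| ≤ B := by rw [hBdef]; linarith [abs_nonneg (Φ x)]
    constructor
    · rw [← ofReal_norm]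
      refine ENNReal.ofReal_le_ofReal ?_
      change |Φ y + min 1 (S N y) * (M y - Φ y)| ≤ 3 * L + 3 * B
      refine (abs_add_le _ _).trans ?_
      rw [abs_mul, abs_of_nonneg hg0]
      have : |M y - Φ y| ≤ 2 * B := (abs_sub _ _).trans (by linarith)
      have := mul_le_mul hg1 this (abs_nonneg _) zero_le_one
      linarith
    · obtain ⟨h, hh0, hhH, hh⟩ := abs_sum_bump_sub_le hR0 (s N) y (z := z)
      have hlip : ∀ᶠ y' in 𝓝 y,
          ‖(Φ y' + min 1 (S N y') * (M y' - Φ y')) - (Φ y + min 1 (S N y) * (M y - Φ y))‖ ≤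
            (3 * L + 2 * B) * (1 + h) * ‖y' - y‖ := by
        filter_upwards [hy, hh] with y' ⟨⟨⟨hy'Φ, hy'M⟩, hy'₁⟩, hy'₂⟩ hy'h
        have e₁ := hL₁.dist_le_mul _ hy'₁ _ hy₁
        have e₂ := hL₂.dist_le_mul _ hy'₂ _ hy₂
        rw [Real.dist_eq, dist_eq_norm] at e₁ e₂
        refine abs_blend_sub_le (norm_nonneg _) hh0 hL0 hB0
          (e₁.trans (mul_le_mul_of_nonneg_right hL (norm_nonneg _)))
          (e₂.trans (mul_le_mul_of_nonneg_right hL' (norm_nonneg _))) ?_ ?_ hg0 hg1 ?_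
        · rw [hBdef]; linarith [abs_nonneg (M x)]
        · rw [hBdef]; linarith [abs_nonneg (Φ x)]
        · have := abs_min_sub_min_le_max 1 (S N y') 1 (S N y)
          rw [sub_self, abs_zero, max_eq_right (abs_nonneg _)] at this
          exact this.trans hy'h
      have := norm_fderiv_le_of_lip' ℝ (by positivity) hlip
      rw [← ofReal_norm]
      calc ENNReal.ofReal _ ≤ ENNReal.ofReal ((3 * L + 3 * B) * (1 + h)) :=
            ENNReal.ofReal_le_ofReal (this.trans (by gcongr; norm_num))
        _ = ENNReal.ofReal (3 * L + 3 * B) * (1 + ENNReal.ofReal h) := by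
            rw [ENNReal.ofReal_mul hC0, ENNReal.ofReal_add zero_le_one hh0, ENNReal.ofReal_one]
        _ ≤ _ := by
            rw [ENNReal.ofReal]
            gcongr
  · filter_upwards [hfin] with x hx _
    refine tendsto_const_nhds.congr' ?_
    filter_upwards [hs.eventually_ge_atTop hx.toFinset] with N hN
    have : ∑' i, bump (z i) (R i) x = S N x :=
      tsum_eq_sum fun i hi => bump_eq_zero (hR0 i) fun h => hi (hN (by simpa using h))
    rw [blend, this]
  · filter_upwards [hfin] with x hx _
    refine ⟨fderiv ℝ (fun y => Φ y + min 1 (∑ i ∈ hx.toFinset, bump (z i) (R i) y) *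
      (M y - Φ y)) x, tendsto_const_nhds.congr' ?_⟩
    filter_upwards [hs.eventually_ge_atTop hx.toFinset] with N hN
    refine Filter.EventuallyEq.fderiv_eq ?_
    have hev : ∀ᶠ y in 𝓝 x, ∀ i ∈ s N, i ∉ hx.toFinset → bump (z i) (R i) y = 0 := by
      refine (Filter.eventually_all_finset _).2 fun i _ => ?_
      by_cases hi : i ∈ hx.toFinset
      · exact Eventually.of_forall fun _ h => absurd hi h
      · have hi' : x ∉ closedBall (z i) (2 * R i) := by simpa using hi
        filter_upwards [isClosed_closedBall.isOpen_compl.mem_nhds hi'] with y hy _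
        exact bump_eq_zero (hR0 i) hy
    filter_upwards [hev] with y hy
    have : ∑ i ∈ hx.toFinset, bump (z i) (R i) y = S N y := Finset.sum_subset hN hy
    rw [this]

lemma memW11Loc_of_locallyLipschitzOn {n : ℕ} {Ω : Set (Eu n)} (hΩ : IsOpen Ω) {M : Eu n → ℝ}
    (hM : LocallyLipschitzOn Ω M) : MemW11Loc Ω M ∧ LocBddFun Ω M := by
  have e : blend (fun i : Empty => i.elim) (fun i : Empty => i.elim) M M = M := by
    funext x; simp [blend]
  rw [← e]
  exact memW11Loc_blend hΩ hM hM (fun i => i.elim) (fun i => i.elim) (by simp)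

lemma le_blend {n : ℕ} {ι : Type} (z : ι → Eu n) (R : ι → ℝ) {Φ M : Eu n → ℝ} {x : Eu n}
    (h : Φ x ≤ M x) : Φ x ≤ blend z R Φ M x :=
  le_add_of_nonneg_right (mul_nonneg (le_min zero_le_one (tsum_nonneg fun _ => bump_nonneg _ _ _))
    (sub_nonneg.2 h))

lemma blend_le {n : ℕ} {ι : Type} (z : ι → Eu n) (R : ι → ℝ) {Φ M : Eu n → ℝ} {x : Eu n}
    (h : Φ x ≤ M x) : blend z R Φ M x ≤ M x := by
  have := mul_le_mul_of_nonneg_right (min_le_left 1 (∑' i, bump (z i) (R i) x)) (sub_nonneg.2 h)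
  rw [blend]
  linarith

lemma blend_of_notMem {n : ℕ} {ι : Type} {z : ι → Eu n} {R : ι → ℝ} (hR0 : ∀ i, 0 < R i)
    (Φ M : Eu n → ℝ) {x : Eu n} (h : x ∉ ⋃ i, closedBall (z i) (2 * R i)) :
    blend z R Φ M x = Φ x := by
  have : ∀ i, bump (z i) (R i) x = 0 := fun i =>
    bump_eq_zero (hR0 i) fun hi => h (mem_iUnion.2 ⟨i, hi⟩)
  simp [blend, this]

lemma ae_blend_eq_of_mem {n : ℕ} {ι : Type} [Countable ι] {z : ι → Eu n} {R : ι → ℝ}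
    (hR0 : ∀ i, 0 < R i) (hR1 : ∀ i, R i ≤ 1)
    (hsum : ∑' i, ENNReal.ofReal (R i) ^ ((n : ℝ) - 1) ≠ ⊤) (Φ M : Eu n → ℝ) :
    ∀ᵐ x, (∃ i, x ∈ closedBall (z i) (R i)) → blend z R Φ M x = M x := by
  filter_upwards [ae_finite_mem_closedBall (z := z) hR0 hR1 hsum] with x hx ⟨i, hi⟩
  have hs : Summable fun i => bump (z i) (R i) x :=
    summable_of_ne_finset_zero (s := hx.toFinset) fun i hi =>
      bump_eq_zero (hR0 i) fun h => hi (by simpa using h)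
  have h1 : 1 ≤ ∑' i, bump (z i) (R i) x :=
    (bump_eq_one (hR0 i) hi).symm.le.trans (hs.le_tsum i fun j _ => bump_nonneg _ _ _)
  rw [blend, min_eq_left h1]
  ring

lemma DensityZeroAt.mono_ae {n : ℕ} {A B : Set (Eu n)} {x : Eu n} (hB : DensityZeroAt B x)
    {U : Set (Eu n)} (hU : U ∈ 𝓝 x) (h : ∀ᵐ y, y ∈ U → y ∈ A → y ∈ B) : DensityZeroAt A x := by
  obtain ⟨δ, hδ, hδU⟩ := Metric.mem_nhds_iff.1 hU
  refine tendsto_of_tendsto_of_tendsto_of_le_of_le' tendsto_const_nhds hB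
    (Eventually.of_forall fun _ => zero_le) ?_
  filter_upwards [Ioo_mem_nhdsGT hδ] with r hr
  refine ENNReal.div_le_div_right (measure_mono_ae ?_) _
  filter_upwards [h] with y hy hyA
  exact ⟨hy (hδU (ball_subset_ball hr.2.le hyA.2)) hyA.1, hyA.2⟩

lemma DensityZeroAt.union {n : ℕ} {A B : Set (Eu n)} {x : Eu n} (hA : DensityZeroAt A x)
    (hB : DensityZeroAt B x) : DensityZeroAt (A ∪ B) x := by
  have := Tendsto.add hA hB
  rw [add_zero] at this
  refine tendsto_of_tendsto_of_tendsto_of_le_of_le tendsto_const_nhds this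
    (fun _ => zero_le) fun r => ?_
  dsimp only
  rw [union_inter_distrib_right, ENNReal.div_add_div_same]
  exact ENNReal.div_le_div_right (measure_union_le _ _) _

lemma not_densityZeroAt_univ {n : ℕ} (x : Eu n) : ¬ DensityZeroAt univ x := by
  intro h
  have h1 : Tendsto (fun r : ℝ => volume (univ ∩ ball x r) / volume (ball x r)) (𝓝[>] 0) (𝓝 1) := by
    refine tendsto_const_nhds.congr' ?_
    filter_upwards [self_mem_nhdsWithin] with r hr
    rw [univ_inter, ENNReal.div_self (measure_ball_pos _ _ hr).ne' measure_ball_lt_top.ne]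
  exact zero_ne_one (tendsto_nhds_unique h h1)

lemma densityZeroAt_empty {n : ℕ} (x : Eu n) : DensityZeroAt ∅ x := by
  simp [DensityZeroAt]

lemma not_densityZeroAt_of_ae {n : ℕ} {A S : Set (Eu n)} {x : Eu n} (hS : DensityZeroAt S x)
    {U : Set (Eu n)} (hU : U ∈ 𝓝 x) (h : ∀ᵐ y, y ∈ U → y ∈ A ∪ S) : ¬ DensityZeroAt A x := fun hA =>
  not_densityZeroAt_univ x ((hA.union hS).mono_ae hU (h.mono fun _ hy hyU _ => hy hyU))

lemma upperRep_eq {n : ℕ} {v Φ : Eu n → ℝ} {S : Set (Eu n)} {x : Eu n} (hS : DensityZeroAt S x)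
    (hv : ∀ y ∉ S, v y = Φ y) (hΦ : ContinuousAt Φ x) : upperRep v x = Φ x := by
  have hmem : ∀ t, Φ x < t → DensityZeroAt {y | t < v y} x := fun t ht => by
    refine hS.mono_ae (hΦ.eventually_lt_const ht) (Eventually.of_forall fun y hy hyv => ?_)
    by_contra hyS
    rw [mem_ofPred_eq, hv y hyS] at hyv
    exact lt_asymm hyv hy
  refine IsGLB.csInf_eq ⟨fun t ht => ?_, fun b hb => ?_⟩ ⟨Φ x + 1, hmem _ (lt_add_one _)⟩
  · by_contra! hlt
    refine not_densityZeroAt_of_ae hS (hΦ.eventually_const_lt hlt)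
      (Eventually.of_forall fun y hy => ?_) ht
    by_cases hyS : y ∈ S
    · exact Or.inr hyS
    · refine Or.inl ?_
      rw [mem_ofPred_eq, hv y hyS]
      exact hy
  · exact le_of_forall_gt_imp_ge_of_dense fun t ht => hb (hmem t ht)

lemma lowerRep_eq {n : ℕ} {v Φ : Eu n → ℝ} {S : Set (Eu n)} {x : Eu n} (hS : DensityZeroAt S x)
    (hv : ∀ y ∉ S, v y = Φ y) (hΦ : ContinuousAt Φ x) : lowerRep v x = Φ x := by
  have hmem : ∀ t, t < Φ x → DensityZeroAt {y | v y < t} x := fun t ht => by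
    refine hS.mono_ae (hΦ.eventually_const_lt ht) (Eventually.of_forall fun y hy hyv => ?_)
    by_contra hyS
    rw [mem_ofPred_eq, hv y hyS] at hyv
    exact lt_asymm hyv hy
  refine IsLUB.csSup_eq ⟨fun t ht => ?_, fun b hb => ?_⟩ ⟨Φ x - 1, hmem _ (sub_one_lt _)⟩
  · by_contra! hlt
    refine not_densityZeroAt_of_ae hS (hΦ.eventually_lt_const hlt)
      (Eventually.of_forall fun y hy => ?_) ht
    by_cases hyS : y ∈ S
    · exact Or.inr hyS
    · refine Or.inl ?_
      rw [mem_ofPred_eq, hv y hyS]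
      exact hy
  · exact le_of_forall_lt_imp_le_of_dense fun t ht => hb (hmem t ht)

lemma preciseRep_eq {n : ℕ} {v Φ : Eu n → ℝ} {S : Set (Eu n)} {x : Eu n} (hS : DensityZeroAt S x)
    (hv : ∀ y ∉ S, v y = Φ y) (hΦ : ContinuousAt Φ x) : preciseRep v x = Φ x := by
  rw [preciseRep, upperRep_eq hS hv hΦ, lowerRep_eq hS hv hΦ]
  ring

lemma upperRep_le {n : ℕ} {u v Φ : Eu n → ℝ} {S U : Set (Eu n)} {x : Eu n} {C : ℝ}
    (hS : DensityZeroAt S x) (hv : ∀ y ∉ S, v y = Φ y) (hΦ : ContinuousAt Φ x) (hU : U ∈ 𝓝 x)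
    (hu : ∀ᵐ y, y ∈ U → |u y| ≤ C) (huv : ∀ᵐ y, y ∈ U → u y ≤ v y) : upperRep u x ≤ Φ x := by
  refine le_of_forall_gt_imp_ge_of_dense fun t ht => csInf_le ⟨-C, fun s hs => ?_⟩ ?_
  · by_contra! hlt
    refine not_densityZeroAt_of_ae (densityZeroAt_empty x) hU ?_ hs
    filter_upwards [hu] with y hy hyU
    exact Or.inl (hlt.trans_le (abs_le.1 (hy hyU)).1)
  · refine hS.mono_ae (inter_mem hU (hΦ.eventually_lt_const ht)) ?_
    filter_upwards [huv] with y hy hyU hyu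
    by_contra hyS
    have := hy hyU.1
    rw [hv y hyS] at this
    exact lt_irrefl _ ((hyu.trans_le this).trans hyU.2)

lemma densityZeroAt_of_upperRep_lt {n : ℕ} {u w : Eu n → ℝ} {U : Set (Eu n)} {x : Eu n} {C t : ℝ}
    (hU : U ∈ 𝓝 x) (hu : ∀ᵐ y, y ∈ U → |u y| ≤ C) (huw : ∀ᵐ y, y ∈ U → w y = u y)
    (ht : upperRep u x < t) : DensityZeroAt {y | t < w y} x := by
  have hne : {t : ℝ | DensityZeroAt {y | t < u y} x}.Nonempty := by
    refine ⟨C, (densityZeroAt_empty x).mono_ae hU ?_⟩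
    filter_upwards [hu] with y hy hyU hyu
    exact absurd ((le_abs_self _).trans (hy hyU)) (not_le.2 hyu)
  obtain ⟨s, hs, hst⟩ := exists_lt_of_csInf_lt hne ht
  refine DensityZeroAt.mono_ae hs hU ?_
  filter_upwards [huw] with y hy hyU hyw
  rw [hy hyU] at hyw
  exact hst.trans hyw

lemma locallyLipschitzOn_thickenedIndicator {n : ℕ} {s : Set (Eu n)} {δ : ℝ} (hδ : 0 < δ)
    (E : Set (Eu n)) : LocallyLipschitzOn s fun x => (thickenedIndicator hδ E x : ℝ) := by
  have := lipschitzWith_thickenedIndicator hδ E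
  exact ((LipschitzWith.of_dist_le_mul fun x y => this.dist_le_mul x y :
    LipschitzWith _ fun x => (thickenedIndicator hδ E x : ℝ)).locallyLipschitz).locallyLipschitzOn

lemma LocallyLipschitzOn.of_eqOn {n : ℕ} {Ω : Set (Eu n)} {f : Eu n → ℝ}
    (h : ∀ x ∈ Ω, ∃ g : Eu n → ℝ, ∃ U ∈ 𝓝 x, LocallyLipschitzOn Ω g ∧ EqOn f g U) :
    LocallyLipschitzOn Ω f := by
  intro x hx
  obtain ⟨g, U, hU, hg, hfg⟩ := h x hx
  obtain ⟨L, t, ht, hL⟩ := hg hx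
  refine ⟨L, t ∩ U, inter_mem ht (mem_nhdsWithin_of_mem_nhds hU), fun y hy y' hy' => ?_⟩
  rw [hfg hy.2, hfg hy'.2]
  exact hL hy.1 hy'.1

lemma exists_majorant {n : ℕ} {Ω : Set (Eu n)} {u : Eu n → ℝ} (hub : LocBddFun Ω u)
    {K : ℕ → Set (Eu n)} (hK : IsExhaustion Ω K) :
    ∃ M : Eu n → ℝ, LocallyLipschitzOn Ω M ∧ ∀ᵐ x, x ∈ Ω → u x ≤ M x := by
  have hC : ∀ m, ∃ C : ℝ, 0 ≤ C ∧ ∀ᵐ x, x ∈ K m → u x ≤ C := fun m => by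
    obtain ⟨C, hC⟩ := hub.2 (K m) (hK.subset m) (hK.isCompact m)
    refine ⟨max C 0, le_max_right _ _, ?_⟩
    filter_upwards [(ae_restrict_iff' (hK.isCompact m).measurableSet).1 hC] with x hx hxK
    exact (le_abs_self _).trans ((hx hxK).trans (le_max_left _ _))
  choose C hC0 hCu using hC
  have hd : ∀ m, ∃ d, 0 < d ∧ thickening d (K m) ⊆ interior (K (m + 1)) := fun m =>
    (hK.isCompact m).exists_thickening_subset_open isOpen_interior (hK.subset_interior m)
  choose d hd0 hd using hd
  let χ : ℕ → Eu n → ℝ := fun m x => C (m + 2) * (1 - (thickenedIndicator (hd0 m) (K m) x : ℝ))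
  have hχ0 : ∀ m x, 0 ≤ χ m x := fun m x => by
    have : (thickenedIndicator (hd0 m) (K m) x : ℝ) ≤ 1 := thickenedIndicator_le_one _ _ _
    exact mul_nonneg (hC0 _) (by linarith)
  have hχK : ∀ m k x, m ≤ k → x ∈ K m → χ k x = 0 := fun m k x hmk hx => by
    simp [χ, -thickenedIndicator_apply, thickenedIndicator_one (hd0 k) (K k) (hK.monotone hmk hx)]
  have hχ1 : ∀ m x, x ∉ K (m + 1) → χ m x = C (m + 2) := fun m x hx => by
    simp [χ, -thickenedIndicator_apply, thickenedIndicator_zero (hd0 m) (K m) fun h => hx (interior_subset (hd m h))]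
  have hχL : ∀ m, LocallyLipschitzOn Ω (χ m) := fun m =>
    (LocallyLipschitzOn.const_real _).mul_real
      ((LocallyLipschitzOn.const_real 1).sub (locallyLipschitzOn_thickenedIndicator (hd0 m) (K m)))
  have hsum : ∀ m x, x ∈ K m → ∑' k, χ k x = ∑ k ∈ Finset.range m, χ k x := fun m x hx =>
    tsum_eq_sum fun k hk => hχK m k x (by simpa using hk) hx
  refine ⟨fun x => C 0 + C 1 + ∑' k, χ k x, LocallyLipschitzOn.of_eqOn fun x hx => ?_, ?_⟩
  · obtain ⟨m, hm⟩ := hK.exists_mem_interior hx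
    refine ⟨fun x => C 0 + C 1 + ∑ k ∈ Finset.range m, χ k x, interior (K m),
      isOpen_interior.mem_nhds hm, (LocallyLipschitzOn.const_real _).add
        (LocallyLipschitzOn.sum_real _ fun k _ => hχL k), fun y hy => ?_⟩
    simp only [hsum m y (interior_subset hy)]
  · filter_upwards [ae_all_iff.2 hCu] with x hx hxΩ
    have hex : ∃ m, x ∈ K m := by simpa using hK.iUnion_eq.symm.subset hxΩ
    classical
    have hpos : 0 ≤ ∑' k, χ k x := tsum_nonneg fun k => hχ0 k x
    have hfind := Nat.find_spec hex
    rcases hm : Nat.find hex with - | - | m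
    · rw [hm] at hfind
      linarith [hx _ hfind, hC0 1]
    · rw [hm] at hfind
      linarith [hx _ hfind, hC0 0]
    · rw [hm] at hfind
      have hnot : x ∉ K (m + 1) := Nat.find_min hex (by omega)
      have : χ m x ≤ ∑' k, χ k x := by
        rw [hsum _ _ hfind]
        exact Finset.single_le_sum (f := fun k => χ k x) (fun k _ => hχ0 k x) (by simp)
      rw [hχ1 m x hnot] at this
      linarith [hx _ hfind, hC0 0, hC0 1]

/-- The function decreasing from `M` to `min M s` as `ψ` decreases from `1` to `0`. -/
def levelFun (M ψ s : ℝ) : ℝ := M - (1 - ψ) * max (M - s) 0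

lemma levelFun_le {M ψ s : ℝ} (hψ : ψ ≤ 1) : levelFun M ψ s ≤ M :=
  sub_le_self _ (mul_nonneg (by linarith) (le_max_right _ _))

lemma le_levelFun {M ψ s a : ℝ} (hψ : 0 ≤ ψ) (haM : a ≤ M) (has : ψ ≠ 1 → a ≤ s) :
    a ≤ levelFun M ψ s := by
  unfold levelFun
  by_cases h : ψ = 1
  · simpa [h] using haM
  · have := has h
    rcases max_cases (M - s) 0 with h | h <;> rw [h.1] <;> nlinarith

lemma levelFun_zero_le (M s : ℝ) : levelFun M 0 s ≤ s := by
  unfold levelFun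
  linarith [le_max_left (M - s) 0]

/-- Pointwise minimum of the functions `φ 0, …, φ ℓ`. -/
def minUpTo {α : Type*} (φ : ℕ → α → ℝ) : ℕ → α → ℝ
  | 0 => φ 0
  | ℓ + 1 => fun x => min (minUpTo φ ℓ x) (φ (ℓ + 1) x)

lemma minUpTo_le {α : Type*} (φ : ℕ → α → ℝ) (x : α) {j ℓ : ℕ} (h : j ≤ ℓ) :
    minUpTo φ ℓ x ≤ φ j x := by
  induction ℓ with
  | zero => rw [Nat.le_zero.1 h]; rfl
  | succ ℓ ih =>
    rcases Nat.le_succ_iff.1 h with h | rfl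
    · exact (min_le_left _ _).trans (ih h)
    · exact min_le_right _ _

lemma le_minUpTo {α : Type*} {φ : ℕ → α → ℝ} {x : α} {ℓ : ℕ} {a : ℝ} (h : ∀ j ≤ ℓ, a ≤ φ j x) :
    a ≤ minUpTo φ ℓ x := by
  induction ℓ with
  | zero => exact h 0 le_rfl
  | succ ℓ ih => exact le_min (ih fun j hj => h j (by omega)) (h _ le_rfl)

lemma locallyLipschitzOn_minUpTo {n : ℕ} {Ω : Set (Eu n)} {φ : ℕ → Eu n → ℝ}
    (h : ∀ j, LocallyLipschitzOn Ω (φ j)) (ℓ : ℕ) : LocallyLipschitzOn Ω (minUpTo φ ℓ) := by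
  induction ℓ with
  | zero => exact h 0
  | succ ℓ ih => exact ih.min_real (h _)

lemma exists_upper_approx {n : ℕ} {Ω : Set (Eu n)} {u w M : Eu n → ℝ} {t : ℕ → ℝ} {ℓ : ℕ} {r : ℝ}
    {K : Set (Eu n)} {ι : Type} {z : ι → Eu n} {R : ι → ℝ}
    (hwu : ∀ᵐ x, x ∈ Ω → w x = u x) (hM : LocallyLipschitzOn Ω M)
    (hMu : ∀ᵐ x, x ∈ Ω → u x ≤ M x) (hr : 0 < r)
    (hcov : ∀ j ≤ ℓ, ∀ᵐ x, x ∈ K → t j < w x →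
      volume.real ({y | t j < w y} ∩ closedBall x r) < thr n * r ^ n →
      ∃ i, x ∈ closedBall (z i) (R i)) :
    ∃ Φ : Eu n → ℝ, LocallyLipschitzOn Ω Φ ∧ (∀ x, Φ x ≤ M x) ∧
      (∀ᵐ x, x ∈ Ω → (∃ i, x ∈ closedBall (z i) (R i)) ∨ u x ≤ Φ x) ∧
      ∀ j ≤ ℓ, ∀ x, ball x r ⊆ K →
        volume.real ({y | t j < w y} ∩ closedBall x (2 * r)) < thr n * r ^ n → Φ x ≤ t j := by
  let D : ℕ → Set (Eu n) := fun j =>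
    {y | thr n * r ^ n ≤ volume.real ({y | t j < w y} ∩ closedBall y r)} ∪ Kᶜ
  let ψ : ℕ → Eu n → ℝ := fun j x => thickenedIndicator hr (D j) x
  have hψ0 : ∀ j x, 0 ≤ ψ j x := fun j x => NNReal.coe_nonneg _
  have hψ1 : ∀ j x, ψ j x ≤ 1 := fun j x => thickenedIndicator_le_one hr (D j) x
  have hψL : ∀ j, LocallyLipschitzOn Ω (ψ j) := fun j => locallyLipschitzOn_thickenedIndicator hr _
  let φ : ℕ → Eu n → ℝ := fun j x => levelFun (M x) (ψ j x) (t j)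
  refine ⟨minUpTo φ ℓ, locallyLipschitzOn_minUpTo (fun j => ?_) ℓ, fun x => ?_, ?_, ?_⟩
  · exact hM.sub (((LocallyLipschitzOn.const_real 1).sub (hψL j)).mul_real
      ((hM.sub (LocallyLipschitzOn.const_real (t j))).max_real (LocallyLipschitzOn.const_real 0)))
  · exact (minUpTo_le φ x (Nat.zero_le ℓ)).trans (levelFun_le (hψ1 0 x))
  · have hcov' : ∀ᵐ x, ∀ j, j ≤ ℓ → x ∈ K → t j < w x →
        volume.real ({y | t j < w y} ∩ closedBall x r) < thr n * r ^ n →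
        ∃ i, x ∈ closedBall (z i) (R i) := by
      refine ae_all_iff.2 fun j => ?_
      by_cases hj : j ≤ ℓ
      · filter_upwards [hcov j hj] with x hx _ using hx
      · exact Eventually.of_forall fun x h => absurd h hj
    filter_upwards [hcov', hwu, hMu] with x hx hxw hxM hxΩ
    by_cases hi : ∃ i, x ∈ closedBall (z i) (R i)
    · exact Or.inl hi
    refine Or.inr (le_minUpTo fun j hj => le_levelFun (hψ0 j x) (hxM hxΩ) fun hne => ?_)
    have hxD : x ∉ D j := fun h => hne (by simp [ψ, -thickenedIndicator_apply, thickenedIndicator_one hr _ h])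
    simp only [D, mem_union, mem_ofPred_eq, mem_compl_iff, not_or, not_le, not_not] at hxD
    rw [← hxw hxΩ]
    by_contra! hlt
    exact hi (hx j hj hxD.2 hlt hxD.1)
  · intro j hj x hxK hvol
    have hx : x ∉ thickening r (D j) := by
      intro h
      obtain ⟨y, hy, hxy⟩ := mem_thickening_iff.1 h
      rcases hy with hy | hy
      · have hsub : {y | t j < w y} ∩ closedBall y r ⊆ {y | t j < w y} ∩ closedBall x (2 * r) :=
          inter_subset_inter_right _ (closedBall_subset_closedBall' (by
            rw [dist_comm] at hxy; linarith))
        have := measureReal_mono (μ := volume) hsub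
          (ne_top_of_le_ne_top measure_closedBall_lt_top.ne (measure_mono inter_subset_right))
        exact absurd (hy.trans this) (not_le.2 hvol)
      · exact hy (hxK (by rwa [mem_ball, dist_comm]))
    have hz : ψ j x = 0 := by simp [ψ, -thickenedIndicator_apply, thickenedIndicator_zero hr _ hx]
    refine (minUpTo_le φ x hj).trans ?_
    simp only [φ, hz]
    exact levelFun_zero_le _ _

lemma DensityZeroAt.eventually_volume_lt {n : ℕ} {E : Set (Eu n)} {x : Eu n}
    (h : DensityZeroAt E x) {r : ℕ → ℝ} (hr : ∀ ℓ, 0 < r ℓ) (hr0 : Tendsto r atTop (𝓝 0)) :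
    ∀ᶠ ℓ in atTop, volume.real (E ∩ closedBall x (2 * r ℓ)) < thr n * r ℓ ^ n := by
  have h3 : Tendsto (fun ℓ => 3 * r ℓ) atTop (𝓝[>] 0) :=
    tendsto_nhdsWithin_iff.2 ⟨by simpa using hr0.const_mul 3,
      Eventually.of_forall fun ℓ => by have := hr ℓ; simp only [mem_Ioi]; positivity⟩
  have hη : 0 < thr n / (3 ^ n * unitVol n) :=
    div_pos (thr_pos n) (mul_pos (by positivity) (unitVol_pos n))
  filter_upwards [(h.comp h3).eventually_lt_const (ENNReal.ofReal_pos.2 hη)] with ℓ hℓ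
  have hrℓ := hr ℓ
  have hb : 0 < 3 * r ℓ := by positivity
  simp only [Function.comp] at hℓ
  rw [ENNReal.div_lt_iff (Or.inl (measure_ball_pos _ _ hb).ne') (Or.inl measure_ball_lt_top.ne),
    ← ofReal_measureReal (measure_ball_lt_top (μ := volume) (x := x)).ne, volume_real_ball _ hb,
    ← ENNReal.ofReal_mul hη.le] at hℓ
  have hlt := (ENNReal.lt_ofReal_iff_toReal_lt (hℓ.trans ENNReal.ofReal_lt_top).ne).1 hℓ
  have e : thr n / (3 ^ n * unitVol n) * ((3 * r ℓ) ^ n * unitVol n) = thr n * r ℓ ^ n := by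
    have := (unitVol_pos n).ne'
    field_simp
    ring
  rw [e] at hlt
  refine (measureReal_mono ?_ ?_).trans_lt hlt
  · exact inter_subset_inter_right _ (closedBall_subset_ball (by linarith))
  · exact ne_top_of_le_ne_top measure_ball_lt_top.ne (measure_mono inter_subset_right)

lemma tendsto_preciseRep_blend {n : ℕ} {u w M : Eu n → ℝ} {K : ℕ → Set (Eu n)} {t : ℕ → ℝ}
    (ht : DenseRange t) {ι : ℕ → Type} {z : ∀ ℓ, ι ℓ → Eu n} {R : ∀ ℓ, ι ℓ → ℝ}
    (hR0 : ∀ ℓ i, 0 < R ℓ i) {Φ : ℕ → Eu n → ℝ} {r : ℕ → ℝ} (hr : ∀ ℓ, 0 < r ℓ)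
    (hr0 : Tendsto r atTop (𝓝 0)) (hmono : Monotone K) {x : Eu n} {U : Set (Eu n)} (hU : U ∈ 𝓝 x)
    (hUK : ∃ m, U ⊆ K m) (hΦc : ∀ ℓ, ContinuousAt (Φ ℓ) x) {C : ℝ}
    (hu : ∀ᵐ y, y ∈ U → |u y| ≤ C) (hwu : ∀ᵐ y, y ∈ U → w y = u y)
    (huv : ∀ ℓ, ∀ᵐ y, y ∈ U → u y ≤ blend (z ℓ) (R ℓ) (Φ ℓ) M y)
    (hΦ : ∀ ℓ, ∀ j ≤ ℓ, ∀ y, ball y (r ℓ) ⊆ K ℓ →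
      volume.real ({y' | t j < w y'} ∩ closedBall y (2 * r ℓ)) < thr n * r ℓ ^ n → Φ ℓ y ≤ t j)
    (hd : ∀ᶠ ℓ in atTop, DensityZeroAt (⋃ i, closedBall (z ℓ i) (2 * R ℓ i)) x) :
    Tendsto (fun ℓ => preciseRep (blend (z ℓ) (R ℓ) (Φ ℓ) M) x) atTop (𝓝 (upperRep u x)) := by
  have hoff : ∀ ℓ, ∀ y ∉ ⋃ i, closedBall (z ℓ i) (2 * R ℓ i),
      blend (z ℓ) (R ℓ) (Φ ℓ) M y = Φ ℓ y := fun ℓ y hy => blend_of_notMem (hR0 ℓ) _ _ hy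
  refine tendsto_order.2 ⟨fun a ha => ?_, fun a ha => ?_⟩
  · filter_upwards [hd] with ℓ hℓ
    rw [preciseRep_eq hℓ (hoff ℓ) (hΦc ℓ)]
    exact ha.trans_le (upperRep_le hℓ (hoff ℓ) (hΦc ℓ) hU hu (huv ℓ))
  · obtain ⟨s, ⟨hs1, hs2⟩, ⟨j, rfl⟩⟩ := ht.exists_mem_open isOpen_Ioo (nonempty_Ioo.2 ha) |>.elim
      fun j hj => (⟨t j, hj, j, rfl⟩ : ∃ s, s ∈ Ioo (upperRep u x) a ∧ ∃ j, t j = s)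
    have hE := densityZeroAt_of_upperRep_lt hU hu hwu hs1
    obtain ⟨m, hm⟩ := hUK
    obtain ⟨δ, hδ, hδU⟩ := Metric.mem_nhds_iff.1 hU
    filter_upwards [hd, hE.eventually_volume_lt hr hr0, hr0.eventually_lt_const hδ,
      eventually_ge_atTop j, eventually_ge_atTop m] with ℓ hℓ hvol hrδ hj hmℓ
    rw [preciseRep_eq hℓ (hoff ℓ) (hΦc ℓ)]
    exact (hΦ ℓ j hj x (((ball_subset_ball hrδ.le).trans hδU).trans (hm.trans (hmono hmℓ)))
      hvol).trans_lt hs2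

lemma exists_sobolev_approx {n : ℕ} (hn : 1 ≤ n) {Ω : Set (Eu n)} (hΩ : IsOpen Ω) {u : Eu n → ℝ}
    (hu : MemBVLoc Ω u) (hub : LocBddFun Ω u) :
    ∃ v : ℕ → Eu n → ℝ,
      (∀ ℓ, MemW11Loc Ω (v ℓ) ∧ LocBddFun Ω (v ℓ)) ∧
      (∀ ℓ, ∀ᵐ x ∂(volume.restrict Ω), u x ≤ v ℓ x ∧ v ℓ x ≤ v 0 x) ∧
      ∀ᵐ x ∂((hm n).restrict Ω),
        Tendsto (fun ℓ => preciseRep (v ℓ) x) atTop (𝓝 (upperRep u x)) := by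
  obtain ⟨K, hK⟩ := exists_isExhaustion hΩ
  obtain ⟨M, hM, hMu⟩ := exists_majorant hub hK
  let w := hub.1.mk u
  have hw : Measurable w := hub.1.stronglyMeasurable_mk.measurable
  have hwu : ∀ᵐ x, x ∈ Ω → w x = u x :=
    (ae_restrict_iff' hΩ.measurableSet).1 (hub.1.ae_eq_mk.mono fun _ h => h.symm)
  obtain ⟨t, htd, ht⟩ := exists_levels hΩ hu hw hwu hK
  have hfam := fun ℓ : ℕ => exists_ball_family ht ℓ (step_pos ℓ)
    (ε := (2⁻¹ : ℝ≥0∞) ^ ℓ) (by simp)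
  choose r ι z R hr hrs hι hR0 hRs hsum hcov using hfam
  have hsum' : ∀ ℓ, ∑' i, ENNReal.ofReal (R ℓ i) ^ ((n : ℝ) - 1) ≠ ⊤ := fun ℓ =>
    ne_top_of_le_ne_top (by simp) (hsum ℓ)
  have hsumall : ∑' ℓ, ∑' i, ENNReal.ofReal (R ℓ i) ^ ((n : ℝ) - 1) ≠ ⊤ := by
    refine ne_top_of_le_ne_top ?_ (ENNReal.tsum_le_tsum hsum)
    rw [ENNReal.tsum_geometric]
    simp
  have hR1 : ∀ ℓ i, R ℓ i ≤ 1 := fun ℓ i => (hRs ℓ i).trans (step_le_one ℓ)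
  have happ := fun ℓ => exists_upper_approx hwu hM hMu (hr ℓ) (hcov ℓ)
  choose Φ hΦL hΦM hΦu hΦt using happ
  let v : ℕ → Eu n → ℝ := fun ℓ => blend (z ℓ) (R ℓ) (Φ ℓ) M
  have huv : ∀ ℓ, ∀ᵐ x, x ∈ Ω → u x ≤ v ℓ x := fun ℓ => by
    filter_upwards [hΦu ℓ, hMu, ae_blend_eq_of_mem (z := z ℓ) (hR0 ℓ) (hR1 ℓ) (hsum' ℓ) (Φ ℓ) M]
      with x hx hxM hxb hxΩ
    rcases hx hxΩ with hi | hi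
    · exact (hxM hxΩ).trans (hxb hi).ge
    · exact hi.trans (le_blend _ _ (hΦM ℓ x))
  refine ⟨fun ℓ => Nat.casesOn ℓ M v, fun ℓ => ?_, fun ℓ => ?_, ?_⟩
  · cases ℓ with
    | zero => exact memW11Loc_of_locallyLipschitzOn hΩ hM
    | succ ℓ => exact memW11Loc_blend hΩ (hΦL ℓ) hM (hR0 ℓ) (hR1 ℓ) (hsum' ℓ)
  · rw [ae_restrict_iff' hΩ.measurableSet]
    cases ℓ with
    | zero => filter_upwards [hMu] with x hx hxΩ using ⟨hx hxΩ, le_rfl⟩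
    | succ ℓ =>
      filter_upwards [huv ℓ] with x hx hxΩ using ⟨hx hxΩ, blend_le _ _ (hΦM ℓ x)⟩
  · rw [ae_restrict_iff' hΩ.measurableSet]
    filter_upwards [hm_ae_eventually_notMem hn hR0 hRs hsumall (z := z) (c := 10) (by norm_num),
      ae_all_iff.2 fun ℓ => hm_ae_densityZeroAt hn (hR0 ℓ) (hsum' ℓ) (z := z ℓ)] with x hx hxd hxΩ
    refine (tendsto_add_atTop_iff_nat 1).1 ?_
    obtain ⟨m, hm⟩ := hK.exists_mem_interior hxΩ
    obtain ⟨C, hC⟩ := hub.2 (K m) (hK.subset m) (hK.isCompact m)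
    rw [ae_restrict_iff' (hK.isCompact m).measurableSet] at hC
    exact tendsto_preciseRep_blend htd hR0 hr
      (squeeze_zero (fun ℓ => (hr ℓ).le) hrs tendsto_step) hK.monotone
      (mem_interior_iff_mem_nhds.1 hm) ⟨m, Subset.rfl⟩
      (fun ℓ => (hΦL ℓ).continuousOn.continuousAt (hΩ.mem_nhds hxΩ)) hC
      (hwu.mono fun y hy hyK => hy (hK.subset m hyK))
      (fun ℓ => (huv ℓ).mono fun y hy hyK => hy (hK.subset m hyK)) hΦt
      (hx.mono fun ℓ hℓ => hxd ℓ hℓ)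

lemma exists_sobolev_approx_zero {Ω : Set (Eu 0)} {u : Eu 0 → ℝ} (hu : LocallyIntegrableOn u Ω)
    (hub : LocBddFun Ω u) :
    ∃ v : ℕ → Eu 0 → ℝ,
      (∀ ℓ, MemW11Loc Ω (v ℓ) ∧ LocBddFun Ω (v ℓ)) ∧
      (∀ ℓ, ∀ᵐ x ∂(volume.restrict Ω), u x ≤ v ℓ x ∧ v ℓ x ≤ v 0 x) ∧
      ∀ᵐ x ∂((hm 0).restrict Ω),
        Tendsto (fun ℓ => preciseRep (v ℓ) x) atTop (𝓝 (upperRep u x)) := by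
  refine ⟨fun _ => u, fun _ => ⟨⟨hu, 0, locallyIntegrableOn_zero, fun _ _ =>
    Subsingleton.elim _ _⟩, hub⟩, fun _ => Eventually.of_forall fun _ => ⟨le_rfl, le_rfl⟩,
    Eventually.of_forall fun x => ?_⟩
  have hc : ContinuousAt u x := continuous_of_const (fun y z => by rw [Subsingleton.elim y z])
    |>.continuousAt
  simp only [preciseRep_eq (densityZeroAt_empty x) (fun _ _ => rfl) hc,
    upperRep_eq (densityZeroAt_empty x) (fun _ _ => rfl) hc]
  exact tendsto_const_nhds

/-- `H^{n-1}`-a.e. approximation of a BV function from above: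
for `u ∈ BV_loc(Ω) ∩ L^∞_loc(Ω)` there are `v_ℓ ∈ W^{1,1}_loc(Ω) ∩ L^∞_loc(Ω)` with
`v_0 ≥ v_ℓ ≥ u` a.e. for all `ℓ` and `v_ℓ* → u⁺` `H^{n-1}`-a.e. on `Ω`. -/
theorem stmt3 {n : ℕ} (Ω : Set (Eu n)) (hΩ : IsOpen Ω) (u : Eu n → ℝ)
    (hu : MemBVLoc Ω u) (hub : LocBddFun Ω u) :
    ∃ v : ℕ → Eu n → ℝ,
      (∀ ℓ, MemW11Loc Ω (v ℓ) ∧ LocBddFun Ω (v ℓ)) ∧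
      (∀ ℓ, ∀ᵐ x ∂(volume.restrict Ω), u x ≤ v ℓ x ∧ v ℓ x ≤ v 0 x) ∧
      ∀ᵐ x ∂((hm n).restrict Ω),
        Tendsto (fun ℓ => preciseRep (v ℓ) x) atTop (𝓝 (upperRep u x)) := by
  rcases Nat.eq_zero_or_pos n with rfl | hn
  · exact exists_sobolev_approx_zero hu.1 hub
  · exact exists_sobolev_approx hn hΩ hu hub
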